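/- If G is a semi-2-tree then π_t(G) = π_t(G, r*) where r* is any simplicial vertex with ecc(r*) = diam(G); that is, the t-pebbling number of G is attained at a simplicial vertex of maximum eccentricity, and equals π_t(T,r*) + (n−1) + b − 2e(T), with T the skeleton, n the number of vertices, and b the number of blocks of G. -/

import Mathlib

open SimpleGraph

/-- A single pebbling step: remove two pebbles from `u`, add one to a neighbor `v`. -/
def PebStep {V : Type} (G : SimpleGraph V) (C C' : V → ℕ) : Prop :=
  ∃ u v : V, G.Adj u v ∧ 2 ≤ C u ∧
    C' u + 2 = C u ∧ C' v = C v + 1 ∧ ∀ w, w ≠ u → w ≠ v → C' w = C w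

/-- `C` is `t`-fold `r`-solvable. -/
def TSolvable {V : Type} (G : SimpleGraph V) (C : V → ℕ) (r : V) (t : ℕ) : Prop :=
  ∃ C', Relation.ReflTransGen (PebStep G) C C' ∧ t ≤ C' r

/-- The `t`-pebbling number of `G` rooted at `r`. -/
noncomputable def piT {V : Type} (G : SimpleGraph V) (r : V) (t : ℕ) : ℕ :=
  sInf {s | ∀ C : V → ℕ, s ≤ ∑ᶠ v, C v → TSolvable G C r t}

/-- The pebbling number of `G` rooted at `r`. -/
noncomputable def pin {V : Type} (G : SimpleGraph V) (r : V) : ℕ := piT G r 1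

/-- The `t`-pebbling number of `G`. -/
noncomputable def piGt {V : Type} (G : SimpleGraph V) (t : ℕ) : ℕ := ⨆ r, piT G r t

/-- The pebbling number of `G`. -/
noncomputable def piG {V : Type} (G : SimpleGraph V) : ℕ := ⨆ r, pin G r

/-- Eccentricity of `r`. -/
noncomputable def eccG {V : Type} (G : SimpleGraph V) (r : V) : ℕ := ⨆ v, G.dist r v

/-- Diameter of `G`. -/
noncomputable def diamG {V : Type} (G : SimpleGraph V) : ℕ := ⨆ u, eccG G u

/-- `G` is a 2-tree: either `K₂` or obtained by adding a 2-simplicial vertex to a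
2-tree. -/
inductive IsTwoTree : {V : Type} → SimpleGraph V → Prop
  | base {V : Type} (G : SimpleGraph V) (e : V ≃ Fin 2)
      (h : ∀ a b : V, G.Adj a b ↔ a ≠ b) : IsTwoTree G
  | extend {V : Type} (G : SimpleGraph V) (v : V)
      (hdeg : (G.neighborSet v).ncard = 2)
      (hcl : G.IsClique (G.neighborSet v))
      (h : IsTwoTree (G.induce {u | u ≠ v})) : IsTwoTree G

/-- A simplicial vertex: its neighborhood is a clique. -/
def IsSimplicial {V : Type} (G : SimpleGraph V) (v : V) : Prop :=
  G.IsClique (G.neighborSet v)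

/-- A 2-path: a 2-tree with exactly two simplicial vertices. -/
def IsTwoPath {V : Type} (G : SimpleGraph V) : Prop :=
  IsTwoTree G ∧ {v | IsSimplicial G v}.ncard = 2

/-- The edges of the `i`-th fan of a fan decomposition with spine `x` and fan
vertices `v i 1, …, v i (k i)`. -/
def FanEdge {V : Type} (x : ℕ → V) (k : ℕ → ℕ) (v : ℕ → ℕ → V) (i : ℕ)
    (a b : V) : Prop :=
  s(a, b) = s(x (i - 1), x i) ∨ s(a, b) = s(x i, x (i + 1)) ∨
  s(a, b) = s(x (i - 1), v i 1) ∨ s(a, b) = s(v i (k i), x (i + 1)) ∨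
  (∃ j, 1 ≤ j ∧ j < k i ∧ s(a, b) = s(v i j, v i (j + 1))) ∨
  (∃ j, 1 ≤ j ∧ j ≤ k i ∧ s(a, b) = s(x i, v i j))

/-- The set of fan vertices of the `i`-th fan. -/
def FanVerts {V : Type} (k : ℕ → ℕ) (v : ℕ → ℕ → V) (i : ℕ) : Set V :=
  {w | ∃ j, 1 ≤ j ∧ j ≤ k i ∧ w = v i j}

/-- `FanData G d x k v` : the data `(x, k, v)` exhibits `G` as an overlapping fan
graph of diameter `d` with spine `x 0, x 1, …, x d` and, for `1 ≤ i ≤ d − 1`, an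
`x_{i−1}x_{i+1}`-fan centered on `x i` with fan vertices `v i 1, …, v i (k i)`;
consecutive fans are opposite-sided or same-sided, and `G` is the union of the
fans. -/
def FanData {V : Type} (G : SimpleGraph V) (d : ℕ) (x : ℕ → V) (k : ℕ → ℕ)
    (v : ℕ → ℕ → V) : Prop :=
  2 ≤ d ∧
  -- the spine is a shortest path between two vertices realizing the diameter
  (∀ u w : V, G.dist u w ≤ d) ∧ G.dist (x 0) (x d) = d ∧
  (∀ i < d, G.Adj (x i) (x (i + 1))) ∧
  (∀ i ≤ d, ∀ l ≤ d, x i = x l → i = l) ∧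
  -- fan structure
  (∀ i, 1 ≤ i → i ≤ d - 1 →
    1 ≤ k i ∧
    G.Adj (x (i - 1)) (v i 1) ∧
    (∀ j, 1 ≤ j → j < k i → G.Adj (v i j) (v i (j + 1))) ∧
    G.Adj (v i (k i)) (x (i + 1)) ∧
    (∀ j, 1 ≤ j → j ≤ k i → G.Adj (x i) (v i j)) ∧
    (∀ j, 1 ≤ j → j ≤ k i → ∀ j', 1 ≤ j' → j' ≤ k i → v i j = v i j' → j = j') ∧
    (∀ j, 1 ≤ j → j ≤ k i → ∀ l ≤ d, v i j ≠ x l)) ∧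
  -- consecutive fans are opposite-sided or same-sided
  (∀ i, 1 ≤ i → i + 1 ≤ d - 1 →
    (FanVerts k v i ∩ FanVerts k v (i + 1) = ∅) ∨
    (v i (k i) = v (i + 1) 1 ∧
      FanVerts k v i ∩ FanVerts k v (i + 1) = {v i (k i)})) ∧
  -- G is the union of the fans: vertices
  (∀ u : V, (∃ l ≤ d, u = x l) ∨
    ∃ i, 1 ≤ i ∧ i ≤ d - 1 ∧ u ∈ FanVerts k v i) ∧
  -- G is the union of the fans: edges
  (∀ a b : V, G.Adj a b → ∃ i, 1 ≤ i ∧ i ≤ d - 1 ∧ FanEdge x k v i a b)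

/-- `G` is an overlapping fan graph. -/
def IsOverlappingFan {V : Type} (G : SimpleGraph V) : Prop :=
  ∃ (d : ℕ) (x : ℕ → V) (k : ℕ → ℕ) (v : ℕ → ℕ → V), FanData G d x k v

/-- Two edges lie in a common block: they are equal or lie on a common cycle. -/
def SameBlockEdge {V : Type} (G : SimpleGraph V) (e₁ e₂ : Sym2 V) : Prop :=
  e₁ = e₂ ∨ ∃ (u : V) (c : G.Walk u u), c.IsCycle ∧ e₁ ∈ c.edges ∧ e₂ ∈ c.edges

/-- `B` is (the vertex set of) a block of `G`: the union of the endpoints of an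
equivalence class of edges under `SameBlockEdge`. -/
def IsBlockOf {V : Type} (G : SimpleGraph V) (B : Set V) : Prop :=
  ∃ e₀ ∈ G.edgeSet, B = {w | ∃ e ∈ G.edgeSet, SameBlockEdge G e₀ e ∧ w ∈ e}

/-- `v` is a cut-vertex of `G`. -/
def IsCutVertex {V : Type} (G : SimpleGraph V) (v : V) : Prop :=
  G.Connected ∧ ¬ (G.induce {u | u ≠ v}).Connected

/-- `G` is a semi-2-tree: connected, every block is a 2-path, and every cut-vertex
is simplicial in every block containing it. -/
def IsSemiTwoTree {V : Type} (G : SimpleGraph V) : Prop :=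
  G.Connected ∧
  (∀ B : Set V, IsBlockOf G B → IsTwoPath (G.induce B)) ∧
  (∀ v : V, IsCutVertex G v → ∀ B : Set V, IsBlockOf G B →
    ∀ h : v ∈ B, IsSimplicial (G.induce B) ⟨v, h⟩)

/-- `E` is the edge set of a spine of the block `B`: a shortest path between the two
simplicial vertices of the 2-path induced on `B`, realizing its diameter. -/
def IsSpineOf {V : Type} (G : SimpleGraph V) (B : Set V) (E : Set (Sym2 V)) : Prop :=
  ∃ (s₁ s₂ : ↥B) (p : (G.induce B).Walk s₁ s₂),
    s₁ ≠ s₂ ∧ IsSimplicial (G.induce B) s₁ ∧ IsSimplicial (G.induce B) s₂ ∧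
    p.IsPath ∧ p.length = (G.induce B).dist s₁ s₂ ∧
    (∀ a b : ↥B, (G.induce B).dist a b ≤ p.length) ∧
    E = (fun e => Sym2.map Subtype.val e) '' {e | e ∈ p.edges}

/-- `T` is a skeleton of the semi-2-tree `G`: the union of spines of its blocks. -/
def IsSkeleton {V : Type} (G T : SimpleGraph V) : Prop :=
  T ≤ G ∧ ∃ S : Set V → Set (Sym2 V),
    (∀ B : Set V, IsBlockOf G B → IsSpineOf G B (S B)) ∧
    T.edgeSet = ⋃ B ∈ {B : Set V | IsBlockOf G B}, S B

section Core

variable {V : Type}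

open Classical in
/-- The configuration with `m` pebbles on `v` and none elsewhere. -/
noncomputable def sg (v : V) (m : ℕ) : V → ℕ := fun w => if w = v then m else 0

theorem sg_same (v : V) (m : ℕ) : sg v m v = m := by simp [sg]

theorem sg_ne {v w : V} (h : w ≠ v) (m : ℕ) : sg v m w = 0 := by simp [sg, h]

theorem sg_add (v : V) (m k : ℕ) : sg v (m + k) = sg v m + sg v k := by
  funext w; simp only [sg, Pi.add_apply]; split_ifs <;> rfl

theorem sg_zero (v : V) : sg v 0 = 0 := by
  funext w; simp [sg]

theorem sum_sg [Fintype V] (v : V) (m : ℕ) : ∑ w, sg v m w = m := by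
  classical
  simp [sg]

theorem pebStep_iff (H : SimpleGraph V) (C C' : V → ℕ) :
    PebStep H C C' ↔ ∃ u v D, H.Adj u v ∧ C = D + sg u 2 ∧ C' = D + sg v 1 := by
  constructor
  · rintro ⟨u, v, huv, h2, hu, hv, hw⟩
    refine ⟨u, v, fun w => C w - sg u 2 w, huv, ?_, ?_⟩
    · funext w
      by_cases h : w = u
      · subst h; simp only [Pi.add_apply, sg_same]; omega
      · simp [sg_ne h]
    · funext w
      by_cases h : w = u
      · subst h
        have := huv.ne
        simp only [Pi.add_apply, sg_same, sg_ne this]; omega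
      · by_cases h' : w = v
        · subst h'; simp only [Pi.add_apply, sg_same, sg_ne h]; omega
        · simp [sg_ne h, sg_ne h', hw w h h']
  · rintro ⟨u, v, D, huv, rfl, rfl⟩
    have h1 := huv.ne
    refine ⟨u, v, huv, ?_, ?_, ?_, ?_⟩
    · simp [sg_same]
    · simp [sg_same, sg_ne h1]
    · simp [sg_same, sg_ne h1.symm]
    · intro w h h'
      simp [sg_ne h, sg_ne h']

/-- `C` can be transformed into a configuration containing `D`. -/
def Reach (H : SimpleGraph V) (C D : V → ℕ) : Prop :=
  ∃ E, Relation.ReflTransGen (PebStep H) C (D + E)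

theorem PebStep.frame {H : SimpleGraph V} {C C' : V → ℕ} (h : PebStep H C C') (E : V → ℕ) :
    PebStep H (C + E) (C' + E) := by
  rw [pebStep_iff] at h ⊢
  obtain ⟨u, v, D, huv, rfl, rfl⟩ := h
  exact ⟨u, v, D + E, huv, by abel, by abel⟩

theorem pebSteps_frame {H : SimpleGraph V} {C C' : V → ℕ}
    (h : Relation.ReflTransGen (PebStep H) C C') (E : V → ℕ) :
    Relation.ReflTransGen (PebStep H) (C + E) (C' + E) := by
  induction h with
  | refl => exact .refl
  | tail _ h ih => exact ih.tail (h.frame E)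

namespace Reach

variable {H : SimpleGraph V} {C C' D D' E : V → ℕ}

theorem of_le (h : D ≤ C) : Reach H C D :=
  ⟨C - D, by rw [add_tsub_cancel_of_le h]⟩

theorem refl (H : SimpleGraph V) (C : V → ℕ) : Reach H C C := of_le le_rfl

theorem zero (H : SimpleGraph V) (C : V → ℕ) : Reach H C 0 := of_le (fun _ => Nat.zero_le _)

theorem trans (h : Reach H C D) (h' : Reach H D E) : Reach H C E := by
  obtain ⟨F, hF⟩ := h
  obtain ⟨F', hF'⟩ := h'
  refine ⟨F' + F, hF.trans ?_⟩
  rw [← add_assoc]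
  exact pebSteps_frame hF' F

theorem add (h : Reach H C D) (h' : Reach H C' D') : Reach H (C + C') (D + D') := by
  obtain ⟨F, hF⟩ := h
  obtain ⟨F', hF'⟩ := h'
  refine ⟨F + F', (pebSteps_frame hF C').trans ?_⟩
  have := pebSteps_frame hF' (D + F)
  rw [add_comm C', add_comm (D' + F')] at this
  convert this using 1
  abel

theorem mono_left (h : C ≤ C') (h' : Reach H C D) : Reach H C' D := (of_le h).trans h'

theorem mono_right (h : D' ≤ D) (h' : Reach H C D) : Reach H C D' := h'.trans (of_le h)

theorem step {u v : V} (h : H.Adj u v) (m : ℕ) : Reach H (sg u (2 * m)) (sg v m) := by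
  induction m with
  | zero => rw [sg_zero, sg_zero]; exact zero _ _
  | succ m ih =>
    have : Reach H (sg u 2) (sg v 1) :=
      ⟨0, .single ((pebStep_iff _ _ _).2 ⟨u, v, 0, h, by simp, by simp⟩)⟩
    have := ih.add this
    rwa [← sg_add, ← sg_add] at this

theorem smul {u v : V} {a : ℕ} (h : Reach H (sg u a) (sg v 1)) (m : ℕ) :
    Reach H (sg u (m * a)) (sg v m) := by
  induction m with
  | zero => rw [sg_zero v]; exact zero _ _
  | succ m ih =>
    have := ih.add h
    rwa [← sg_add, ← sg_add, ← Nat.succ_mul] at this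

theorem sg_mono {v : V} {m k : ℕ} (h : m ≤ k) : sg v m ≤ sg v k := by
  intro w; simp only [sg]; split_ifs <;> simp [h]

theorem tSolvable_iff {r : V} {t : ℕ} : TSolvable H C r t ↔ Reach H C (sg r t) := by
  constructor
  · rintro ⟨C', h, ht⟩
    have hle : sg r t ≤ C' := by
      intro w
      by_cases hw : w = r
      · subst hw; simpa [sg_same]
      · simp [sg_ne hw]
    exact ⟨C' - sg r t, by rwa [add_tsub_cancel_of_le hle]⟩
  · rintro ⟨E, h⟩
    exact ⟨_, h, by simp [sg_same]⟩

theorem sum {ι : Type} (s : Finset ι) (f g : ι → V → ℕ) (h : ∀ i ∈ s, Reach H (f i) (g i)) :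
    Reach H (∑ i ∈ s, f i) (∑ i ∈ s, g i) := by
  classical
  induction s using Finset.induction_on with
  | empty => simpa using refl H 0
  | insert a s ha ih =>
    rw [Finset.sum_insert ha, Finset.sum_insert ha]
    exact (h a (by simp)).add (ih fun i hi => h i (by simp [hi]))

end Reach

theorem sum_sg_apply (F : Finset V) (C : V → ℕ) (w : V) [Decidable (w ∈ F)] :
    (∑ v ∈ F, sg v (C v)) w = if w ∈ F then C w else 0 := by
  classical
  rw [Finset.sum_apply]
  simp only [sg]
  rw [Finset.sum_ite_eq]
  congr

theorem sum_sg_const {ι : Type} (F : Finset ι) (c : V) (f : ι → ℕ) :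
    ∑ v ∈ F, sg c (f v) = sg c (∑ v ∈ F, f v) := by
  classical
  induction F using Finset.induction_on with
  | empty => simp [sg_zero]
  | insert a s ha ih => rw [Finset.sum_insert ha, Finset.sum_insert ha, ih, sg_add]

/-- All pairs on neighbours of `c` can be moved to `c`. -/
theorem Reach.pairs {H : SimpleGraph V} {c : V} (F : Finset V) (hF : ∀ v ∈ F, H.Adj v c)
    (C : V → ℕ) : Reach H (∑ v ∈ F, sg v (C v)) (sg c (∑ v ∈ F, C v / 2)) := by
  rw [← sum_sg_const]
  refine Reach.sum _ _ _ fun v hv => ?_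
  exact (Reach.step (hF v hv) _).mono_left (Reach.sg_mono (Nat.mul_div_le _ _))

open Classical in
/-- The restriction of a configuration to a set. -/
noncomputable def rs (A : Set V) (C : V → ℕ) : V → ℕ := fun v => if v ∈ A then C v else 0

theorem rs_of_mem {A : Set V} {v : V} (h : v ∈ A) (C : V → ℕ) : rs A C v = C v := by simp [rs, h]

theorem rs_of_not_mem {A : Set V} {v : V} (h : v ∉ A) (C : V → ℕ) : rs A C v = 0 := by
  simp [rs, h]

theorem rs_add_rs_compl (A : Set V) (C : V → ℕ) : rs A C + rs Aᶜ C = C := by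
  funext v
  by_cases h : v ∈ A <;> simp [rs, h]

variable [Fintype V]

/-- Any configuration on `A` of size `m * 2 ^ e + κ` can move `m` pebbles to `c`. -/
def Up (H : SimpleGraph V) (A : Set V) (c : V) (e κ : ℕ) : Prop :=
  ∀ m C, (∀ v, v ∉ A → C v = 0) → m * 2 ^ e + κ ≤ ∑ v, C v → Reach H C (sg c m)

theorem sum_rs_add (A : Set V) (C : V → ℕ) : ∑ v, rs A C v + ∑ v, rs Aᶜ C v = ∑ v, C v := by
  rw [← Finset.sum_add_distrib]
  exact Finset.sum_congr rfl fun v _ => congrFun (rs_add_rs_compl A C) v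

namespace Up

variable {H : SimpleGraph V} {A A₁ A₂ B : Set V} {c r s : V} {e κ e₁ e₂ K₁ K₂ d f K : ℕ}

theorem reach (h : Up H A c e κ) {C : V → ℕ} (hC : ∀ v, v ∉ A → C v = 0) :
    Reach H C (sg c ((∑ v, C v - κ) / 2 ^ e)) := by
  by_cases hk : κ ≤ ∑ v, C v
  · apply h _ _ hC
    have := Nat.div_mul_le_self (∑ v, C v - κ) (2 ^ e)
    omega
  · rw [Nat.sub_eq_zero_of_le (by omega), Nat.zero_div, sg_zero]
    exact Reach.zero _ _

theorem mono_set (h : Up H A c e κ) (hB : B ⊆ A) : Up H B c e κ :=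
  fun m C hC hs => h m C (fun v hv => hC v fun hv' => hv (hB hv')) hs

theorem mono_num (h : Up H A c e κ) (hk : κ ≤ K) : Up H A c e K :=
  fun m C hC hs => h m C hC (by omega)

theorem single (H : SimpleGraph V) (c : V) : Up H {c} c 0 0 := by
  intro m C hC hs
  refine Reach.of_le fun w => ?_
  have : C = sg c (C c) := by
    funext w
    by_cases hw : w = c
    · subst hw; rw [sg_same]
    · rw [sg_ne hw, hC w (by simpa using hw)]
  rw [this, sum_sg] at hs
  rw [this]
  apply Reach.sg_mono
  simpa using hs

theorem wedge_arith {a b m e₁ e₂ : ℕ} (h : m * 2 ^ max e₁ e₂ + 2 ^ min e₁ e₂ - 1 ≤ a + b) :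
    m ≤ a / 2 ^ e₁ + b / 2 ^ e₂ := by
  wlog he : e₁ ≤ e₂ generalizing a b e₁ e₂
  · have := this (a := b) (b := a) (e₁ := e₂) (e₂ := e₁)
      (by rw [max_comm, min_comm, add_comm b]; exact h) (by omega)
    omega
  rw [max_eq_right he, min_eq_left he] at h
  have h1 := Nat.div_add_mod a (2 ^ e₁)
  have h2 := Nat.div_add_mod b (2 ^ e₂)
  have h3 := Nat.mod_lt a (Nat.two_pow_pos e₁)
  have h4 := Nat.mod_lt b (Nat.two_pow_pos e₂)
  have h5 : 2 ^ e₁ ≤ 2 ^ e₂ := Nat.pow_le_pow_right (by norm_num) he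
  generalize a / 2 ^ e₁ = x at *
  generalize b / 2 ^ e₂ = y at *
  generalize 2 ^ e₁ = p at *
  generalize 2 ^ e₂ = q at *
  by_contra hlt
  have h6 : (x + y + 1) * q ≤ m * q := Nat.mul_le_mul_right _ (by omega)
  have h7 : p * x ≤ q * x := Nat.mul_le_mul_right _ h5
  have : (x + y + 1) * q = q * x + q * y + q := by ring
  omega

theorem wedge (h₁ : Up H A₁ c e₁ K₁) (h₂ : Up H A₂ c e₂ K₂) :
    Up H (A₁ ∪ A₂) c (max e₁ e₂) (K₁ + K₂ + 2 ^ min e₁ e₂ - 1) := by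
  intro m C hC hs
  have r1 := h₁.reach (C := rs A₁ C) (fun v hv => rs_of_not_mem hv C)
  have r2 := h₂.reach (C := rs A₁ᶜ C) (fun v hv => by
    by_cases h : v ∈ A₁
    · exact rs_of_not_mem (by simpa using h) C
    · rw [rs_of_mem h]; exact hC v (by simp [h, hv]))
  have r := r1.add r2
  rw [rs_add_rs_compl, ← sg_add] at r
  refine r.mono_right (Reach.sg_mono (wedge_arith ?_))
  have := sum_rs_add A₁ C
  have := Nat.two_pow_pos (min e₁ e₂)
  omega

theorem extend (h₁ : Up H A₁ s e K) (h₂ : Up H B r d f) (hs : s ∈ B)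
    (hr : Reach H (sg s (2 ^ d)) (sg r 1)) : Up H (A₁ ∪ B) r (e + d) (K + f) := by
  intro m C hC hsum
  have r1 := h₁.reach (C := rs A₁ C) (fun v hv => rs_of_not_mem hv C)
  have hsplit := sum_rs_add A₁ C
  have hq := Nat.div_add_mod (∑ v, rs A₁ C v - K) (2 ^ e)
  have hq' := Nat.mod_lt (∑ v, rs A₁ C v - K) (Nat.two_pow_pos e)
  have hpe := Nat.two_pow_pos e
  set q := (∑ v, rs A₁ C v - K) / 2 ^ e with hqdef
  have hpow : m * 2 ^ (e + d) = 2 ^ e * (m * 2 ^ d) := by ring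
  by_cases hσ : ∑ v, rs A₁ᶜ C v ≤ f
  · have : m * 2 ^ d ≤ q := by
      rw [hqdef, Nat.le_div_iff_mul_le hpe, mul_comm, ← hpow]
      omega
    have hle : rs A₁ C ≤ C := fun v => by
      have := congrFun (rs_add_rs_compl A₁ C) v
      simp only [Pi.add_apply] at this
      exact this ▸ Nat.le_add_right _ _
    exact ((r1.mono_left hle).mono_right (Reach.sg_mono this)).trans (hr.smul m)
  · have r2 := r1.add (Reach.refl H (rs A₁ᶜ C))
    rw [rs_add_rs_compl] at r2
    refine r2.trans (h₂ _ _ ?_ ?_)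
    · intro v hv
      have hvs : v ≠ s := fun h => hv (h ▸ hs)
      simp only [Pi.add_apply, sg_ne hvs, zero_add]
      by_cases h : v ∈ A₁
      · exact rs_of_not_mem (by simpa using h) C
      · rw [rs_of_mem h]; exact hC v (by simp [h, hv])
    · simp only [Pi.add_apply, Finset.sum_add_distrib, sum_sg]
      by_contra hlt
      have h1 : 2 ^ e * (q + (∑ v, rs A₁ᶜ C v - f) + 1) ≤ 2 ^ e * (m * 2 ^ d) :=
        Nat.mul_le_mul_left _ (by omega)
      have h2 : 2 ^ e * (q + (∑ v, rs A₁ᶜ C v - f) + 1) =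
        2 ^ e * q + 2 ^ e * (∑ v, rs A₁ᶜ C v - f) + 2 ^ e := by ring
      have h3 : 1 * (∑ v, rs A₁ᶜ C v - f) ≤ 2 ^ e * (∑ v, rs A₁ᶜ C v - f) :=
        Nat.mul_le_mul_right _ hpe
      omega

theorem pend (h : Up H A c e K) (hc : H.Adj c r) (F : Finset V) (hF : ∀ v ∈ F, H.Adj v r) :
    Up H (insert r (A ∪ F)) r (e + 1) (K + F.card) := by
  classical
  intro m C hC hsum
  set C₁ := rs (A \ {r}) C with hC₁
  set F' := F.filter (· ∉ A) with hF'
  have hdec : C = sg r (C r) + C₁ + ∑ v ∈ F', sg v (C v) := by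
    funext w
    simp only [Pi.add_apply]
    rw [sum_sg_apply]
    by_cases hw : w = r
    · subst hw
      have : w ∉ F' := fun hh => (hF w (Finset.mem_filter.1 hh).1).ne rfl
      rw [sg_same, hC₁, rs_of_not_mem (by simp), if_neg this]; rfl
    · rw [sg_ne hw]
      by_cases hA : w ∈ A
      · rw [hC₁, rs_of_mem (by simp [hA, hw]), if_neg (by simp [hF', hA])]; simp
      · rw [hC₁, rs_of_not_mem (by simp [hA])]
        by_cases hwF : w ∈ F
        · rw [if_pos (by simp [hF', hA, hwF])]; simp
        · rw [if_neg (by simp [hF', hwF]), hC w (by simp [hw, hA, hwF])]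
  have hC₁A : ∀ v, v ∉ A → C₁ v = 0 := fun v hv => rs_of_not_mem (by simp [hv]) C
  have r1 := (h.reach hC₁A)
  have r2 := r1.trans ((Reach.step hc ((∑ v, C₁ v - K) / 2 ^ e / 2)).mono_left
    (Reach.sg_mono (Nat.mul_div_le _ _)))
  have r3 := ((Reach.refl H (sg r (C r))).add r2).add
    (Reach.pairs F' (fun v hv => hF v (Finset.mem_filter.1 hv).1) C)
  rw [← hdec, ← sg_add, ← sg_add] at r3
  refine r3.mono_right (Reach.sg_mono ?_)
  have hs : ∑ v, C v = C r + ∑ v, C₁ v + ∑ v ∈ F', C v := by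
    conv_lhs => rw [hdec]
    simp only [Pi.add_apply, Finset.sum_add_distrib, sum_sg]
    congr 1
    simp only [sum_sg_apply]
    simp
  have hP : ∑ v ∈ F', C v ≤ 2 * ∑ v ∈ F', C v / 2 + F.card := by
    have h1 : ∑ v ∈ F', C v ≤ ∑ v ∈ F', (2 * (C v / 2) + 1) :=
      Finset.sum_le_sum fun v _ => by omega
    rw [Finset.sum_add_distrib, ← Finset.mul_sum] at h1
    have h2 : F'.card ≤ F.card := Finset.card_filter_le _ _
    simp at h1
    omega
  rw [Nat.div_div_eq_div_mul, ← pow_succ]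
  have hpe : 2 ≤ 2 ^ (e + 1) := by rw [pow_succ]; have := Nat.two_pow_pos e; omega
  have hq := Nat.div_add_mod (∑ v, C₁ v - K) (2 ^ (e + 1))
  have hq' := Nat.mod_lt (∑ v, C₁ v - K) (Nat.two_pow_pos (e + 1))
  generalize (∑ v, C₁ v - K) / 2 ^ (e + 1) = q at *
  generalize ∑ v ∈ F', C v / 2 = P at *
  by_contra hlt
  have h1 : 2 ^ (e + 1) * (C r + q + P + 1) ≤ m * 2 ^ (e + 1) := by
    rw [mul_comm]; exact Nat.mul_le_mul_right _ (by omega)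
  have h2 : 2 ^ (e + 1) * (C r + q + P + 1) =
    2 ^ (e + 1) * q + 2 ^ (e + 1) * (C r + P) + 2 ^ (e + 1) := by ring
  have h3 : 2 * (C r + P) ≤ 2 ^ (e + 1) * (C r + P) := Nat.mul_le_mul_right _ hpe
  omega

theorem edge (h : Up H A c e K) (hc : H.Adj c r) : Up H (insert r A) r (e + 1) K := by
  simpa using h.pend hc ∅ (by simp)

end Up

end Core

section CapSection

variable {V : Type}

/-- The subgraph of `G` formed by the edges with both ends in `A`. -/
def onSet (G : SimpleGraph V) (A : Set V) : SimpleGraph V where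
  Adj u v := G.Adj u v ∧ u ∈ A ∧ v ∈ A
  symm := ⟨fun _ _ h => ⟨h.1.symm, h.2.2, h.2.1⟩⟩
  loopless := ⟨fun _ h => h.1.ne rfl⟩

theorem onSet_univ (G : SimpleGraph V) : onSet G Set.univ = G := by
  ext; simp [onSet]

/-- No pebbling sequence from `C` puts more than `m` pebbles on `r`. -/
def Cap (H : SimpleGraph V) (r : V) (m : ℕ) (C : V → ℕ) : Prop :=
  ∀ C', Relation.ReflTransGen (PebStep H) C C' → C' r ≤ m

namespace Cap

variable {H : SimpleGraph V} {r : V} {m : ℕ} {C C' D : V → ℕ} {A : Set V}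

theorem le (h : Cap H r m C) : C r ≤ m := h C .refl

theorem of_step (h : Cap H r m C) (hs : PebStep H C C') : Cap H r m C' :=
  fun D hD => h D (.head hs hD)

theorem of_invariant (Inv : (V → ℕ) → Prop) (hI : Inv C)
    (hstep : ∀ D D', Inv D → PebStep H D D' → Inv D') (hm : ∀ D, Inv D → D r ≤ m) :
    Cap H r m C := by
  intro C' h
  apply hm
  induction h with
  | refl => exact hI
  | tail _ h ih => exact hstep _ _ ih h

theorem congr (hr : r ∈ A) (hle : ∀ v ∈ A, C v ≤ D v) (h : Cap (onSet H A) r m D) :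
    Cap (onSet H A) r m C := by
  refine of_invariant (fun C => ∃ D, (∀ v ∈ A, C v ≤ D v) ∧ Cap (onSet H A) r m D)
    ⟨D, hle, h⟩ ?_ ?_
  · rintro C C' ⟨D, hle, hD⟩ hs
    rw [pebStep_iff] at hs
    obtain ⟨u, v, E, huv, rfl, rfl⟩ := hs
    refine ⟨D - sg u 2 + sg v 1, ?_, hD.of_step ((pebStep_iff _ _ _).2
      ⟨u, v, D - sg u 2, huv, ?_, rfl⟩)⟩
    · intro w hw
      have := hle w hw
      simp only [Pi.add_apply, Pi.sub_apply] at *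
      omega
    · funext w
      have := hle u huv.2.1
      by_cases hw : w = u
      · subst hw
        simp only [Pi.add_apply, Pi.sub_apply, sg_same] at *; omega
      · simp [sg_ne hw]
  · rintro C ⟨D, hle, hD⟩
    exact (hle r hr).trans hD.le

theorem unframe {j : ℕ} (h : Cap H r m (D + sg r j)) : Cap H r (m - j) D := by
  intro C' hC'
  have := h _ (pebSteps_frame hC' (sg r j))
  simp only [Pi.add_apply, sg_same] at this
  omega

theorem ghost_one (h : Cap H r m C) (v : V) : Cap H r (m + 1) (C + sg v 1) := by
  refine of_invariant (fun C => ∃ D w, C ≤ D + sg w 1 ∧ Cap H r m D) ⟨C, v, le_rfl, h⟩ ?_ ?_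
  · rintro C C' ⟨D, w, hle, hD⟩ hs
    rw [pebStep_iff] at hs
    obtain ⟨u, v, E, huv, rfl, rfl⟩ := hs
    by_cases hu : 2 ≤ D u
    · refine ⟨D - sg u 2 + sg v 1, w, ?_, hD.of_step ((pebStep_iff _ _ _).2
        ⟨u, v, D - sg u 2, huv, ?_, rfl⟩)⟩
      · intro x
        have := hle x
        simp only [Pi.add_apply, Pi.sub_apply] at *
        by_cases hx : x = u
        · subst hx
          simp only [sg_same] at *; omega
        · simp only [sg_ne hx] at *; omega
      · funext x
        by_cases hw : x = u
        · subst hw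
          simp only [Pi.add_apply, Pi.sub_apply, sg_same] at *; omega
        · simp [sg_ne hw]
    · have hwu : w = u := by
        by_contra hne
        have := hle u
        simp only [Pi.add_apply, sg_same, sg_ne (Ne.symm hne)] at this
        omega
      subst hwu
      refine ⟨D, v, ?_, hD⟩
      intro x
      have := hle x
      simp only [Pi.add_apply] at *
      by_cases hx : x = w
      · subst hx
        simp only [sg_same] at *; omega
      · simp only [sg_ne hx] at *; omega
  · rintro C ⟨D, w, hle, hD⟩
    have h1 := hle r
    have h2 := hD.le
    have : sg w 1 r ≤ 1 := by simp only [sg]; split_ifs <;> simp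
    simp only [Pi.add_apply] at h1
    omega

theorem ghost (h : Cap H r m C) (v : V) (j : ℕ) : Cap H r (m + j) (C + sg v j) := by
  induction j with
  | zero => simpa [sg_zero] using h
  | succ j ih => rw [sg_add, ← add_assoc C]; exact ih.ghost_one v

end Cap

/-- `A'` and `A''` meet in `c` only, and every edge inside `A' ∪ A''` lies in one of them. -/
def CutAt (H : SimpleGraph V) (A' A'' : Set V) (c : V) : Prop :=
  c ∈ A' ∧ c ∈ A'' ∧ (∀ v, v ∈ A' → v ∈ A'' → v = c) ∧
  ∀ u v, H.Adj u v → u ∈ A' ∪ A'' → v ∈ A' ∪ A'' → (u ∈ A' ∧ v ∈ A') ∨ (u ∈ A'' ∧ v ∈ A'')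

theorem CutAt.symm {H : SimpleGraph V} {A' A'' : Set V} {c : V} (h : CutAt H A' A'' c) :
    CutAt H A'' A' c :=
  ⟨h.2.1, h.1, fun v h1 h2 => h.2.2.1 v h2 h1, fun u v huv hu hv =>
    (h.2.2.2 u v huv hu.symm hv.symm).symm⟩

open Classical in
theorem Cap.cut {H : SimpleGraph V} {A' A'' : Set V} {c z : V} (hsep : CutAt H A' A'' c)
    (hz : z ∈ A'') {k m : ℕ} {C : V → ℕ} (h1 : Cap (onSet H A') c k C)
    (h2 : Cap (onSet H A'') z m (Function.update C c k)) :
    Cap (onSet H (A' ∪ A'')) z m C := by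
  obtain ⟨hc', hc'', hint, hedge⟩ := hsep
  refine Cap.of_invariant (fun C => ∃ k, Cap (onSet H A') c k C ∧
    Cap (onSet H A'') z m (Function.update C c k)) ⟨k, h1, h2⟩ ?_ ?_
  · clear h1 h2
    rintro C C' ⟨k, h1, h2⟩ hs
    rw [pebStep_iff] at hs
    obtain ⟨u, v, E, huv, rfl, rfl⟩ := hs
    have hne := huv.1.ne
    rcases hedge u v huv.1 huv.2.1 huv.2.2 with ⟨hu, hv⟩ | ⟨hu, hv⟩
    · refine ⟨k, h1.of_step ((pebStep_iff _ _ _).2 ⟨u, v, E, ⟨huv.1, hu, hv⟩, rfl, rfl⟩), ?_⟩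
      refine h2.congr hz fun w hw => ?_
      by_cases hwc : w = c
      · subst hwc; simp
      · have hwA : w ∉ A' := fun h => hwc (hint w h hw)
        have hwu : w ≠ u := fun h => hwA (h ▸ hu)
        have hwv : w ≠ v := fun h => hwA (h ▸ hv)
        simp [Function.update_of_ne hwc, sg_ne hwu, sg_ne hwv]
    · by_cases huc : u = c
      · subst huc
        have hvA : v ∉ A' := fun h => hne (hint v h hv).symm
        have hk : 2 ≤ k := by have := h1.le; simp only [Pi.add_apply, sg_same] at this; omega
        refine ⟨k - 2, h1.unframe.congr hc' fun w hw => ?_, h2.of_step ((pebStep_iff _ _ _).2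
          ⟨u, v, Function.update E u (k - 2), ⟨huv.1, hu, hv⟩, ?_, ?_⟩)⟩
        · have : w ≠ v := fun h => hvA (h ▸ hw)
          simp [sg_ne this]
        · funext w
          by_cases hwu : w = u
          · subst hwu; simp [sg_same]; omega
          · simp [Function.update_of_ne hwu, sg_ne hwu]
        · funext w
          by_cases hwu : w = u
          · subst hwu; simp [sg_ne hne]
          · simp [Function.update_of_ne hwu]
      · by_cases hvc : v = c
        · subst hvc
          have huA : u ∉ A' := fun h => hne (hint u h hu)
          refine ⟨k + 1, Cap.ghost_one (h1.congr hc' fun w hw => by simp) v,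
            h2.of_step ((pebStep_iff _ _ _).2
            ⟨u, v, Function.update E v k, ⟨huv.1, hu, hv⟩, ?_, ?_⟩)⟩
          · funext w
            by_cases hwu : w = v
            · subst hwu; simp [sg_ne hne.symm]
            · simp [Function.update_of_ne hwu]
          · funext w
            by_cases hwu : w = v
            · subst hwu; simp [sg_same]
            · simp [Function.update_of_ne hwu, sg_ne hwu]
        · have huA : u ∉ A' := fun h => huc (hint u h hu)
          have hvA : v ∉ A' := fun h => hvc (hint v h hv)
          refine ⟨k, h1.congr hc' fun w hw => ?_, h2.of_step ((pebStep_iff _ _ _).2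
            ⟨u, v, Function.update E c k, ⟨huv.1, hu, hv⟩, ?_, ?_⟩)⟩
          · have hwu : w ≠ u := fun h => huA (h ▸ hw)
            have hwv : w ≠ v := fun h => hvA (h ▸ hw)
            simp [sg_ne hwu, sg_ne hwv]
          · funext w
            by_cases hwu : w = c
            · subst hwu; simp [sg_ne (Ne.symm huc)]
            · simp [Function.update_of_ne hwu]
          · funext w
            by_cases hwu : w = c
            · subst hwu; simp [sg_ne (Ne.symm hvc)]
            · simp [Function.update_of_ne hwu]
  · rintro D ⟨k, h1, h2⟩
    have e1 := h1.le
    have e2 := h2.le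
    by_cases hzc : z = c
    · subst hzc; simp at e2; omega
    · rwa [Function.update_of_ne hzc] at e2

theorem Cap.eliminate {H : SimpleGraph V} {S : Set V} {s a b r : V} (hs : s ∉ S)
    (ha : a ∈ S) (hb : b ∈ S) (hnb : ∀ v ∈ S, H.Adj s v → v = a ∨ v = b)
    (hab : a = b ∨ H.Adj a b) (hr : r ∈ S) {m : ℕ} {C : V → ℕ}
    (h : ∀ i j, i + j = C s / 2 → Cap (onSet H S) r m (C + sg a i + sg b j)) :
    Cap (onSet H (insert s S)) r m C := by
  refine Cap.of_invariant (fun C => ∀ i j, i + j = C s / 2 →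
    Cap (onSet H S) r m (C + sg a i + sg b j)) h ?_ ?_
  · clear h
    intro C C' h hst
    rw [pebStep_iff] at hst
    obtain ⟨u, v, E, huv, rfl, rfl⟩ := hst
    have hne := huv.1.ne
    intro i j hij
    have hsa : s ≠ a := fun h => hs (h ▸ ha)
    have hsb : s ≠ b := fun h => hs (h ▸ hb)
    rcases huv.2.1 with hu | hu
    · -- moving a pebble out of `s`
      subst hu
      have hv : v ∈ S := huv.2.2.resolve_left hne.symm
      simp only [Pi.add_apply, sg_ne hne, sg_same] at hij h
      rcases hnb v hv huv.1 with rfl | rfl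
      · refine (h (i + 1) j (by omega)).congr hr fun w hw => ?_
        simp only [Pi.add_apply, sg_add]; omega
      · refine (h i (j + 1) (by omega)).congr hr fun w hw => ?_
        simp only [Pi.add_apply, sg_add]; omega
    · rcases huv.2.2 with hv | hv
      · subst hv
        simp only [Pi.add_apply, sg_ne hne.symm, sg_same, add_zero] at hij h
        by_cases hpar : (E v + 1) / 2 = E v / 2
        · refine (h i j (by omega)).congr hr fun w hw => ?_
          have : w ≠ v := fun h => hs (h ▸ hw)
          simp only [Pi.add_apply, sg_ne this]; omega
        · rcases hnb u hu huv.1.symm with rfl | rfl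
          · rcases Nat.eq_zero_or_pos i with hi | hi
            · rcases hab with rfl | hab
              · refine (h 0 (j - 1) (by omega)).congr hr fun w hw => ?_
                have hwv : w ≠ v := fun h => hs (h ▸ hw)
                by_cases hwu : w = u
                · subst hwu
                  simp only [Pi.add_apply, sg_ne hwv, sg_same]; omega
                · simp only [Pi.add_apply, sg_ne hwv, sg_ne hwu]; omega
              · have := (h 0 (j - 1) (by omega)).of_step ((pebStep_iff _ _ _).2
                  ⟨u, b, E + sg b (j - 1), ⟨hab, hu, hb⟩, by rw [sg_zero]; abel, rfl⟩)
                refine this.congr hr fun w hw => ?_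
                have hwv : w ≠ v := fun h => hs (h ▸ hw)
                subst hi
                have hj : j = (j - 1) + 1 := by omega
                rw [hj, sg_add]
                simp [sg_ne hwv, sg_zero]; omega
            · refine (h (i - 1) j (by omega)).congr hr fun w hw => ?_
              have hwv : w ≠ v := fun h => hs (h ▸ hw)
              have := Reach.sg_mono (v := u) (show i ≤ (i - 1) + 1 by omega) w
              have h2 := Reach.sg_mono (v := u) (show 1 ≤ 2 by omega) w
              rw [sg_add] at this
              simp only [Pi.add_apply, sg_ne hwv] at *; omega
          · rcases Nat.eq_zero_or_pos j with hi | hi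
            · rcases hab with rfl | hab
              · refine (h (i - 1) 0 (by omega)).congr hr fun w hw => ?_
                have hwv : w ≠ v := fun h => hs (h ▸ hw)
                by_cases hwu : w = a
                · subst hwu
                  simp only [Pi.add_apply, sg_ne hwv, sg_same]; omega
                · simp only [Pi.add_apply, sg_ne hwv, sg_ne hwu]; omega
              · have := (h (i - 1) 0 (by omega)).of_step ((pebStep_iff _ _ _).2
                  ⟨u, a, E + sg a (i - 1), ⟨hab.symm, hu, ha⟩, by rw [sg_zero]; abel, rfl⟩)
                refine this.congr hr fun w hw => ?_
                have hwv : w ≠ v := fun h => hs (h ▸ hw)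
                subst hi
                have hj : i = (i - 1) + 1 := by omega
                rw [hj, sg_add]
                simp [sg_ne hwv, sg_zero]; omega
            · refine (h i (j - 1) (by omega)).congr hr fun w hw => ?_
              have hwv : w ≠ v := fun h => hs (h ▸ hw)
              have := Reach.sg_mono (v := u) (show j ≤ (j - 1) + 1 by omega) w
              have h2 := Reach.sg_mono (v := u) (show 1 ≤ 2 by omega) w
              rw [sg_add] at this
              simp only [Pi.add_apply, sg_ne hwv] at *; omega
      · have hsu : s ≠ u := fun h => hs (h ▸ hu)
        have hsv : s ≠ v := fun h => hs (h ▸ hv)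
        simp only [Pi.add_apply, sg_ne hsu, sg_ne hsv] at hij h
        refine (h i j hij).of_step ((pebStep_iff _ _ _).2
          ⟨u, v, E + sg a i + sg b j, ⟨huv.1, hu, hv⟩, by abel, by abel⟩)
  · intro D hD
    have := (hD (D s / 2) 0 (by omega)).le
    simp only [Pi.add_apply] at this
    omega

variable [Fintype V]

/-- There is a configuration `X` on `A` of size `κ` such that adding `M` pebbles on `src`
allows no more than `M / 2 ^ e` pebbles to reach `root`. -/
def Low (H : SimpleGraph V) (A : Set V) (root src : V) (e κ : ℕ) : Prop :=
  ∃ X : V → ℕ, (∀ v, v ∉ A → X v = 0) ∧ ∑ v, X v = κ ∧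
    ∀ M, Cap (onSet H A) root (M / 2 ^ e) (sg src M + X)

open Classical in
theorem Low.series {H : SimpleGraph V} {A' A'' : Set V} {c z r : V} {e κ e' κ' : ℕ}
    (hsep : CutAt H A' A'' c) (hr : r ∈ A'') (hz : z ∈ A') (h1 : Low H A' c z e κ)
    (h2 : Low H A'' r c e' κ') : Low H (A' ∪ A'') r z (e + e') (κ + κ') := by
  obtain ⟨X, hX, hXs, hXc⟩ := h1
  obtain ⟨Y, hY, hYs, hYc⟩ := h2
  refine ⟨X + Y, fun v hv => ?_, ?_, fun M => ?_⟩
  · simp only [Set.mem_union, not_or] at hv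
    simp [hX v hv.1, hY v hv.2]
  · simp [Finset.sum_add_distrib, hXs, hYs]
  · have g1 := (hXc M).ghost c (Y c)
    refine Cap.cut hsep hr (g1.congr hsep.1 fun v hv => ?_)
      ((show Cap (onSet H A'') r (M / 2 ^ (e + e')) (sg c (M / 2 ^ e) + Y) by
        have := hYc (M / 2 ^ e)
        rwa [Nat.div_div_eq_div_mul, ← pow_add] at this).congr hr fun v hv => ?_)
    · by_cases hvc : v = c
      · subst hvc; simp [sg_same]; omega
      · have : Y v = 0 := hY v fun h => hvc (hsep.2.2.1 v hv h)
        simp [this]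
    · by_cases hvc : v = c
      · subst hvc; simp [sg_same]
      · have hvA : v ∉ A' := fun h => hvc (hsep.2.2.1 v h hv)
        have hvz : v ≠ z := fun h => hvA (h ▸ hz)
        simp [Function.update_of_ne hvc, sg_ne hvz, sg_ne hvc, hX v hvA]

open Classical in
theorem Low.hang {H : SimpleGraph V} {A' A'' : Set V} {c z r z' : V} {e κ e' κ' : ℕ}
    (hsep : CutAt H A' A'' c) (hr : r ∈ A'') (hz : z ∈ A'') (hz' : z' ∈ A')
    (h2 : Low H A'' r z e κ)
    (h1 : Low H A' c z' e' κ') : Low H (A' ∪ A'') r z e (κ + κ' + 2 ^ e' - 1) := by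
  obtain ⟨X, hX, hXs, hXc⟩ := h1
  obtain ⟨Y, hY, hYs, hYc⟩ := h2
  have hp := Nat.two_pow_pos e'
  refine ⟨X + Y + sg z' (2 ^ e' - 1), fun v hv => ?_, ?_, fun M => ?_⟩
  · simp only [Set.mem_union, not_or] at hv
    have : v ≠ z' := fun h => hv.1 (h ▸ hz')
    simp [hX v hv.1, hY v hv.2, sg_ne this]
  · simp only [Pi.add_apply, Finset.sum_add_distrib, hXs, hYs, sum_sg]; omega
  · have g1 := (hXc (2 ^ e' - 1)).ghost c (Y c + sg z M c)
    rw [Nat.div_eq_of_lt (by omega), zero_add] at g1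
    refine Cap.cut hsep hr (g1.congr hsep.1 fun v hv => ?_)
      ((hYc M).congr hr fun v hv => ?_)
    · by_cases hvc : v = c
      · subst hvc; simp only [Pi.add_apply, sg_same]; omega
      · have hvA : v ∉ A'' := fun h => hvc (hsep.2.2.1 v hv h)
        have hvz : v ≠ z := fun h => hvA (h ▸ hz)
        simp only [Pi.add_apply, hY v hvA, sg_ne hvz]; omega
    · by_cases hvc : v = c
      · subst hvc; simp [add_comm]
      · have hvA : v ∉ A' := fun h => hvc (hsep.2.2.1 v h hv)
        have hvz : v ≠ z' := fun h => hvA (h ▸ hz')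
        simp [Function.update_of_ne hvc, sg_ne hvz, hX v hvA]

theorem Low.single (H : SimpleGraph V) (c : V) : Low H {c} c c 0 0 := by
  refine ⟨0, by simp, by simp, fun M => ?_⟩
  refine Cap.of_invariant (fun C => C = sg c M) (by simp) ?_ ?_
  · rintro D D' - h
    rw [pebStep_iff] at h
    obtain ⟨u, v, E, ⟨h1, h2, h3⟩, -⟩ := h
    exact (h1.ne (h2.trans h3.symm)).elim
  · rintro D rfl
    simp [sg_same]

theorem Low.edge {H : SimpleGraph V} {u v : V} (h : u ≠ v) : Low H {u, v} v u 1 0 := by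
  refine ⟨0, by simp, by simp, fun M => ?_⟩
  refine Cap.eliminate (S := {v}) (a := v) (b := v) (by simpa using h) rfl rfl (by simp)
    (.inl rfl) rfl ?_
  intro i j hij
  obtain ⟨X, hX, hXs, hXc⟩ := Low.single H v
  have hX0 : X = 0 := by
    funext w
    have := (Finset.sum_eq_zero_iff.1 hXs) w (Finset.mem_univ w)
    simpa using this
  subst hX0
  rw [add_zero, sg_same] at hij
  have key : Cap (onSet H {v}) v (M / 2 / 2 ^ 0) (sg u M + 0 + sg v i + sg v j) := by
    refine (hXc (M / 2)).congr (A := {v}) rfl ?_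
    rintro w rfl
    simp [sg_same, sg_ne h.symm]; omega
  simpa using key

end CapSection

section ChainSection

/-- The combinatorial type of a 2-path: the `k`-th vertex is joined to the `k-1`-st and to the
`p k`-th vertex. -/
structure Parents (p : ℕ → ℕ) : Prop where
  p0 : p 0 = 0
  p1 : p 1 = 0
  p2 : p 2 = 0
  pos : ∀ k, 3 ≤ k → 1 ≤ p k
  next : ∀ k, 1 ≤ k → p (k + 1) = p k ∨ p (k + 1) = k - 1

/-- The distance of the `k`-th vertex to the `0`-th one. -/
def lev (p : ℕ → ℕ) (k : ℕ) : ℕ :=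
  if h : 1 ≤ k ∧ p k < k then lev p (p k) + 1 else 0
termination_by k
decreasing_by exact h.2

namespace Parents

variable {p : ℕ → ℕ} (hp : Parents p)
include hp

theorem lt {k : ℕ} (hk : 2 ≤ k) : p k + 2 ≤ k := by
  induction k, hk using Nat.le_induction with
  | base => simp [hp.p2]
  | succ k hk ih => rcases hp.next k (by omega) with h | h <;> omega

theorem lt' {k : ℕ} (hk : 1 ≤ k) : p k < k := by
  rcases Nat.lt_or_ge k 2 with h | h
  · obtain rfl : k = 1 := by omega
    simp [hp.p1]
  · have := hp.lt h; omega

theorem mono {j k : ℕ} (h : j ≤ k) : p j ≤ p k := by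
  induction k, h using Nat.le_induction with
  | base => rfl
  | succ k hk ih =>
    rcases Nat.eq_zero_or_pos k with rfl | h0
    · have : j = 0 := by omega
      subst this; simp [hp.p0]
    · rcases hp.next k h0 with h | h
      · omega
      · rcases Nat.lt_or_ge k 2 with h2 | h2
        · obtain rfl : k = 1 := by omega
          rw [hp.p1] at ih; omega
        · have := hp.lt h2; omega

theorem lev_zero : lev p 0 = 0 := by
  have := hp.p0
  rw [lev]; simp

theorem lev_eq {k : ℕ} (hk : 1 ≤ k) : lev p k = lev p (p k) + 1 := by
  rw [lev, dif_pos ⟨hk, hp.lt' hk⟩]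

theorem lev_one : lev p 1 = 1 := by rw [hp.lev_eq le_rfl, hp.p1, hp.lev_zero]

theorem lev_two : lev p 2 = 1 := by rw [hp.lev_eq (by norm_num), hp.p2, hp.lev_zero]

theorem lev_mono {j k : ℕ} (h : j ≤ k) : lev p j ≤ lev p k := by
  induction k using Nat.strong_induction_on generalizing j with
  | _ k ih =>
    rcases Nat.eq_zero_or_pos j with rfl | hj
    · rw [hp.lev_zero]; omega
    · rw [hp.lev_eq hj, hp.lev_eq (by omega : 1 ≤ k)]
      have := ih (p k) (hp.lt' (by omega)) (hp.mono h)
      omega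

theorem lev_succ (k : ℕ) : lev p (k + 1) ≤ lev p k + 1 := by
  rcases Nat.eq_zero_or_pos k with rfl | hk
  · rw [hp.lev_one, hp.lev_zero]
  · rw [hp.lev_eq (by omega : 1 ≤ k + 1)]
    rcases hp.next k hk with h | h
    · rw [h, hp.lev_eq hk]; omega
    · rw [h]; have := hp.lev_mono (show k - 1 ≤ k by omega); omega

theorem lev_pos {k : ℕ} (hk : 1 ≤ k) : 1 ≤ lev p k := by rw [hp.lev_eq hk]; omega

theorem two_lev_le (k : ℕ) : 2 * lev p k ≤ k + 1 := by
  induction k using Nat.strong_induction_on with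
  | _ k ih =>
    rcases Nat.lt_or_ge k 2 with h | h
    · interval_cases k
      · rw [hp.lev_zero]; omega
      · rw [hp.lev_one]
    · rw [hp.lev_eq (by omega)]
      have := ih (p k) (hp.lt' (by omega))
      have := hp.lt h
      omega

theorem fan {i j k : ℕ} (hk : p k = i) (h1 : i + 2 ≤ j) (h2 : j ≤ k) : p j = i := by
  induction k, h2 using Nat.le_induction with
  | base => exact hk
  | succ k hjk ih =>
    rcases hp.next k (by omega) with h | h
    · exact ih (by omega)
    · omega

theorem next_cases {i : ℕ} (hi : 1 ≤ i) : p (i + 1) = p i ∨ p (i + 1) = i - 1 := hp.next i hi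

end Parents

/-- The excess of the `k`-th initial segment. -/
def kap (p : ℕ → ℕ) (k : ℕ) : ℕ := if k = 0 then 0 else k + 1 - 2 * lev p k

theorem Parents.kap_zero {p : ℕ → ℕ} (_ : Parents p) : kap p 0 = 0 := by simp [kap]

theorem Parents.kap_eq {p : ℕ → ℕ} (hp : Parents p) {k : ℕ} (hk : 1 ≤ k) :
    kap p k + 2 * lev p k = k + 1 := by
  have := hp.two_lev_le k
  rw [kap, if_neg (by omega)]; omega

theorem Parents.kap_step {p : ℕ → ℕ} (hp : Parents p) {k : ℕ} (hk : 3 ≤ k) :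
    kap p k + 2 + p k = kap p (p k) + k ∧ lev p k = lev p (p k) + 1 := by
  have h1 := hp.kap_eq (show 1 ≤ k by omega)
  have h2 := hp.kap_eq (hp.pos k hk)
  have h3 := hp.lev_eq (show 1 ≤ k by omega)
  exact ⟨by omega, h3⟩

variable {V : Type}

/-- `y 0, …, y N` is an ordering of a 2-path, with parents given by `p`. -/
structure Chain (G : SimpleGraph V) (y : ℕ → V) (p : ℕ → ℕ) (N : ℕ) : Prop extends Parents p where
  inj : ∀ i j, i ≤ N → j ≤ N → y i = y j → i = j
  adj : ∀ j k, j < k → k ≤ N → (G.Adj (y j) (y k) ↔ j = k - 1 ∨ j = p k)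

/-- The initial segment `y 0, …, y k`. -/
def seg (y : ℕ → V) (k : ℕ) : Set V := {v | ∃ j, j ≤ k ∧ y j = v}

theorem mem_seg {y : ℕ → V} {j k : ℕ} (h : j ≤ k) : y j ∈ seg y k := ⟨j, h, rfl⟩

theorem seg_zero (y : ℕ → V) : seg y 0 = {y 0} := by
  ext v; constructor
  · rintro ⟨j, hj, rfl⟩
    obtain rfl : j = 0 := by omega
    rfl
  · rintro rfl; exact mem_seg le_rfl

theorem seg_succ (y : ℕ → V) (k : ℕ) : seg y (k + 1) = insert (y (k + 1)) (seg y k) := by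
  ext v; constructor
  · rintro ⟨j, hj, rfl⟩
    rcases Nat.lt_or_ge j (k + 1) with h | h
    · exact .inr (mem_seg (by omega))
    · obtain rfl : j = k + 1 := by omega
      exact .inl rfl
  · rintro (rfl | ⟨j, hj, rfl⟩)
    · exact mem_seg le_rfl
    · exact mem_seg (by omega)

theorem seg_mono {y : ℕ → V} {j k : ℕ} (h : j ≤ k) : seg y j ⊆ seg y k := by
  rintro v ⟨i, hi, rfl⟩; exact mem_seg (hi.trans h)

/-- All pairs of pebbles on neighbours of `c` can be moved to `c`. -/
theorem Reach.pairs' {H : SimpleGraph V} {c : V} (y : ℕ → V) (F : Finset ℕ)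
    (hF : ∀ j ∈ F, H.Adj (y j) c) (f : ℕ → ℕ) :
    Reach H (∑ j ∈ F, sg (y j) (f j)) (sg c (∑ j ∈ F, f j / 2)) := by
  rw [← sum_sg_const]
  refine Reach.sum _ _ _ fun v hv => ?_
  exact (Reach.step (hF v hv) _).mono_left (Reach.sg_mono (Nat.mul_div_le _ _))

theorem sum_le_two_mul (F : Finset ℕ) (f : ℕ → ℕ) :
    ∑ j ∈ F, f j ≤ 2 * ∑ j ∈ F, f j / 2 + F.card := by
  have h1 : ∑ v ∈ F, f v ≤ ∑ v ∈ F, (2 * (f v / 2) + 1) := Finset.sum_le_sum fun v _ => by omega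
  rw [Finset.sum_add_distrib, ← Finset.mul_sum] at h1
  simpa using h1

theorem sum_lt_two_mul (F : Finset ℕ) (f : ℕ → ℕ) {j : ℕ} (hj : j ∈ F) (he : f j % 2 = 0) :
    ∑ j ∈ F, f j + 1 ≤ 2 * ∑ j ∈ F, f j / 2 + F.card := by
  have h1 : ∑ v ∈ F, f v < ∑ v ∈ F, (2 * (f v / 2) + 1) :=
    Finset.sum_lt_sum (fun v _ => by omega) ⟨j, hj, by omega⟩
  rw [Finset.sum_add_distrib, ← Finset.mul_sum] at h1
  simp at h1; omega

theorem Reach.path {H : SimpleGraph V} {z : ℕ → V} {a b : ℕ} (hab : a < b)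
    (hz : ∀ t, a ≤ t → t < b → H.Adj (z t) (z (t + 1))) :
    Reach H (sg (z a) 2 + ∑ t ∈ Finset.Ioo a b, sg (z t) 1) (sg (z b) 1) := by
  induction b, hab using Nat.le_induction with
  | base =>
    have : Finset.Ioo a a.succ = ∅ := by ext; simp
    rw [Nat.succ_eq_add_one] at *
    rw [this]
    simpa using Reach.step (hz a le_rfl (by omega)) 1
  | succ b hab ih =>
    have h1 : Finset.Ioo a (b + 1) = insert b (Finset.Ioo a b) := by ext; simp; omega
    rw [h1, Finset.sum_insert (by simp), add_comm (sg (z b) 1), ← add_assoc]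
    refine ((ih fun t h1 h2 => hz t h1 (by omega)).add (Reach.refl H (sg (z b) 1))).trans ?_
    rw [← sg_add]
    exact Reach.step (hz b (by omega) (by omega)) 1

/-- If all the vertices of a path carry an odd number of pebbles and have the common neighbour
`c`, one pebble can be moved along the path, and all the remaining pairs can be moved to `c`. -/
theorem Reach.odd_path {H : SimpleGraph V} {z : ℕ → V} {c : V} {i b : ℕ}
    (hz : ∀ t, i < t → t < b → H.Adj (z t) (z (t + 1))) {f : ℕ → ℕ}
    (hadj : ∀ j ∈ Finset.Ioo i b, H.Adj (z j) c)
    (hodd : ∀ j ∈ Finset.Ioo i b, f j % 2 = 1) (hP : 1 ≤ ∑ j ∈ Finset.Ioo i b, f j / 2) :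
    Reach H (∑ j ∈ Finset.Ioo i b, sg (z j) (f j))
      (sg (z b) 1 + sg c (∑ j ∈ Finset.Ioo i b, f j / 2 - 1)) := by
  obtain ⟨j₀, hj₀, hj₀'⟩ : ∃ j ∈ Finset.Ioo i b, f j / 2 ≠ 0 := by
    by_contra! hcon
    rw [Finset.sum_eq_zero hcon] at hP; omega
  set u : ℕ → ℕ := fun j => if j = j₀ then 2 else if j₀ < j then 1 else 0 with hu
  have hle : ∀ j ∈ Finset.Ioo i b, u j ≤ f j := by
    intro j hj
    have := hodd j hj
    simp only [hu]; split_ifs with h1 h2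
    · subst h1; omega
    · omega
    · omega
  have hsplit : ∑ j ∈ Finset.Ioo i b, sg (z j) (f j) =
      ∑ j ∈ Finset.Ioo i b, sg (z j) (u j) + ∑ j ∈ Finset.Ioo i b, sg (z j) (f j - u j) := by
    rw [← Finset.sum_add_distrib]
    refine Finset.sum_congr rfl fun j hj => ?_
    rw [← sg_add, Nat.add_sub_cancel' (hle j hj)]
  have hus : ∑ j ∈ Finset.Ioo i b, sg (z j) (u j) =
      sg (z j₀) 2 + ∑ t ∈ Finset.Ioo j₀ b, sg (z t) 1 := by
    rw [← Finset.add_sum_erase _ _ hj₀]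
    congr 1
    · simp [hu]
    · have hsub : Finset.Ioo j₀ b ⊆ (Finset.Ioo i b).erase j₀ := by
        intro t ht; simp at ht hj₀ ⊢; omega
      rw [← Finset.sum_subset hsub]
      · refine Finset.sum_congr rfl fun t ht => ?_
        simp only [Finset.mem_Ioo] at ht
        simp only [hu]; rw [if_neg (by omega), if_pos ht.1]
      · intro t ht ht'
        simp at ht ht' hj₀
        simp only [hu]; rw [if_neg ht.1, if_neg (by omega), sg_zero]
  rw [hsplit, hus]
  refine (Reach.path (Finset.mem_Ioo.1 hj₀).2 fun t h1 h2 =>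
    hz t (by simp at hj₀; omega) h2).add
    ((Reach.pairs' z _ hadj (fun j => f j - u j)).mono_right (Reach.sg_mono ?_))
  rw [← Finset.add_sum_erase _ _ hj₀, ← Finset.add_sum_erase _ (fun j => (f j - u j) / 2) hj₀]
  have : ∑ j ∈ (Finset.Ioo i b).erase j₀, f j / 2 ≤
      ∑ j ∈ (Finset.Ioo i b).erase j₀, (f j - u j) / 2 := by
    refine Finset.sum_le_sum fun j hj => ?_
    rw [Finset.mem_erase] at hj
    have := hodd j hj.2
    simp only [hu]; rw [if_neg hj.1]; split_ifs <;> omega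
  simp only [hu, if_true]
  simp only [hu] at this
  omega

namespace Chain

variable {G : SimpleGraph V} {y : ℕ → V} {p : ℕ → ℕ} {N : ℕ}

theorem parents (h : Chain G y p N) : Parents p := h.toParents

theorem adj_pred (h : Chain G y p N) {k : ℕ} (hk : k + 1 ≤ N) : G.Adj (y k) (y (k + 1)) :=
  (h.adj k (k + 1) (by omega) hk).2 (.inl (by omega))

theorem adj_par (h : Chain G y p N) {k : ℕ} (h1 : 1 ≤ k) (hk : k ≤ N) : G.Adj (y (p k)) (y k) :=
  (h.adj _ _ (h.lt' h1) hk).2 (.inr rfl)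

theorem adj_fan (h : Chain G y p N) {i j k : ℕ} (hk : p k = i) (h1 : i < j) (h2 : j ≤ k)
    (hN : k ≤ N) : G.Adj (y i) (y j) := by
  refine (h.adj _ _ h1 (by omega)).2 ?_
  rcases Nat.lt_or_ge j (i + 2) with h3 | h3
  · left; omega
  · right; rw [h.fan hk h3 h2]

theorem sum_sg_y (h : Chain G y p N) (F : Finset ℕ) (hF : ∀ j ∈ F, j ≤ N) (f : ℕ → ℕ) {t : ℕ}
    (ht : t ≤ N) : (∑ j ∈ F, sg (y j) (f j)) (y t) = if t ∈ F then f t else 0 := by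
  rw [Finset.sum_apply]
  have : ∀ j ∈ F, sg (y j) (f j) (y t) = if t = j then f j else 0 := by
    intro j hj
    by_cases htj : t = j
    · subst htj; simp [sg_same]
    · rw [if_neg htj, sg_ne fun hh => htj (h.inj _ _ ht (hF j hj) hh)]
  rw [Finset.sum_congr rfl this]
  simp

theorem sum_sg_y_off (F : Finset ℕ) (f : ℕ → ℕ) {w : V} (hw : ∀ j ∈ F, w ≠ y j) :
    (∑ j ∈ F, sg (y j) (f j)) w = 0 := by
  rw [Finset.sum_apply]
  exact Finset.sum_eq_zero fun j hj => sg_ne (hw j hj) _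

theorem decomp (h : Chain G y p N) {i k : ℕ} (hik : i < k) (hk : k ≤ N) {C : V → ℕ}
    (hC : ∀ v, v ∉ seg y k → C v = 0) :
    C = rs (seg y i) C + ∑ j ∈ Finset.Ioo i k, sg (y j) (C (y j)) + sg (y k) (C (y k)) := by
  funext w
  simp only [Pi.add_apply]
  by_cases hw : w ∈ seg y k
  · obtain ⟨t, ht, rfl⟩ := hw
    rw [h.sum_sg_y _ (fun j hj => by simp at hj; omega) (fun j => C (y j)) (by omega)]
    simp only [Finset.mem_Ioo]
    by_cases h1 : t ≤ i
    · rw [rs_of_mem (mem_seg h1), if_neg (by omega), sg_ne fun hh => ?_]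
      · simp
      · have := h.inj _ _ (by omega) hk hh; omega
    · have h2 : y t ∉ seg y i := by
        rintro ⟨j, hj, hjt⟩
        have := h.inj _ _ (by omega) (by omega) hjt; omega
      rw [rs_of_not_mem h2]
      by_cases h3 : t = k
      · subst h3; simp [sg_same]
      · rw [if_pos (by omega), sg_ne fun hh => h3 (h.inj _ _ (by omega) hk hh)]; simp
  · rw [hC w hw, rs_of_not_mem fun h' => hw (seg_mono hik.le h'), sum_sg_y_off, sg_ne]
    · rintro rfl; exact hw (mem_seg le_rfl)
    · rintro j hj rfl
      simp at hj
      exact hw (mem_seg (by omega))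

theorem decomp_sum [Fintype V] (h : Chain G y p N) {i k : ℕ} (hik : i < k) (hk : k ≤ N)
    {C : V → ℕ} (hC : ∀ v, v ∉ seg y k → C v = 0) :
    ∑ v, C v = ∑ v, rs (seg y i) C v + ∑ j ∈ Finset.Ioo i k, C (y j) + C (y k) := by
  conv_lhs => rw [h.decomp hik hk hC]
  simp only [Pi.add_apply, Finset.sum_add_distrib, sum_sg, Finset.sum_apply]
  rw [Finset.sum_comm]
  simp only [sum_sg]

theorem walk (h : Chain G y p N) {a b : ℕ} (hab : a < b) (hb : b ≤ N) :
    Reach G (sg (y a) 2 + ∑ t ∈ Finset.Ioo a b, sg (y t) 1) (sg (y b) 1) :=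
  Reach.path hab fun t h1 h2 => h.adj_pred (by omega)

theorem side (h : Chain G y p N) {g a b : ℕ} (hab : a < b) (hb : b ≤ N)
    (hg : G.Adj (y g) (y (a + 1))) :
    Reach G (sg (y g) 2 + ∑ t ∈ Finset.Ioo a b, sg (y t) 1) (sg (y b) 1) := by
  rcases Nat.lt_or_ge (a + 1) b with h1 | h1
  · have h2 : Finset.Ioo a b = insert (a + 1) (Finset.Ioo (a + 1) b) := by ext; simp; omega
    rw [h2, Finset.sum_insert (by simp), ← add_assoc]
    refine (((Reach.step hg 1).add (Reach.refl G (sg (y (a + 1)) 1))).add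
      (Reach.refl G _)).trans ?_
    rw [← sg_add]
    exact h.walk h1 hb
  · obtain rfl : b = a + 1 := by omega
    have : Finset.Ioo a (a + 1) = ∅ := by ext; simp
    rw [this]
    simpa using Reach.step hg 1

theorem odd_fan (h : Chain G y p N) {i b : ℕ} (hb : b ≤ N) {f : ℕ → ℕ}
    (hadj : ∀ j ∈ Finset.Ioo i b, G.Adj (y j) (y i))
    (hodd : ∀ j ∈ Finset.Ioo i b, f j % 2 = 1) (hP : 1 ≤ ∑ j ∈ Finset.Ioo i b, f j / 2) :
    Reach G (∑ j ∈ Finset.Ioo i b, sg (y j) (f j))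
      (sg (y b) 1 + sg (y i) (∑ j ∈ Finset.Ioo i b, f j / 2 - 1)) :=
  Reach.odd_path (z := y) (fun _ _ _ => h.adj_pred (by omega)) hadj hodd hP

end Chain

end ChainSection

section ChainUpSection

variable {V : Type} [Fintype V] {G : SimpleGraph V} {y : ℕ → V} {p : ℕ → ℕ} {N : ℕ}

namespace Chain

/-- Either `M` pebbles reach `y i`, or `M - 2` pebbles reach `y i` while two pebbles reach a
prescribed earlier neighbour. -/
def Side (G : SimpleGraph V) (y : ℕ → V) (p : ℕ → ℕ) (i : ℕ) : Prop :=
  ∀ M C g, 2 ≤ M → (∀ v, v ∉ seg y i → C v = 0) →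
    M * 2 ^ lev p i + kap p i ≤ ∑ v, C v + 1 → (g = i - 1 ∨ g = p i) →
    Reach G C (sg (y i) M) ∨ Reach G C (sg (y i) (M - 2) + sg (y g) 2)

theorem kap_one (hp : Parents p) : kap p 1 = 0 := by
  have := hp.kap_eq (k := 1) le_rfl
  rw [hp.lev_one] at this; omega

theorem kap_two (hp : Parents p) : kap p 2 = 1 := by
  have := hp.kap_eq (k := 2) (by norm_num)
  rw [hp.lev_two] at this; omega

theorem up_zero : Up G (seg y 0) (y 0) 0 0 := by
  rw [seg_zero]; exact Up.single G _

theorem up_one (h : Chain G y p N) (hN : 1 ≤ N) : Up G (seg y 1) (y 1) 1 0 := by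
  rw [seg_succ]
  exact up_zero.edge (h.adj_pred hN)

theorem up_two (h : Chain G y p N) (hN : 2 ≤ N) : Up G (seg y 2) (y 2) 1 1 := by
  have h2 : G.Adj (y 0) (y 2) := by have := h.adj_par (k := 2) (by omega) hN; rwa [h.p2] at this
  have := up_zero.pend h2 {y 1} (by simpa using h.adj_pred hN)
  convert this using 1
  · rw [seg_succ, seg_succ, seg_zero]
    ext; simp
  · simp

theorem reach_of_rs {i : ℕ} {C : V → ℕ} (hup : Up G (seg y i) (y i) (lev p i) (kap p i)) {m : ℕ}
    (hm : m * 2 ^ lev p i + kap p i ≤ ∑ v, rs (seg y i) C v) :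
    Reach G (rs (seg y i) C) (sg (y i) m) :=
  hup m _ (fun _ hv => rs_of_not_mem hv C) hm

/-- The inductive step for moving pebbles to the last vertex. -/
theorem up_step (h : Chain G y p N) {k : ℕ} (hk : 3 ≤ k) (hkN : k ≤ N)
    (hup : Up G (seg y (p k)) (y (p k)) (lev p (p k)) (kap p (p k)))
    (hside : Side G y p (p k)) : Up G (seg y k) (y k) (lev p k) (kap p k) := by
  intro m C hC hsum
  have hp := h.parents
  obtain ⟨hkap, hlev⟩ := hp.kap_step hk
  have hi1 := hp.pos k hk
  have hik := hp.lt (show 2 ≤ k by omega)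
  have hlp := hp.lev_pos hi1
  set i := p k with hi
  set f : ℕ → ℕ := fun j => C (y j) with hf
  have hdec := h.decomp (by omega : i < k) hkN hC
  rw [h.decomp_sum (by omega : i < k) hkN hC, hlev, pow_succ] at hsum
  have hcard : (Finset.Ioo i k).card = k - i - 1 := Nat.card_Ioo i k
  have hadj : ∀ j ∈ Finset.Ioo i k, G.Adj (y j) (y i) := fun j hj => by
    rw [Finset.mem_Ioo] at hj; exact (h.adj_fan rfl hj.1 hj.2.le hkN).symm
  have hcen : G.Adj (y i) (y k) := h.adj_par (by omega) hkN
  have hpow : 2 ≤ 2 ^ lev p i := by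
    calc 2 = 2 ^ 1 := rfl
      _ ≤ _ := Nat.pow_le_pow_right (by norm_num) hlp
  by_cases hq : m ≤ C (y k)
  · refine Reach.of_le fun w => ?_
    by_cases hw : w = y k
    · subst hw; simpa [sg_same]
    · simp [sg_ne hw]
  obtain ⟨m', hm'⟩ : ∃ m', m = m' + C (y k) := ⟨m - C (y k), by omega⟩
  set q := C (y k) with hqdef
  suffices hmain : Reach G (rs (seg y i) C + ∑ j ∈ Finset.Ioo i k, sg (y j) (f j))
      (sg (y k) m') by
    rw [hm', sg_add, hdec]
    exact hmain.add (Reach.refl G _)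
  have hA := Finset.sum_congr (rfl : Finset.Ioo i k = _) fun j _ => rfl (a := C (y j))
  set φ := ∑ j ∈ Finset.Ioo i k, C (y j) with hφ
  set P := ∑ j ∈ Finset.Ioo i k, f j / 2 with hP
  set a := ∑ v, rs (seg y i) C v with ha
  set D := 2 ^ lev p i with hD
  have hma : m' * (D * 2) + kap p k ≤ a + φ := by
    have h1 : m * (D * 2) = m' * (D * 2) + q * (D * 2) := by rw [hm']; ring
    have h2 : q * 1 ≤ q * (D * 2) := Nat.mul_le_mul_left _ (by omega)
    omega
  have hPD : P * 2 ≤ P * D := Nat.mul_le_mul_left _ hpow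
  have hmD : m' * (D * 2) = 2 * m' * D := by ring
  have hpairs := Reach.pairs' (H := G) y _ hadj f
  have hfin : ∀ x, Reach G (rs (seg y i) C + ∑ j ∈ Finset.Ioo i k, sg (y j) (f j))
      (sg (y i) x) → 2 * m' ≤ x → Reach G (rs (seg y i) C +
        ∑ j ∈ Finset.Ioo i k, sg (y j) (f j)) (sg (y k) m') := fun x hx hle =>
    (hx.mono_right (Reach.sg_mono hle)).trans (Reach.step hcen m')
  by_cases hodd : ∀ j ∈ Finset.Ioo i k, f j % 2 = 1
  · have hφle : φ ≤ 2 * P + (Finset.Ioo i k).card := sum_le_two_mul _ _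
    rcases Nat.eq_zero_or_pos P with hP0 | hP1
    · have hf1 : ∀ j ∈ Finset.Ioo i k, f j = 1 := by
        intro j hj
        have h1 := hodd j hj
        have h2 := Finset.sum_eq_zero_iff.1 (hP ▸ hP0) j hj
        omega
      have hg := hp.next_cases hi1
      rcases hside (2 * m') (rs (seg y i) C) (p (i + 1)) (by omega)
        (fun _ hv => rs_of_not_mem hv C) (by rw [← hD]; omega) (by omega) with hr | hr
      · exact hfin (2 * m') (((hr.add (Reach.zero G _))).mono_right (by simp)) le_rfl
      · have hgadj : G.Adj (y (p (i + 1))) (y (i + 1)) := h.adj_par (by omega) (by omega)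
        have hw := h.side (show i < k by omega) hkN hgadj
        have h3 := hr.add (Reach.refl G (∑ j ∈ Finset.Ioo i k, sg (y j) (f j)))
        refine h3.trans ?_
        have h4 : ∑ j ∈ Finset.Ioo i k, sg (y j) (f j) = ∑ j ∈ Finset.Ioo i k, sg (y j) 1 :=
          Finset.sum_congr rfl fun j hj => by rw [hf1 j hj]
        rw [h4, add_assoc]
        have h5 := (Reach.step hcen (m' - 1)).add hw
        rw [← sg_add] at h5
        have e1 : m' - 1 + 1 = m' := by omega
        have e2 : 2 * (m' - 1) = 2 * m' - 2 := by omega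
        rwa [e1, e2] at h5
    · have ho := h.odd_fan hkN hadj hodd hP1
      have hr : Reach G (rs (seg y i) C) (sg (y i) (2 * m' - P - 1)) := by
        rcases Nat.lt_or_ge (2 * m') (P + 1) with hlt | hge
        · have : 2 * m' - P - 1 = 0 := by omega
          rw [this, sg_zero]
          exact Reach.zero _ _
        apply reach_of_rs hup
        rw [← hD, ← ha]
        have h6 : (2 * m' - P - 1) * D + P * D + D = 2 * m' * D := by
          obtain ⟨x, hx⟩ : ∃ x, 2 * m' = x + P + 1 := ⟨2 * m' - P - 1, by omega⟩
          have : 2 * m' - P - 1 = x := by omega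
          rw [this, hx]; ring
        omega
      have h3 := hr.add ho
      refine h3.trans ?_
      have h5 : Reach G (sg (y i) (2 * m' - P - 1) + sg (y i) (P - 1)) (sg (y k) (m' - 1)) := by
        rw [← sg_add]
        exact (Reach.step hcen (m' - 1)).mono_left (Reach.sg_mono (by omega))
      have h6 := h5.add (Reach.refl G (sg (y k) 1))
      rw [← sg_add (y k)] at h6
      have e1 : m' - 1 + 1 = m' := by omega
      rw [e1] at h6
      refine h6.mono_left (le_of_eq ?_)
      rw [add_comm (sg (y k) 1), add_assoc]
  · push Not at hodd
    obtain ⟨j, hj, hje⟩ := hodd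
    have hφle : φ + 1 ≤ 2 * P + (Finset.Ioo i k).card := 
      sum_lt_two_mul _ f hj (by omega)
    by_cases hge : 2 * m' ≤ P
    · exact hfin P (((Reach.zero G _).add hpairs).mono_right (by rw [zero_add])) hge
    · have hr : Reach G (rs (seg y i) C) (sg (y i) (2 * m' - P)) := by
        apply reach_of_rs hup
        rw [← hD, ← ha]
        have h6 : (2 * m' - P) * D + P * D = 2 * m' * D := by
          rw [← add_mul]; congr 1; omega
        omega
      have h3 := hr.add hpairs
      rw [← sg_add] at h3
      exact hfin _ h3 (by omega)

end Chain

end ChainUpSection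

section ChainSideSection

variable {V : Type} [Fintype V] {G : SimpleGraph V} {y : ℕ → V} {p : ℕ → ℕ} {N : ℕ}

omit [Fintype V] in
theorem sg_le_iff {v : V} {m : ℕ} {C : V → ℕ} : sg v m ≤ C ↔ m ≤ C v := by
  constructor
  · intro h; simpa [sg_same] using h v
  · intro h w
    by_cases hw : w = v
    · subst hw; simpa [sg_same]
    · simp [sg_ne hw]

namespace Chain

theorem reach_center {i : ℕ} {C : V → ℕ} (hup : Up G (seg y i) (y i) (lev p i) (kap p i))
    {X Y : ℕ} (h : X * 2 ^ lev p i + kap p i ≤ ∑ v, rs (seg y i) C v + Y * 2 ^ lev p i) :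
    Reach G (rs (seg y i) C) (sg (y i) (X - Y)) := by
  rcases Nat.lt_or_ge X Y with hlt | hge
  · rw [Nat.sub_eq_zero_of_le hlt.le, sg_zero]
    exact Reach.zero _ _
  · obtain ⟨x, rfl⟩ := Nat.exists_eq_add_of_le' hge
    apply reach_of_rs hup
    rw [add_mul] at h
    simp only [add_tsub_cancel_right]
    omega

theorem side_of_zero (h : Chain G y p N) {i : ℕ} (hi : 1 ≤ i)
    (hup : Up G (seg y i) (y i) (lev p i) (kap p i))
    (hz : ∀ M C g, 2 ≤ M → (∀ v, v ∉ seg y i → C v = 0) → C (y i) = 0 →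
      M * 2 ^ lev p i + kap p i ≤ ∑ v, C v + 1 → (g = i - 1 ∨ g = p i) →
      Reach G C (sg (y i) M) ∨ Reach G C (sg (y i) (M - 2) + sg (y g) 2)) : Side G y p i := by
  intro M C g hM hC hs hg
  by_cases h0 : C (y i) = 0
  · exact hz M C g hM hC h0 hs hg
  · left
    have hle : sg (y i) 1 ≤ C := sg_le_iff.2 (Nat.pos_of_ne_zero h0)
    have hdec : C = (C - sg (y i) 1) + sg (y i) 1 := (tsub_add_cancel_of_le hle).symm
    have hsum : ∑ v, C v = ∑ v, (C - sg (y i) 1) v + 1 := by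
      conv_lhs => rw [hdec]
      simp only [Pi.add_apply, Finset.sum_add_distrib, sum_sg]
    have hl : 2 ≤ 2 ^ lev p i := by
      calc 2 = 2 ^ 1 := rfl
        _ ≤ _ := Nat.pow_le_pow_right (by norm_num) (h.parents.lev_pos hi)
    have := hup (M - 1) (C - sg (y i) 1) (fun v hv => by simp [hC v hv]) (by
      have := Nat.mul_le_mul_right (2 ^ lev p i) hM
      rw [Nat.sub_mul]; omega)
    have := this.add (Reach.refl G (sg (y i) 1))
    rw [← hdec, ← sg_add] at this
    rwa [show M - 1 + 1 = M by omega] at this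

omit [Fintype V] in
theorem rs_seg_zero (C : V → ℕ) : rs (seg y 0) C = sg (y 0) (C (y 0)) := by
  rw [seg_zero]
  funext w
  by_cases hw : w = y 0
  · subst hw; rw [rs_of_mem (by simp), sg_same]
  · rw [rs_of_not_mem (by simpa using hw), sg_ne hw]

theorem side_one (h : Chain G y p N) (hN : 1 ≤ N) : Side G y p 1 := by
  have hp := h.parents
  refine h.side_of_zero le_rfl ?_ ?_
  · rw [hp.lev_one, kap_one hp]; exact h.up_one hN
  intro M C g hM hC h0 hs hg
  obtain rfl : g = 0 := by have := hp.p1; omega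
  rw [hp.lev_one, kap_one hp, h.decomp_sum (by norm_num : 0 < 1) hN hC, rs_seg_zero, sum_sg,
    h0] at hs
  have he : Finset.Ioo 0 1 = ∅ := by ext; simp; omega
  rw [he] at hs
  simp at hs
  right
  have hr := (Reach.step (h.adj_pred hN) (M - 2)).add (Reach.refl G (sg (y 0) 2))
  rw [← sg_add] at hr
  exact hr.mono_left (sg_le_iff.2 (by omega))

theorem side_two (h : Chain G y p N) (hN : 2 ≤ N) : Side G y p 2 := by
  have hp := h.parents
  refine h.side_of_zero (by norm_num) ?_ ?_
  · rw [hp.lev_two, kap_two hp]; exact h.up_two hN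
  intro M C g hM hC h0 hs hg
  have he : Finset.Ioo 0 2 = {1} := by ext; simp; omega
  have hd := h.decomp (by norm_num : 0 < 2) hN hC
  rw [hp.lev_two, kap_two hp, h.decomp_sum (by norm_num : 0 < 2) hN hC, rs_seg_zero, sum_sg,
    h0, he, Finset.sum_singleton] at hs
  rw [rs_seg_zero, he, Finset.sum_singleton, h0, sg_zero, add_zero] at hd
  have a01 : G.Adj (y 0) (y 1) := h.adj_pred (by omega)
  have a12 : G.Adj (y 1) (y 2) := h.adj_pred hN
  have a02 : G.Adj (y 0) (y 2) := by have := h.adj_par (k := 2) (by omega) hN; rwa [hp.p2] at this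
  set a := C (y 0)
  set b := C (y 1)
  rw [hd]
  have key : ∀ a b, Reach G (sg (y 0) a + sg (y 1) b) (sg (y 2) (a / 2 + b / 2)) := by
    intro a b
    rw [sg_add]
    exact ((Reach.step a02 (a / 2)).mono_left (Reach.sg_mono (Nat.mul_div_le _ _))).add
      ((Reach.step a12 (b / 2)).mono_left (Reach.sg_mono (Nat.mul_div_le _ _)))
  by_cases hM' : M ≤ a / 2 + b / 2
  · exact .inl ((key a b).mono_right (Reach.sg_mono hM'))
  right
  have e1 : a ≥ 2 → Reach G (sg (y 0) a + sg (y 1) b) (sg (y 2) (M - 2) + sg (y 0) 2) := by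
    intro ha
    refine (((key (a - 2) b).mono_right (Reach.sg_mono (by omega))).add
      (Reach.refl G (sg (y 0) 2))).mono_left (le_of_eq ?_)
    rw [add_right_comm, ← sg_add, Nat.sub_add_cancel ha]
  have e2 : b ≥ 2 → Reach G (sg (y 0) a + sg (y 1) b) (sg (y 2) (M - 2) + sg (y 1) 2) := by
    intro ha
    refine (((key a (b - 2)).mono_right (Reach.sg_mono (by omega))).add
      (Reach.refl G (sg (y 1) 2))).mono_left (le_of_eq ?_)
    rw [add_assoc, ← sg_add, Nat.sub_add_cancel ha]
  rw [hp.p2] at hg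
  rcases hg with rfl | rfl
  · by_cases hb : 2 ≤ b
    · exact e2 hb
    · have h1 := (key (a - 2) b).add (Reach.step a01 1)
      have hb1 : b = 1 := by omega
      rw [hb1] at h1 ⊢
      have h2 := ((Reach.step a02 (M - 2)).add (Reach.step a01 1)).add (Reach.refl G (sg (y 1) 1))
      rw [← sg_add, add_assoc, ← sg_add] at h2
      exact h2.mono_left (add_le_add_left (Reach.sg_mono (by omega)) _)
  · by_cases ha : 2 ≤ a
    · exact e1 ha
    · have ha1 : a = 1 := by omega
      rw [ha1]
      have h2 := ((Reach.step a12 (M - 2)).add (Reach.step a01.symm 1)).add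
        (Reach.refl G (sg (y 0) 1))
      rw [← sg_add, add_assoc, ← sg_add, add_comm (sg (y 1) _)] at h2
      exact h2.mono_left (add_le_add_right (Reach.sg_mono (by omega)) _)

theorem side_step (h : Chain G y p N) {i : ℕ} (hi : 3 ≤ i) (hiN : i ≤ N)
    (hupi : Up G (seg y i) (y i) (lev p i) (kap p i))
    (hup : Up G (seg y (p i)) (y (p i)) (lev p (p i)) (kap p (p i)))
    (hside : Side G y p (p i)) : Side G y p i := by
  have hp := h.parents
  refine h.side_of_zero (by omega) hupi ?_
  clear hupi
  intro M C g hM hC h0 hs hg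
  obtain ⟨hkap, hlev⟩ := hp.kap_step hi
  have hj1 := hp.pos i hi
  have hji := hp.lt (show 2 ≤ i by omega)
  have hlp := hp.lev_pos hj1
  set j := p i with hj
  obtain ⟨b, rfl⟩ : ∃ b, i = b + 1 := ⟨i - 1, by omega⟩
  have hins : Finset.Ioo j (b + 1) = insert b (Finset.Ioo j b) := by ext; simp; omega
  set f : ℕ → ℕ := fun j => C (y j) with hf
  have hdec := h.decomp (by omega : j < b + 1) hiN hC
  rw [h0, sg_zero, add_zero, hins, Finset.sum_insert (by simp)] at hdec
  rw [h.decomp_sum (by omega : j < b + 1) hiN hC, hlev, pow_succ, h0, hins,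
    Finset.sum_insert (by simp)] at hs
  have hcard : (Finset.Ioo j b).card = b - j - 1 := Nat.card_Ioo j b
  have hadj : ∀ t ∈ Finset.Ioo j b, G.Adj (y t) (y j) := fun t ht => by
    rw [Finset.mem_Ioo] at ht; exact (h.adj_fan hj.symm ht.1 (by omega) hiN).symm
  have hjb : G.Adj (y j) (y b) := h.adj_fan hj.symm (by omega) (by omega) hiN
  have hcen : G.Adj (y j) (y (b + 1)) := h.adj_par (by omega) hiN
  have hpow : 2 ≤ 2 ^ lev p j := by
    calc 2 = 2 ^ 1 := rfl
      _ ≤ _ := Nat.pow_le_pow_right (by norm_num) hlp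
  set φ := ∑ t ∈ Finset.Ioo j b, C (y t) with hφ
  set P := ∑ t ∈ Finset.Ioo j b, f t / 2 with hP
  have hcenter : ∀ X Y, X * 2 ^ lev p j + kap p j ≤ ∑ v, rs (seg y j) C v + Y * 2 ^ lev p j →
    Reach G (rs (seg y j) C) (sg (y j) (X - Y)) := fun X Y => reach_center hup
  have hDP : P * 2 ≤ P * 2 ^ lev p j := Nat.mul_le_mul_left _ hpow
  have hD2 : f b / 2 * 2 ≤ f b / 2 * 2 ^ lev p j := Nat.mul_le_mul_left _ hpow
  have hMD : M * (2 ^ lev p j * 2) = 2 * M * 2 ^ lev p j := by ring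
  have hpairs := Reach.pairs' (H := G) y _ hadj f
  have hφle : φ ≤ 2 * P + (Finset.Ioo j b).card := sum_le_two_mul _ f
  have hfb : C (y b) = f b := rfl
  have hbj : Reach G (sg (y b) (f b)) (sg (y j) (f b / 2)) :=
    (Reach.step hjb.symm _).mono_left (Reach.sg_mono (Nat.mul_div_le _ _))
  set a := ∑ v, rs (seg y j) C v with ha
  set D := 2 ^ lev p j with hD
  rw [hdec]
  have hre : ∀ E, Reach G (rs (seg y j) C + ∑ t ∈ Finset.Ioo j b, sg (y t) (f t)
      + sg (y b) (f b)) E →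
      Reach G (rs (seg y j) C + (sg (y b) (C (y b)) + ∑ t ∈ Finset.Ioo j b, sg (y t) (C (y t))))
        E := by
    intro E hE
    rwa [add_comm (sg (y b) _), ← add_assoc]
  have hcomb : ∀ X Z R, X * D + kap p j ≤ a + P * D + Z * D →
      Reach G (sg (y b) (f b)) (sg (y j) Z + R) →
      Reach G (rs (seg y j) C + ∑ t ∈ Finset.Ioo j b, sg (y t) (f t) + sg (y b) (f b))
        (sg (y j) X + R) := by
    intro X Z R hX hR
    have := ((hcenter X (P + Z) (by rw [add_mul]; omega)).add hpairs).add hR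
    rw [← sg_add, ← add_assoc, ← sg_add] at this
    exact this.mono_right (add_le_add_left (Reach.sg_mono (by omega)) _)
  have hM2 : Reach G (sg (y j) (2 * M - 4)) (sg (y (b + 1)) (M - 2)) :=
    (Reach.step hcen (M - 2)).mono_left (Reach.sg_mono (by omega))
  have hsub : ∀ c, c ≤ 2 * M → (2 * M - c) * D + c * D = 2 * M * D := fun c hc => by
    rw [← add_mul, Nat.sub_add_cancel hc]
  have h4 := hsub 4 (by omega)
  have h2 := hsub 2 (by omega)
  have hlast : ∀ E, Reach G E (sg (y j) (2 * M - 2) + sg (y b) 1) →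
      Reach G E (sg (y (b + 1)) (M - 2) + sg (y b) 2) := by
    intro E hE
    have := (hM2.add (Reach.step hjb 1)).add (Reach.refl G (sg (y b) 1))
    rw [← sg_add, add_assoc, ← sg_add] at this
    exact hE.trans (this.mono_left (add_le_add_left (Reach.sg_mono (by omega)) _))
  rcases hg with hg | rfl
  · obtain rfl : g = b := by omega
    rcases Nat.lt_or_ge (f g) 2 with hlt | hge
    · obtain hf1 | hf0 : f g = 1 ∨ f g = 0 := by omega
      · right
        apply hre
        apply hlast
        refine hcomb _ 0 _ (by omega) ?_
        rw [hf1, sg_zero, zero_add]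
        exact Reach.refl _ _
      · by_cases hodd : ∀ t ∈ Finset.Ioo j g, f t % 2 = 1
        · rcases Nat.eq_zero_or_pos P with hP0 | hP1
          · have hf1 : ∀ t ∈ Finset.Ioo j g, f t = 1 := by
              intro t ht
              have h1 := hodd t ht
              have h2 := Finset.sum_eq_zero_iff.1 (hP ▸ hP0) t ht
              omega
            have h4 : ∑ t ∈ Finset.Ioo j g, sg (y t) (f t) = ∑ t ∈ Finset.Ioo j g, sg (y t) 1 :=
              Finset.sum_congr rfl fun t ht => by rw [hf1 t ht]
            have hgg := hp.next_cases hj1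
            rcases hside (2 * M) (rs (seg y j) C) (p (j + 1)) (by omega)
              (fun _ hv => rs_of_not_mem hv C) (by rw [← hD]; omega) (by omega) with hr | hr
            · left
              apply hre
              refine (hr.trans (Reach.step hcen M)).mono_left ?_
              rw [add_assoc]
              exact le_self_add
            · right
              apply hre
              apply hlast
              have hgadj : G.Adj (y (p (j + 1))) (y (j + 1)) := h.adj_par (by omega) (by omega)
              have hw := h.side (show j < g by omega) (by omega) hgadj
              rw [h4, hf0, sg_zero, add_zero]
              refine (hr.add (Reach.refl G _)).trans ?_
              rw [add_assoc]
              exact (Reach.refl G _).add hw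
          · right
            apply hre
            apply hlast
            have ho := h.odd_fan (by omega) hadj hodd hP1
            rw [hf0, sg_zero, add_zero]
            have hr := (hcenter (2 * M - 1) P (by
              have h1 := hsub 1 (by omega)
              omega)).add ho
            refine hr.mono_right ?_
            rw [add_comm (sg (y g) 1), ← add_assoc, ← sg_add]
            exact add_le_add_left (Reach.sg_mono (by omega)) _
        · left
          push Not at hodd
          obtain ⟨t, ht, hte⟩ := hodd
          have hφle' : φ + 1 ≤ 2 * P + (Finset.Ioo j g).card :=
            sum_lt_two_mul _ f ht (by omega)
          apply hre
          refine Reach.trans ?_ (Reach.step hcen M)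
          have := hcomb (2 * M) 0 0 (by omega) (Reach.zero _ _ |>.mono_right (by simp [sg_zero]))
          rwa [add_zero] at this
    · right
      apply hre
      have hZ : (f g - 2) / 2 * 2 ≤ (f g - 2) / 2 * D := Nat.mul_le_mul_left _ hpow
      have := hcomb (2 * M - 4) ((f g - 2) / 2) (sg (y g) 2) (by omega) ?_
      · exact this.trans (hM2.add (Reach.refl G _))
      · have := ((Reach.step hjb.symm ((f g - 2) / 2)).mono_left
          (Reach.sg_mono (Nat.mul_div_le _ _))).add (Reach.refl G (sg (y g) 2))
        rwa [← sg_add, Nat.sub_add_cancel hge] at this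
  · right
    apply hre
    have := hcomb (2 * M - 2) (f b / 2) 0 (by omega) (by rwa [add_zero])
    rw [add_zero] at this
    refine this.trans ?_
    have := hM2.add (Reach.refl G (sg (y j) 2))
    rw [← sg_add] at this
    exact this.mono_left (Reach.sg_mono (by omega))

theorem up_and_side (h : Chain G y p N) (i : ℕ) (hi : i ≤ N) :
    Up G (seg y i) (y i) (lev p i) (kap p i) ∧ (1 ≤ i → Side G y p i) := by
  have hp := h.parents
  induction i using Nat.strong_induction_on with
  | _ i ih =>
    rcases Nat.lt_or_ge i 3 with h3 | h3
    · interval_cases i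
      · rw [hp.lev_zero, hp.kap_zero]; exact ⟨up_zero, by omega⟩
      · refine ⟨?_, fun _ => h.side_one hi⟩
        rw [hp.lev_one, kap_one hp]; exact h.up_one hi
      · refine ⟨?_, fun _ => h.side_two hi⟩
        rw [hp.lev_two, kap_two hp]; exact h.up_two hi
    · have hlt := hp.lt' (show 1 ≤ i by omega)
      obtain ⟨h1, h2⟩ := ih (p i) hlt (by omega)
      have h2 := h2 (hp.pos i h3)
      have hu := h.up_step h3 hi h1 h2
      exact ⟨hu, fun _ => h.side_step h3 hi hu h1 h2⟩

theorem up (h : Chain G y p N) {i : ℕ} (hi : i ≤ N) :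
    Up G (seg y i) (y i) (lev p i) (kap p i) := (h.up_and_side i hi).1

end Chain

end ChainSideSection

section ChainLower

theorem Cap.of_steps {V : Type} {H : SimpleGraph V} {r : V} {m : ℕ} {C C' : V → ℕ}
    (h : Cap H r m C) (hs : Relation.ReflTransGen (PebStep H) C C') : Cap H r m C' :=
  fun D hD => h D (hs.trans hD)

theorem Cap.of_reach {V : Type} {H : SimpleGraph V} {A : Set V} {r : V} {m : ℕ} {C D : V → ℕ}
    (hr : r ∈ A) (h : Cap (onSet H A) r m C) (hs : Reach (onSet H A) C D) :
    Cap (onSet H A) r m D := by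
  obtain ⟨E, hE⟩ := hs
  exact (h.of_steps hE).congr hr fun v _ => by simp

namespace Chain

variable {V : Type} {G : SimpleGraph V} {y : ℕ → V} {p : ℕ → ℕ} {N : ℕ}

theorem not_mem_seg (h : Chain G y p N) {j k : ℕ} (hjk : j < k) (hk : k ≤ N) : y k ∉ seg y j := by
  rintro ⟨i, hi, hik⟩
  have := h.inj _ _ (by omega) hk hik
  omega

theorem adj_par_pred (h : Chain G y p N) {k : ℕ} (h2 : 2 ≤ k) (hk : k ≤ N) :
    G.Adj (y (p k)) (y (k - 1)) := by
  obtain ⟨k, rfl⟩ : ∃ j, k = j + 1 := ⟨k - 1, by omega⟩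
  have h3 := h.lt h2
  refine (h.adj _ _ (by omega) (by omega)).2 ?_
  rcases h.next k (by omega) with h1 | h1
  · right; simpa using h1
  · left; simpa using h1

theorem nbr_seg (h : Chain G y p N) {k : ℕ} (h1 : 1 ≤ k) (hk : k ≤ N) {v : V}
    (hv : v ∈ seg y (k - 1)) (hadj : G.Adj (y k) v) : v = y (k - 1) ∨ v = y (p k) := by
  obtain ⟨j, hj, rfl⟩ := hv
  rcases (h.adj j k (by omega) hk).1 hadj.symm with rfl | rfl
  · exact .inl rfl
  · exact .inr rfl

theorem low [Fintype V] (h : Chain G y p N) {k : ℕ} (hk : k ≤ N) :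
    Low G (seg y k) (y 0) (y k) (lev p k) (kap p k) := by
  induction k using Nat.strong_induction_on with
  | _ k ih =>
  rcases Nat.lt_or_ge k 2 with h2 | h2
  · obtain rfl | rfl : k = 0 ∨ k = 1 := by omega
    · rw [seg_zero, h.lev_zero, h.parents.kap_zero]; exact Low.single G _
    · have h3 := h.parents.kap_eq le_rfl
      rw [h.lev_one] at h3
      rw [show (1 : ℕ) = 0 + 1 from rfl, seg_succ, seg_zero, zero_add, h.lev_one,
        show kap p 1 = 0 by omega]
      exact Low.edge fun hh => by have := h.inj _ _ hk (by omega) hh; omega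
  have hsucc := h.lev_succ (k - 1)
  have hmono := h.lev_mono (show k - 1 ≤ k by omega)
  have hpos := h.lev_pos (show 1 ≤ k - 1 by omega)
  have hkk : k - 1 + 1 = k := by omega
  rw [hkk] at hsucc
  have hseg : seg y k = insert (y k) (seg y (k - 1)) := by
    have := seg_succ y (k - 1)
    rwa [hkk] at this
  have hlt := h.lt h2
  have hkap := h.parents.kap_eq (show 1 ≤ k by omega)
  have h0 : y 0 ∈ seg y (k - 1) := mem_seg (Nat.zero_le _)
  rcases Nat.lt_or_ge (lev p (k - 1)) (lev p k) with hl | hl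
  · -- the level increases
    have hpk : p k = k - 2 := by
      rcases h.next (k - 1) (by omega) with h1 | h1
      · rw [hkk] at h1
        have e1 := h.lev_eq (show 1 ≤ k by omega)
        have e2 := h.lev_eq (show 1 ≤ k - 1 by omega)
        rw [h1] at e1; omega
      · rw [hkk] at h1; omega
    have hlk := h.lev_eq (show 1 ≤ k by omega)
    rw [hpk] at hlk
    have h3 : 3 ≤ k := by
      by_contra h3
      obtain rfl : k = 2 := by omega
      have := h.lev_two; omega
    have hkap2 := h.parents.kap_eq (show 1 ≤ k - 2 by omega)
    obtain ⟨X, hX, hXs, hXc⟩ := ih (k - 2) (by omega) (by omega)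
    have hseg' : seg y (k - 1) = insert (y (k - 1)) (seg y (k - 2)) := by
      have := seg_succ y (k - 2)
      rwa [show k - 2 + 1 = k - 1 by omega] at this
    refine ⟨X, fun v hv => hX v fun hv' => hv (seg_mono (by omega) hv'), by omega, fun M => ?_⟩
    rw [hseg]
    refine Cap.eliminate (a := y (k - 1)) (b := y (p k)) (h.not_mem_seg (by omega) hk)
      (mem_seg le_rfl) (mem_seg (by omega)) (fun v hv hadj => h.nbr_seg (by omega) hk hv hadj)
      (.inr (h.adj_par_pred h2 hk).symm) h0 fun i j hij => ?_
    simp only [Pi.add_apply, sg_same, hX _ (h.not_mem_seg (show k - 2 < k by omega) hk),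
      add_zero] at hij
    rw [hseg']
    have hlt' := h.lt (show 2 ≤ k - 1 by omega)
    refine Cap.eliminate (a := y (k - 2)) (b := y (p (k - 1)))
      (h.not_mem_seg (by omega) (by omega)) (mem_seg le_rfl) (mem_seg (by omega))
      (fun v hv hadj => h.nbr_seg (k := k - 1) (by omega) (by omega) hv hadj)
      (.inr (h.adj_par_pred (k := k - 1) (by omega) (by omega)).symm) (mem_seg (Nat.zero_le _))
      fun i' j' hij' => ?_
    have hne1 : y (k - 1) ≠ y k := fun hh => by
      have := h.inj _ _ (by omega) hk hh; omega
    have hne2 : y (k - 1) ≠ y (p k) := fun hh => by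
      have := h.inj _ _ (by omega) (by omega) hh; omega
    simp only [Pi.add_apply, sg_same, sg_ne hne1, sg_ne hne2, zero_add, add_zero,
      hX _ (h.not_mem_seg (show k - 2 < k - 1 by omega) (by omega))] at hij'
    have hM := (hXc (M / 2))
    rw [Nat.div_div_eq_div_mul, ← pow_succ', ← hlk] at hM
    refine (hM.of_reach (D := sg (y (k - 2)) (j + i') + sg (y (p (k - 1))) j' + X)
      (mem_seg (Nat.zero_le _)) ?_).congr (mem_seg (Nat.zero_le _)) fun v hv => ?_
    · refine Reach.add ?_ (Reach.refl _ X)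
      refine Reach.mono_left (C := sg (y (k - 2)) (j + i') + sg (y (k - 2)) (2 * j')) ?_
        ((Reach.refl _ _).add (Reach.step ?_ _))
      · rw [← sg_add]; exact Reach.sg_mono (by omega)
      · refine ⟨?_, mem_seg le_rfl, mem_seg (by omega)⟩
        exact (h.adj_par_pred (k := k - 1) (by omega) (by omega)).symm
    · obtain ⟨t, ht, rfl⟩ := hv
      have n1 : y t ≠ y k := fun hh => by have := h.inj _ _ (by omega) hk hh; omega
      have n2 : y t ≠ y (k - 1) := fun hh => by
        have := h.inj _ _ (by omega) (by omega) hh; omega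
      rw [hpk]
      simp only [Pi.add_apply, sg_ne n1, sg_ne n2, sg_add]
      omega
  · -- the level is unchanged
    have hlk : lev p k = lev p (k - 1) := by omega
    have hkap1 := h.parents.kap_eq (show 1 ≤ k - 1 by omega)
    obtain ⟨X, hX, hXs, hXc⟩ := ih (k - 1) (by omega) (by omega)
    refine ⟨X + sg (y (k - 1)) 1, fun v hv => ?_, ?_, fun M => ?_⟩
    · rw [hseg, Set.mem_insert_iff, not_or] at hv
      rw [Pi.add_apply, hX v hv.2, sg_ne]
      rintro rfl; exact hv.2 (mem_seg le_rfl)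
    · simp only [Pi.add_apply, Finset.sum_add_distrib, hXs, sum_sg]; omega
    rw [hseg]
    refine Cap.eliminate (a := y (k - 1)) (b := y (p k)) (h.not_mem_seg (by omega) hk)
      (mem_seg le_rfl) (mem_seg (by omega)) (fun v hv hadj => h.nbr_seg (by omega) hk hv hadj)
      (.inr (h.adj_par_pred h2 hk).symm) h0 fun i j hij => ?_
    have hne1 : y k ≠ y (k - 1) := fun hh => by
      have := h.inj _ _ hk (by omega) hh; omega
    simp only [Pi.add_apply, sg_same, sg_ne hne1, add_zero,
      hX _ (h.not_mem_seg (show k - 1 < k by omega) hk)] at hij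
    have hM := hXc (2 * (M / 2) + 1)
    have hdiv : (2 * (M / 2) + 1) / 2 ^ lev p (k - 1) = M / 2 ^ lev p k := by
      obtain ⟨e, he⟩ : ∃ e, lev p (k - 1) = e + 1 := ⟨lev p (k - 1) - 1, by omega⟩
      rw [hlk, he, pow_succ', ← Nat.div_div_eq_div_mul, ← Nat.div_div_eq_div_mul]
      congr 1; omega
    rw [hdiv] at hM
    refine (hM.of_reach (D := sg (y (k - 1)) (2 * i + 1) + sg (y (p k)) j + X) h0 ?_).congr h0
      fun v hv => ?_
    · refine Reach.add ?_ (Reach.refl _ X)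
      refine Reach.mono_left (C := sg (y (k - 1)) (2 * i + 1) + sg (y (k - 1)) (2 * j)) ?_
        ((Reach.refl _ _).add (Reach.step ?_ _))
      · rw [← sg_add]; exact Reach.sg_mono (by omega)
      · exact ⟨(h.adj_par_pred h2 hk).symm, mem_seg le_rfl, mem_seg (by omega)⟩
    · obtain ⟨t, ht, rfl⟩ := hv
      have n1 : y t ≠ y k := fun hh => by have := h.inj _ _ (by omega) hk hh; omega
      have h4 : sg (y (k - 1)) (2 * i + 1) (y t) =
          sg (y (k - 1)) i (y t) + sg (y (k - 1)) i (y t) + sg (y (k - 1)) 1 (y t) := by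
        rw [two_mul, sg_add, sg_add]; rfl
      simp only [Pi.add_apply, sg_ne n1]
      omega

end Chain

end ChainLower

section ChainReverse

namespace Chain

variable {V : Type} {G : SimpleGraph V} {y : ℕ → V} {p : ℕ → ℕ} {N : ℕ}

theorem decomp' (h : Chain G y p N) {k : ℕ} (hk : k < N) {C : V → ℕ}
    (hC : ∀ v, v ∉ seg y N → C v = 0) :
    C = rs (seg y k) C + ∑ j ∈ Finset.Ioo 0 (N + 1 - k), sg (y (N + 1 - j)) (C (y (N + 1 - j))) := by
  have h1 := h.decomp hk le_rfl hC
  rw [add_assoc] at h1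
  have h2 : Finset.Ioc k N = insert N (Finset.Ioo k N) := by ext; simp; omega
  have h3 : ∑ j ∈ Finset.Ioc k N, sg (y j) (C (y j)) =
      ∑ j ∈ Finset.Ioo k N, sg (y j) (C (y j)) + sg (y N) (C (y N)) := by
    rw [h2, Finset.sum_insert (by simp), add_comm]
  rw [← h3] at h1
  have h4 : ∑ j ∈ Finset.Ioo 0 (N + 1 - k), sg (y (N + 1 - j)) (C (y (N + 1 - j))) =
      ∑ j ∈ Finset.Ioc k N, sg (y j) (C (y j)) := by
    refine Finset.sum_nbij' (fun j => N + 1 - j) (fun j => N + 1 - j) ?_ ?_ ?_ ?_ ?_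
    all_goals (intro j hj; simp at hj ⊢; try omega)
  rw [h4]; exact h1

/-- The upper bound at a vertex whose successors form a fan with centre before it. -/
theorem up_inner [Fintype V] (h : Chain G y p N) {k : ℕ} (hq : p N < k) (hk : k + 2 ≤ N)
    (hl : lev p k = lev p N) : Up G (seg y N) (y k) (lev p N) (kap p N) := by
  classical
  intro m C hC hCs
  have hq1 := h.pos N (by omega)
  have he2 : 2 ≤ lev p N := by
    have := h.lev_eq (show 1 ≤ N by omega)
    have := h.lev_pos hq1
    omega
  have hkN := h.parents.kap_eq (show 1 ≤ N by omega)
  have hkk := h.parents.kap_eq (show 1 ≤ k by omega)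
  have hS := h.up (show k ≤ N by omega)
  rw [hl] at hS hkk
  set e := lev p N
  obtain ⟨E, hE⟩ : ∃ E, 2 ^ e = 4 * E ∧ 1 ≤ E := by
    refine ⟨2 ^ (e - 2), ?_, Nat.one_le_two_pow⟩
    rw [show (4 : ℕ) = 2 ^ 2 by rfl, ← pow_add]; congr 1; omega
  have hd := h.decomp' (show k < N by omega) hC
  set z : ℕ → V := fun j => y (N + 1 - j) with hz
  set f : ℕ → ℕ := fun j => C (y (N + 1 - j)) with hf
  set I := Finset.Ioo 0 (N + 1 - k) with hI
  set L := rs (seg y k) C with hL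
  have hLo : ∀ v, v ∉ seg y k → L v = 0 := fun v hv => rs_of_not_mem hv _
  set g := y (p N) with hg
  have hgr : G.Adj g (y k) := h.adj_fan rfl hq (by omega) le_rfl
  have hgs : g ∈ seg y k := mem_seg hq.le
  have hcard : I.card = N - k := by simp [hI]; omega
  have hsum : ∑ v, C v = ∑ v, L v + ∑ j ∈ I, f j := by
    conv_lhs => rw [hd]
    simp only [Pi.add_apply, Finset.sum_add_distrib, Finset.sum_apply]
    rw [Finset.sum_comm (s := Finset.univ)]
    simp only [sum_sg, hf]
  have hadj : ∀ j ∈ I, G.Adj (z j) g := by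
    intro j hj
    simp [hI] at hj
    exact (h.adj_fan rfl (by omega) (by omega) le_rfl).symm
  have hstep : ∀ j, 0 < j → j < N + 1 - k → G.Adj (z j) (z (j + 1)) := by
    intro j h1 h2
    have := h.adj_pred (k := N - j) (by omega)
    simp only [hz]
    rw [show N + 1 - (j + 1) = N - j by omega, show N + 1 - j = N - j + 1 by omega]
    exact this.symm
  rw [hsum] at hCs
  rw [hd]
  set P := ∑ j ∈ I, f j / 2 with hP
  have key : ∀ Q m', m' * 2 ^ e + kap p k + 1 ≤ ∑ v, L v + 2 * Q →
      Reach G (L + sg g Q) (sg (y k) m') := by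
    intro Q m' hQ
    obtain ⟨w, ε, hε, rfl⟩ : ∃ w ε, ε ≤ 1 ∧ Q = ε + 2 * w :=
      ⟨Q / 2, Q % 2, by omega, by omega⟩
    refine Reach.mono_right (D := sg (y k) ((m' - w) + w)) (Reach.sg_mono (by omega)) ?_
    rw [sg_add, sg_add, ← add_assoc]
    refine Reach.add ?_ (Reach.step hgr w)
    rcases Nat.lt_or_ge w m' with h1 | h1
    · obtain ⟨s, rfl⟩ := Nat.exists_eq_add_of_lt h1
      refine hS _ _ (fun v hv => ?_) ?_
      · rw [Pi.add_apply, hLo v hv, sg_ne]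
        rintro rfl; exact hv hgs
      · simp only [Pi.add_apply, Finset.sum_add_distrib, sum_sg]
        rw [show w + s + 1 - w = s + 1 by omega]
        have : 4 * w ≤ w * 2 ^ e := by rw [hE.1]; nlinarith
        have h2 : (w + s + 1) * 2 ^ e = w * 2 ^ e + (s + 1) * 2 ^ e := by ring
        omega
    · rw [Nat.sub_eq_zero_of_le h1, sg_zero]; exact Reach.zero _ _
  have hR := sum_le_two_mul I f
  rw [hcard] at hR
  by_cases hodd : ∀ j ∈ I, f j % 2 = 1
  · rcases Nat.eq_zero_or_pos P with hP0 | hP0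
    · refine Reach.mono_right (D := sg (y k) m + 0) (by simp) ?_
      exact Reach.add (hS _ _ hLo (by omega)) (Reach.zero _ _)
    · have ho := Reach.odd_path hstep hadj hodd hP0
      rcases Nat.eq_zero_or_pos m with rfl | hm
      · rw [sg_zero]; exact Reach.zero _ _
      · refine ((Reach.refl G L).add ho).trans ?_
        have hzk : z (N + 1 - k) = y k := by
          simp only [hz]; congr 1; omega
        rw [hzk, add_comm (sg (y k) 1), ← add_assoc]
        obtain ⟨m, rfl⟩ : ∃ l, m = l + 1 := ⟨m - 1, by omega⟩
        rw [sg_add]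
        refine Reach.add (key _ _ ?_) (Reach.refl _ _)
        rw [add_mul] at hCs
        rw [← hI, ← hP]
        omega
  · push Not at hodd
    obtain ⟨j, hj, hjo⟩ := hodd
    have hR' := sum_lt_two_mul I f hj (by omega)
    rw [hcard] at hR'
    refine ((Reach.refl G L).add (Reach.pairs' z I hadj f)).trans (key _ _ ?_)
    omega

end Chain

end ChainReverse

section ChainDescent

/-- The final segment `y k, …, y N`. -/
def tail {V : Type} (y : ℕ → V) (k N : ℕ) : Set V := {v | ∃ j, k ≤ j ∧ j ≤ N ∧ y j = v}

namespace Parents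

variable {p : ℕ → ℕ} (hp : Parents p)
include hp

theorem eq_or_le {i j : ℕ} (hi : 1 ≤ i) (hij : i ≤ j) : p j = p i ∨ i ≤ p j + 1 := by
  induction j, hij using Nat.le_induction with
  | base => exact .inl rfl
  | succ j hij ih =>
    rcases hp.next j (by omega) with h | h
    · rw [h]; exact ih
    · right; omega

theorem lev_iter {N k : ℕ} (t : ℕ) (ht : ∀ s < t, k < p^[s] N) :
    lev p (p^[t] N) + t = lev p N := by
  induction t with
  | zero => rfl
  | succ t ih =>
    have h1 := ih fun s hs => ht s (by omega)
    have h2 := ht t (by omega)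
    rw [Function.iterate_succ_apply']
    have := hp.lev_eq (show 1 ≤ p^[t] N by omega)
    omega

theorem iter_le {N s t : ℕ} (h : s ≤ t) : p^[t] N ≤ p^[s] N := by
  induction t, h using Nat.le_induction with
  | base => rfl
  | succ t h ih =>
    rw [Function.iterate_succ_apply']
    rcases Nat.eq_zero_or_pos (p^[t] N) with h0 | h0
    · rw [h0, hp.p0]; omega
    · have := hp.lt' h0; omega

end Parents

namespace Chain

variable {V : Type} {G : SimpleGraph V} {y : ℕ → V} {p : ℕ → ℕ} {N : ℕ}

theorem up_pend [Fintype V] (h : Chain G y p N) {A : Set V} {c i e K j : ℕ} (hi : i < j)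
    (hj : j ≤ N) (hc : p j = c) (hci : c ≤ i)
    (hA : Up G (A ∪ tail y j N) (y j) e K) :
    Up G (insert (y c) (A ∪ tail y (i + 1) N)) (y c) (e + 1) (K + (j - (i + 1))) := by
  classical
  have hF : ((Finset.Ioo i j).image y).card = j - (i + 1) := by
    rw [Finset.card_image_of_injOn]
    · simp; omega
    · intro a ha b hb hab
      simp at ha hb
      exact h.inj _ _ (by omega) (by omega) hab
  have := hA.pend (h.adj_fan hc (by omega) le_rfl hj).symm ((Finset.Ioo i j).image y) (by
    intro v hv
    simp only [Finset.mem_image, Finset.mem_Ioo] at hv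
    obtain ⟨a, ha, rfl⟩ := hv
    exact (h.adj_fan hc (by omega) (by omega) hj).symm)
  rw [hF] at this
  refine this.mono_set (Set.insert_subset_insert ?_)
  rintro v (hv | ⟨a, h1, h2, rfl⟩)
  · exact .inl (.inl hv)
  · rcases Nat.lt_or_ge a j with h3 | h3
    · right; simp; exact ⟨a, ⟨by omega, h3⟩, rfl⟩
    · exact .inl (.inr ⟨a, h3, h2, rfl⟩)

theorem up_iter [Fintype V] (h : Chain G y p N) {k : ℕ} {A : Set V} {e K : ℕ}
    (hA : Up G A (y N) e K) (t : ℕ) (ht : ∀ s < t, k < p^[s] N) :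
    p^[t] N + t ≤ N ∧
    Up G (A ∪ tail y (p^[t] N) N) (y (p^[t] N)) (e + t) (K + (N - p^[t] N - t)) := by
  induction t with
  | zero =>
    refine ⟨le_rfl, ?_⟩
    simp only [Function.iterate_zero, id, Nat.sub_self, add_zero]
    have h1 := hA.wedge (Up.single G (y N))
    simp only [add_zero, Nat.zero_le, max_eq_left, min_eq_right, pow_zero] at h1
    refine (h1.mono_num (by omega)).mono_set ?_
    rintro v (hv | ⟨j, h1, h2, rfl⟩)
    · exact .inl hv
    · obtain rfl : j = N := by omega
      exact .inr rfl
  | succ t ih =>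
    obtain ⟨h1, h2⟩ := ih fun s hs => ht s (by omega)
    have h3 := ht t (by omega)
    rw [Function.iterate_succ_apply']
    set j := p^[t] N
    have h4 := h.lt' (show 1 ≤ j by omega)
    refine ⟨by omega, ?_⟩
    have := h.up_pend h4 (by omega) rfl le_rfl h2
    rw [add_assoc e] at this
    refine (this.mono_num (by omega)).mono_set ?_
    rintro v (hv | ⟨a, h1, h2, rfl⟩)
    · exact .inr (.inl hv)
    · rcases Nat.eq_or_lt_of_le h1 with rfl | h3
      · exact .inl rfl
      · exact .inr (.inr ⟨a, h3, h2, rfl⟩)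

/-- The number of steps `p` needs to get from `N` below `j`. -/
theorem exists_depth (h : Chain G y p N) (j : ℕ) : ∃ t, p^[t] N ≤ j := by
  by_contra! hcon
  have h1 : ∀ t, p^[t] N + t ≤ N := by
    intro t
    induction t with
    | zero => rfl
    | succ t ih =>
      rw [Function.iterate_succ_apply']
      have := h.lt' (show 1 ≤ p^[t] N by have := hcon t; omega)
      omega
  have := h1 (N + 1)
  omega

open Classical in
/-- The least number of steps `p` needs to get from `N` below `j`. -/
noncomputable def depth (h : Chain G y p N) (j : ℕ) : ℕ := Nat.find (h.exists_depth j)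

theorem iter_depth (h : Chain G y p N) (j : ℕ) : p^[h.depth j] N ≤ j := by
  classical exact Nat.find_spec (h.exists_depth j)

theorem lt_iter (h : Chain G y p N) {j t : ℕ} (ht : t < h.depth j) : j < p^[t] N := by
  classical exact not_le.1 (Nat.find_min (h.exists_depth j) ht)

theorem depth_le (h : Chain G y p N) {j t : ℕ} (ht : p^[t] N ≤ j) : h.depth j ≤ t := by
  classical exact Nat.find_min' (h.exists_depth j) ht

theorem depth_anti (h : Chain G y p N) {i j : ℕ} (hij : i ≤ j) : h.depth j ≤ h.depth i :=
  h.depth_le ((h.iter_depth i).trans hij)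

theorem depth_par (h : Chain G y p N) (j : ℕ) : h.depth (p j) ≤ h.depth j + 1 := by
  apply h.depth_le
  rw [Function.iterate_succ_apply']
  exact h.parents.mono (h.iter_depth j)

theorem depth_lip (h : Chain G y p N) {i j : ℕ} (hi : i ≤ N) (hj : j ≤ N)
    (hadj : G.Adj (y i) (y j)) : h.depth i ≤ h.depth j + 1 := by
  rcases lt_trichotomy i j with h1 | rfl | h1
  · have h2 := h.depth_par j
    have h3 : p j ≤ i := by
      rcases (h.adj i j h1 hj).1 hadj with rfl | rfl
      · have := h.lt' (show 1 ≤ j by omega); omega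
      · rfl
    exact (h.depth_anti h3).trans h2
  · exact (hadj.ne rfl).elim
  · exact (h.depth_anti h1.le).trans (Nat.le_succ _)

theorem descent [Fintype V] (h : Chain G y p N) {k : ℕ} (hk : 1 ≤ k) (hkN : k < N) :
    ∃ d κ, 1 ≤ d ∧ (∃ ψ : ℕ → ℕ, ψ N = 0 ∧ ψ k = d ∧
        ∀ i j, i ≤ N → j ≤ N → G.Adj (y i) (y j) → ψ i ≤ ψ j + 1) ∧
      (∀ A e K, Up G A (y N) e K → Up G (A ∪ tail y k N) (y k) (e + d) (K + κ)) ∧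
      ((κ + d = N - k ∧ lev p N ≤ lev p k + d ∧ lev p k + d ≤ lev p N + 1) ∨
       (κ + d = N - k + 1 ∧ 2 ≤ d ∧ lev p N + 1 ≤ lev p k + d ∧ lev p k + d ≤ lev p N + 2 ∧
        (lev p k + d = lev p N + 2 → d = 2 →
          2 ≤ lev p N ∧ G.Adj (y (p N)) (y k) ∧ Up G (seg y N) (y k) (lev p N) (kap p N)))) := by
  obtain ⟨w, hw⟩ : ∃ w, h.depth k = w + 1 := by
    refine ⟨h.depth k - 1, ?_⟩
    have h1 := h.iter_depth k
    rcases Nat.eq_zero_or_pos (h.depth k) with h0 | h0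
    · rw [h0] at h1; simp at h1; omega
    · omega
  have hdN : h.depth N = 0 := by
    have := h.depth_le (j := N) (t := 0) le_rfl; omega
  set q' := p^[w] N with hq'
  have hkq' : k < q' := h.lt_iter (by omega)
  have hqk : p q' ≤ k := by
    have := h.iter_depth k
    rwa [hw, Function.iterate_succ_apply'] at this
  have hlow : ∀ s < w, k < p^[s] N := fun s hs => h.lt_iter (by omega)
  have hlev : lev p q' + w = lev p N := h.parents.lev_iter w hlow
  have hlevq : lev p q' = lev p (p q') + 1 := h.lev_eq (by omega)
  have hq'N : q' + w ≤ N := by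
    exact (h.up_iter (Up.single G (y N)) w hlow).1
  have hm1 := h.lev_mono hqk
  have hm2 := h.lev_mono hkq'.le
  by_cases hcase : p q' = k ∨ q' = k + 1
  · refine ⟨w + 1, N - k - (w + 1), by omega,
      ⟨h.depth, hdN, hw, fun i j hi hj => h.depth_lip hi hj⟩,
      fun A e K hA => ?_, .inl ⟨by omega, ?_⟩⟩
    · have h2 := (h.up_iter hA w hlow).2
      rw [← hq'] at h2
      rcases hcase with hc | hc
      · have := h.up_pend hkq' (by omega) hc le_rfl h2
        rw [add_assoc e] at this
        refine (this.mono_num (by omega)).mono_set ?_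
        rintro v (hv | ⟨a, h1, h2, rfl⟩)
        · exact .inr (.inl hv)
        · rcases Nat.eq_or_lt_of_le h1 with rfl | h3
          · exact .inl rfl
          · exact .inr (.inr ⟨a, h3, h2, rfl⟩)
      · rw [hc] at h2
        have := h2.edge (h.adj_pred (by omega)).symm
        rw [add_assoc e] at this
        refine (this.mono_num (by omega)).mono_set ?_
        rintro v (hv | ⟨a, h1, h2, rfl⟩)
        · exact .inr (.inl hv)
        · rcases Nat.eq_or_lt_of_le h1 with rfl | h3
          · exact .inl rfl
          · exact .inr (.inr ⟨a, h3, h2, rfl⟩)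
    · rcases hcase with hc | hc
      · rw [hc] at hlevq; omega
      · have := h.lev_succ k
        rw [← hc] at this; omega
  · push Not at hcase
    obtain ⟨hc1, hc2⟩ := hcase
    refine ⟨w + 2, N - k - (w + 1), by omega, ⟨fun j => if j = k then w + 2 else h.depth j, ?_, ?_,
      fun i j hi hj hadj => ?_⟩, fun A e K hA => ?_, .inr ⟨by omega, by omega, by omega, by omega,
      fun h1 h2 => ?_⟩⟩
    · simp only; rw [if_neg (by omega), hdN]
    · simp
    · have hl := h.depth_lip hi hj hadj
      have hne : i ≠ j := by rintro rfl; exact hadj.ne rfl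
      simp only
      by_cases hik : i = k
      · subst hik
        rw [if_pos rfl, if_neg (Ne.symm hne)]
        rcases Nat.lt_or_ge j i with h1 | h1
        · have := h.depth_anti h1.le; omega
        · have h4 : j < q' := by
            rcases (h.adj i j (by omega) hj).1 hadj with h5 | h5
            · omega
            · by_contra! h6
              rcases h.parents.eq_or_le (show 1 ≤ q' by omega) h6 with h7 | h7 <;> omega
          by_contra! h5
          have h6 := h.iter_depth j
          have h7 := h.parents.iter_le (N := N) (show h.depth j ≤ w by omega)
          omega
      · rw [if_neg hik]
        by_cases hjk : j = k
        · subst hjk; rw [if_pos rfl]; omega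
        · rw [if_neg hjk]; exact hl
    · have h2 := (h.up_iter hA w hlow).2
      rw [← hq'] at h2
      have h3 := h.up_pend hkq' (by omega) rfl hqk h2
      have h4 := h3.edge (r := y k) (h.adj_fan rfl (by omega) hkq'.le (by omega))
      rw [add_assoc e, add_assoc e] at h4
      refine (h4.mono_num (by omega)).mono_set ?_
      rintro v (hv | ⟨a, h1, h2, rfl⟩)
      · exact .inr (.inr (.inl hv))
      · rcases Nat.eq_or_lt_of_le h1 with rfl | h3
        · exact .inl rfl
        · exact .inr (.inr (.inr ⟨a, h3, h2, rfl⟩))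
    · obtain rfl : w = 0 := by omega
      simp only [Function.iterate_zero, id] at hq'
      rw [hq'] at *
      have h3 := h.pos N (by omega)
      have h4 := h.lev_pos h3
      exact ⟨by omega, h.adj_fan rfl (by omega) hkN.le le_rfl,
        h.up_inner (by omega) (by omega) (by omega)⟩

end Chain

end ChainDescent

section ChainInterior

theorem interior_arith₁ {a b t δ : ℕ} (hba : b ≤ a) (hb : 1 ≤ b) (ht : 1 ≤ t) (hδ : δ ≤ 1) :
    t * 2 ^ a + 2 ^ b + b ≤ t * 2 ^ (a + b - δ) + 1 + 2 * δ := by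
  have hlt : b + 1 ≤ 2 ^ b := Nat.lt_two_pow_self
  have hab : 2 ^ b ≤ 2 ^ a := Nat.pow_le_pow_right (by norm_num) hba
  have hta : 2 ^ a ≤ t * 2 ^ a := Nat.le_mul_of_pos_left _ ht
  obtain rfl | rfl : δ = 0 ∨ δ = 1 := by omega
  · rw [Nat.sub_zero, pow_add, ← mul_assoc]
    obtain rfl | h2 : b = 1 ∨ 2 ≤ b := by omega
    · omega
    · have : 4 ≤ 2 ^ b := by
        calc 4 = 2 ^ 2 := rfl
          _ ≤ _ := Nat.pow_le_pow_right (by norm_num) h2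
      nlinarith
  · rw [Nat.add_sub_assoc hb, pow_add, ← mul_assoc]
    obtain ⟨b, rfl⟩ : ∃ c, b = c + 1 := ⟨b - 1, by omega⟩
    rw [pow_succ] at *
    rw [Nat.add_sub_cancel]
    obtain rfl | rfl | h2 : b = 0 ∨ b = 1 ∨ 2 ≤ b := by omega
    · omega
    · omega
    · have : 4 ≤ 2 ^ b := by
        calc 4 = 2 ^ 2 := rfl
          _ ≤ _ := Nat.pow_le_pow_right (by norm_num) h2
      nlinarith

theorem interior_arith₂ {a b t δ : ℕ} (hba : b ≤ a) (hb : 2 ≤ b) (ht : 1 ≤ t) (h1 : 1 ≤ δ)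
    (h2 : δ = 1 ∨ δ = 2 ∧ 3 ≤ b) :
    t * 2 ^ a + 2 ^ b + b ≤ t * 2 ^ (a + b - δ) + 2 * δ := by
  have hab : 2 ^ b ≤ 2 ^ a := Nat.pow_le_pow_right (by norm_num) hba
  have hta : 2 ^ a ≤ t * 2 ^ a := Nat.le_mul_of_pos_left _ ht
  have hlt : ∀ c, c + 1 ≤ 2 ^ c := fun c => Nat.lt_two_pow_self
  obtain rfl | ⟨rfl, h3⟩ := h2
  · rw [Nat.add_sub_assoc (by omega), pow_add, ← mul_assoc]
    obtain ⟨b, rfl⟩ : ∃ c, b = c + 2 := ⟨b - 2, by omega⟩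
    have := hlt b
    rw [show b + 2 - 1 = b + 1 by omega, show 2 ^ (b + 1) = 2 * 2 ^ b by ring]
    rw [show 2 ^ (b + 2) = 4 * 2 ^ b by ring] at *
    obtain rfl | h2 : b = 0 ∨ 1 ≤ b := by omega
    · omega
    · nlinarith
  · rw [Nat.add_sub_assoc (by omega), pow_add, ← mul_assoc]
    obtain ⟨b, rfl⟩ : ∃ c, b = c + 3 := ⟨b - 3, by omega⟩
    have := hlt b
    rw [show b + 3 - 2 = b + 1 by omega, show 2 ^ (b + 1) = 2 * 2 ^ b by ring]
    rw [show 2 ^ (b + 3) = 8 * 2 ^ b by ring] at *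
    obtain rfl | h2 : b = 0 ∨ 1 ≤ b := by omega
    · omega
    · nlinarith

namespace Chain

variable {V : Type} {G : SimpleGraph V} {y : ℕ → V} {p : ℕ → ℕ} {N : ℕ}

theorem reach_lev (h : Chain G y p N) {k : ℕ} (hk : k ≤ N) :
    Reach G (sg (y 0) (2 ^ lev p k)) (sg (y k) 1) := by
  induction k using Nat.strong_induction_on with
  | _ k ih =>
    rcases Nat.eq_zero_or_pos k with rfl | h0
    · rw [h.lev_zero]; exact Reach.refl _ _
    · have h1 := h.lt' h0
      rw [h.lev_eq h0, pow_succ]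
      have h2 := (ih (p k) h1 (by omega)).smul 2
      rw [mul_comm]
      exact h2.trans (Reach.step (h.adj_par h0 hk) 1)

theorem up_interior [Fintype V] (h : Chain G y p N) {k : ℕ} (hk : 1 ≤ k) (hkN : k < N)
    {A₁ A₂ : Set V} {e₁ K₁ e₂ K₂ D : ℕ} (h₁ : Up G A₁ (y 0) e₁ K₁) (h₂ : Up G A₂ (y N) e₂ K₂)
    (hD : ∀ ψ : ℕ → ℕ, ψ N = 0 → (∀ i j, i ≤ N → j ≤ N → G.Adj (y i) (y j) → ψ i ≤ ψ j + 1) →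
      ψ k ≤ D) (hord : e₂ + D ≤ e₁ + lev p k) :
    Up G (A₁ ∪ seg y N ∪ A₂) (y k) (e₁ + lev p N + e₂) (K₁ + K₂ + (N + 1 - 2 * lev p N)) := by
  obtain ⟨d, κ, hd1, ⟨ψ, hψN, hψk, hψ⟩, hup, hcase⟩ := h.descent hk hkN
  have hdD := hD ψ hψN hψ
  rw [hψk] at hdD
  have hleft := h₁.extend (h.up hkN.le) (mem_seg (Nat.zero_le _)) (h.reach_lev hkN.le)
  have hwedge := hleft.wedge (hup _ _ _ h₂)
  have hl1 := h.lev_pos hk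
  have hkk := h.parents.kap_eq hk
  have hkN' := h.parents.kap_eq (show 1 ≤ N by omega)
  rw [max_eq_left (by omega), min_eq_right (by omega)] at hwedge
  have hset : A₁ ∪ seg y N ∪ A₂ ⊆ A₁ ∪ seg y k ∪ (A₂ ∪ tail y k N) := by
    rintro v ((hv | ⟨j, hj, rfl⟩) | hv)
    · exact .inl (.inl hv)
    · rcases Nat.lt_or_ge j k with h1 | h1
      · exact .inl (.inr (mem_seg h1.le))
      · exact .inr (.inr ⟨j, h1, hj, rfl⟩)
    · exact .inr (.inl hv)
  intro t C hC hsum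
  rcases Nat.eq_zero_or_pos t with rfl | ht
  · rw [sg_zero]; exact Reach.zero _ _
  have hp2 := Nat.two_pow_pos (e₂ + d)
  rcases hcase with ⟨hκ, hlo, hhi⟩ | ⟨hκ, hd2, hlo, hhi, hRS⟩
  · refine hwedge t C (fun v hv => hC v fun hv' => hv (hset hv')) (le_trans ?_ hsum)
    have h3 := interior_arith₁ (a := e₁ + lev p k) (b := e₂ + d) (t := t)
      (δ := lev p k + d - lev p N) (by omega) (by omega) ht (by omega)
    rw [show e₁ + lev p k + (e₂ + d) - (lev p k + d - lev p N) = e₁ + lev p N + e₂ by omega] at h3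
    omega
  · by_cases hbad : lev p k + d = lev p N + 2 ∧ e₂ + d = 2
    · obtain ⟨hl2, hadj, hu⟩ := hRS hbad.1 (by omega)
      obtain ⟨e₂0, d2⟩ : e₂ = 0 ∧ d = 2 := by omega
      subst e₂0 d2
      rw [show lev p N = lev p k by omega] at hu
      have h4 := h₁.extend hu (mem_seg (Nat.zero_le _)) (h.reach_lev hkN.le)
      have h5 := h₂.extend h4 (d := e₁ + lev p k) (.inr (mem_seg le_rfl)) ?_
      · rw [show lev p k = lev p N by omega] at h5
        refine h5 t C (fun v hv => hC v fun hv' => hv ?_) (le_trans ?_ hsum)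
        · rw [Set.union_comm]; exact hv'
        · rw [zero_add, add_zero]
          omega
      · obtain ⟨l, hl⟩ : ∃ l, e₁ + lev p k = l + 2 := ⟨e₁ + lev p k - 2, by omega⟩
        have hl' := Nat.two_pow_pos l
        refine Reach.mono_left (C := sg (y N) (2 * 2)) (Reach.sg_mono ?_)
          ((Reach.step (h.adj_par (by omega) le_rfl).symm 2).trans (Reach.step hadj 1))
        rw [hl, pow_add]; omega
    · refine hwedge t C (fun v hv => hC v fun hv' => hv (hset hv')) (le_trans ?_ hsum)
      have h3 := interior_arith₂ (a := e₁ + lev p k) (b := e₂ + d) (t := t)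
        (δ := lev p k + d - lev p N) (by omega) (by omega) ht (by omega) (by omega)
      rw [show e₁ + lev p k + (e₂ + d) - (lev p k + d - lev p N) = e₁ + lev p N + e₂ by omega] at h3
      omega

end Chain

end ChainInterior

section TwoTrees

open Classical in
/-- `S` induces a 2-tree in `G`. -/
inductive TT {V : Type} (G : SimpleGraph V) : Finset V → Prop
  | edge (a b : V) (h : G.Adj a b) : TT G {a, b}
  | ext (S : Finset V) (v a b : V) (hS : TT G S) (hv : v ∉ S) (ha : a ∈ S) (hb : b ∈ S)
      (hab : G.Adj a b) (hn : ∀ u ∈ S, G.Adj v u ↔ u = a ∨ u = b) : TT G (insert v S)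

/-- The neighbours of `v` in `S` are pairwise adjacent. -/
def Simp {V : Type} (G : SimpleGraph V) (S : Finset V) (v : V) : Prop :=
  v ∈ S ∧ ∀ a ∈ S, ∀ b ∈ S, G.Adj v a → G.Adj v b → a ≠ b → G.Adj a b

open Classical in
theorem IsTwoTree.tt {W : Type} {H : SimpleGraph W} (h : IsTwoTree H) {V : Type}
    (G : SimpleGraph V) (f : W → V) (hf : Function.Injective f)
    (hadj : ∀ a b, H.Adj a b ↔ G.Adj (f a) (f b)) :
    ∃ S : Finset V, (S : Set V) = Set.range f ∧ TT G S := by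
  induction h with
  | base H e he =>
    have e1 : ∀ x, x = e.symm 0 ∨ x = e.symm 1 := by
      intro x
      rcases (by decide : ∀ i : Fin 2, i = 0 ∨ i = 1) (e x) with h | h
      · left; rw [← h]; simp
      · right; rw [← h]; simp
    refine ⟨{f (e.symm 0), f (e.symm 1)}, ?_, TT.edge _ _ ((hadj _ _).1 ((he _ _).2 (by simp)))⟩
    ext x
    simp only [Finset.coe_insert, Finset.coe_singleton, Set.mem_insert_iff, Set.mem_singleton_iff,
      Set.mem_range]
    constructor
    · rintro (rfl | rfl) <;> exact ⟨_, rfl⟩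
    · rintro ⟨w, rfl⟩
      rcases e1 w with rfl | rfl <;> simp
  | extend H v hdeg hcl h ih =>
    obtain ⟨S, hS, hT⟩ := ih (fun x => f x.1) (fun x y hxy => Subtype.ext (hf hxy))
      (fun a b => by rw [← hadj]; rfl)
    obtain ⟨a, b, hab, hn⟩ := Set.ncard_eq_two.1 hdeg
    have hmem : ∀ u, u ≠ v → f u ∈ S := fun u hu => by
      rw [← Finset.mem_coe, hS]; exact ⟨⟨u, hu⟩, rfl⟩
    have hva : H.Adj v a := by
      have : a ∈ H.neighborSet v := by rw [hn]; simp
      exact this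
    have hvb : H.Adj v b := by
      have : b ∈ H.neighborSet v := by rw [hn]; simp
      exact this
    refine ⟨insert (f v) S, ?_, TT.ext S (f v) (f a) (f b) hT ?_ (hmem a hva.ne') (hmem b hvb.ne')
      ((hadj _ _).1 (hcl hva hvb hab)) ?_⟩
    · ext x
      rw [Finset.coe_insert, hS]
      constructor
      · rintro (rfl | ⟨u, rfl⟩) <;> exact ⟨_, rfl⟩
      · rintro ⟨w, rfl⟩
        by_cases hw : w = v
        · left; rw [hw]
        · right; exact ⟨⟨w, hw⟩, rfl⟩
    · rw [← Finset.mem_coe, hS]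
      rintro ⟨u, hu⟩
      exact u.2 (hf hu)
    · intro u hu
      rw [← Finset.mem_coe, hS] at hu
      obtain ⟨w, rfl⟩ := hu
      rw [← hadj]
      have : H.Adj v w.1 ↔ w.1 ∈ H.neighborSet v := Iff.rfl
      rw [this, hn]
      simp [hf.eq_iff]

variable {V : Type} {G : SimpleGraph V}

theorem TT.two_le {S : Finset V} (h : TT G S) : 2 ≤ S.card := by
  classical
  induction h with
  | edge a b h => rw [Finset.card_pair h.ne]
  | ext S v a b hS hv ha hb hab hn ih => rw [Finset.card_insert_of_notMem hv]; omega

theorem Finset.eq_pair_of_card {S : Finset V} [DecidableEq V] (h : S.card = 2) {a b : V}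
    (ha : a ∈ S) (hb : b ∈ S) (hab : a ≠ b) : S = {a, b} := by
  symm
  apply Finset.eq_of_subset_of_card_le
  · intro x hx; simp at hx; rcases hx with rfl | rfl <;> assumption
  · rw [Finset.card_pair hab, h]

open Classical in
theorem TT.erase {S : Finset V} (h : TT G S) (hc : 3 ≤ S.card) {v : V} (hv : Simp G S v) :
    TT G (S.erase v) ∧ ∃ a b, a ∈ S ∧ b ∈ S ∧ G.Adj a b ∧ ∀ u ∈ S, G.Adj v u ↔ u = a ∨ u = b := by
  induction h with
  | edge a b h => rw [Finset.card_pair h.ne] at hc; omega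
  | ext S w a b hS hw ha hb hab hn ih =>
    by_cases hvw : v = w
    · subst hvw
      rw [Finset.erase_insert hw]
      refine ⟨hS, a, b, by simp [ha], by simp [hb], hab, fun u hu => ?_⟩
      rw [Finset.mem_insert] at hu
      rcases hu with rfl | hu
      · simp only [SimpleGraph.irrefl, false_iff, not_or]
        exact ⟨fun h => hw (h ▸ ha), fun h => hw (h ▸ hb)⟩
      · exact hn u hu
    have hvS : v ∈ S := (Finset.mem_insert.1 hv.1).resolve_left hvw
    have hvs : Simp G S v := ⟨hvS, fun x hx y hy => hv.2 x (by simp [hx]) y (by simp [hy])⟩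
    have her : (insert w S).erase v = insert w (S.erase v) := by
      rw [Finset.erase_insert_of_ne (Ne.symm hvw)]
    rw [her]
    rw [Finset.card_insert_of_notMem hw] at hc
    rcases Nat.lt_or_ge S.card 3 with h3 | h3
    · have h2 : S = {a, b} := Finset.eq_pair_of_card (by omega) ha hb hab.ne
      have hwa : G.Adj w a := (hn a ha).2 (.inl rfl)
      have hwb : G.Adj w b := (hn b hb).2 (.inr rfl)
      rw [h2] at hvS
      simp only [Finset.mem_insert, Finset.mem_singleton] at hvS
      rcases hvS with rfl | rfl
      · have : S.erase v = {b} := by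
          rw [h2]; ext x; simp only [Finset.mem_erase, Finset.mem_insert, Finset.mem_singleton]
          constructor
          · tauto
          · rintro rfl; exact ⟨hab.ne', .inr rfl⟩
        rw [this]
        refine ⟨TT.edge _ _ hwb, w, b, by simp, by simp [hb], hwb, fun u hu => ?_⟩
        rw [h2] at hu
        simp only [Finset.mem_insert, Finset.mem_singleton] at hu
        rcases hu with rfl | rfl | rfl
        · simp [hwa.symm]
        · simp [hvw, hab.ne]
        · simp [hab]
      · have : S.erase v = {a} := by
          rw [h2]; ext x; simp only [Finset.mem_erase, Finset.mem_insert, Finset.mem_singleton]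
          constructor
          · tauto
          · rintro rfl; exact ⟨hab.ne, .inl rfl⟩
        rw [this]
        refine ⟨TT.edge _ _ hwa, w, a, by simp, by simp [ha], hwa, fun u hu => ?_⟩
        rw [h2] at hu
        simp only [Finset.mem_insert, Finset.mem_singleton] at hu
        rcases hu with rfl | rfl | rfl
        · simp [hwb.symm]
        · simp [hab.symm]
        · simp [hvw, hab.ne']
    · obtain ⟨hT, c, d, hc', hd', hcd, hcn⟩ := ih h3 hvs
      have hvc : G.Adj v c := (hcn c hc').2 (.inl rfl)
      have hvd : G.Adj v d := (hcn d hd').2 (.inr rfl)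
      have hnot : ¬ G.Adj w v := by
        intro hwv
        have hadjn : ∀ x ∈ S, G.Adj v x → x = a ∨ x = b := fun x hx hvx => (hn x hx).1 <|
          hv.2 w (by simp) x (by simp [hx]) hwv.symm hvx fun h => hw (h ▸ hx)
        have h1 := hadjn c hc' hvc
        have h2 := hadjn d hd' hvd
        have h3 := (hn v hvS).1 hwv
        have := hvc.ne; have := hvd.ne; have := hcd.ne
        rcases h1 with rfl | rfl <;> rcases h2 with rfl | rfl <;> rcases h3 with rfl | rfl <;>
          simp_all
      have hva : v ≠ a := by rintro rfl; exact hnot ((hn _ ha).2 (.inl rfl))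
      have hvb : v ≠ b := by rintro rfl; exact hnot ((hn _ hb).2 (.inr rfl))
      refine ⟨TT.ext _ w a b hT (by simp [hw]) (by simp [ha, Ne.symm hva])
        (by simp [hb, Ne.symm hvb]) hab fun u hu => hn u (Finset.mem_of_mem_erase hu), c, d,
        by simp [hc'], by simp [hd'], hcd, fun u hu => ?_⟩
      rw [Finset.mem_insert] at hu
      rcases hu with rfl | hu
      · constructor
        · intro h; exact (hnot h.symm).elim
        · rintro (rfl | rfl)
          · exact (hw hc').elim
          · exact (hw hd').elim
      · exact hcn u hu

theorem TT.not_adj {S : Finset V} (h : TT G S) (hc : 4 ≤ S.card) {u v : V} (hu : Simp G S u)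
    (hv : Simp G S v) : ¬ G.Adj u v := by
  classical
  intro huv
  have h1 := h.erase (by omega) hv
  obtain ⟨-, a, b, ha, hb, hab, hn⟩ := h.erase (by omega) hu
  have hcard := Finset.card_erase_of_mem hv.1
  obtain ⟨-, c, d, hc', hd', hcd, hcn⟩ := h1.1.erase (by omega) (v := u)
    ⟨by simp [hu.1, huv.ne], fun x hx y hy => hu.2 x (Finset.mem_of_mem_erase hx) y
      (Finset.mem_of_mem_erase hy)⟩
  have e1 := (hn c (Finset.mem_of_mem_erase hc')).1 ((hcn c hc').2 (.inl rfl))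
  have e2 := (hn d (Finset.mem_of_mem_erase hd')).1 ((hcn d hd').2 (.inr rfl))
  have e3 := (hn v hv.1).1 huv
  have e4 := Finset.ne_of_mem_erase hc'
  have e5 := Finset.ne_of_mem_erase hd'
  have e6 := hcd.ne
  rcases e1 with rfl | rfl <;> rcases e2 with rfl | rfl <;> rcases e3 with rfl | rfl <;>
          simp_all

theorem TT.exists_simp {S : Finset V} (h : TT G S) (hc : 4 ≤ S.card) :
    ∃ u v, u ≠ v ∧ Simp G S u ∧ Simp G S v := by
  classical
  induction h with
  | edge a b h => rw [Finset.card_pair h.ne] at hc; omega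
  | ext S w a b hS hw ha hb hab hn ih =>
    rw [Finset.card_insert_of_notMem hw] at hc
    have hwa : G.Adj w a := (hn a ha).2 (.inl rfl)
    have hwb : G.Adj w b := (hn b hb).2 (.inr rfl)
    have hws : Simp G (insert w S) w := by
      refine ⟨by simp, fun x hx y hy hwx hwy hxy => ?_⟩
      have hx' := (Finset.mem_insert.1 hx).resolve_left hwx.ne'
      have hy' := (Finset.mem_insert.1 hy).resolve_left hwy.ne'
      rcases (hn x hx').1 hwx with rfl | rfl <;> rcases (hn y hy').1 hwy with rfl | rfl
      · exact (hxy rfl).elim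
      · exact hab
      · exact hab.symm
      · exact (hxy rfl).elim
    have hext : ∀ x, Simp G S x → x ≠ a → x ≠ b → Simp G (insert w S) x := by
      intro x hx hxa hxb
      have hwx : ¬ G.Adj w x := fun h => by
        rcases (hn x hx.1).1 h with rfl | rfl
        · exact hxa rfl
        · exact hxb rfl
      refine ⟨by simp [hx.1], fun c hc d hd hxc hxd hcd => ?_⟩
      have hc' := (Finset.mem_insert.1 hc).resolve_left fun h => hwx (h ▸ hxc.symm)
      have hd' := (Finset.mem_insert.1 hd).resolve_left fun h => hwx (h ▸ hxd.symm)
      exact hx.2 c hc' d hd' hxc hxd hcd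
    rcases Nat.lt_or_ge S.card 4 with h4 | h4
    · obtain ⟨x, hx, hxab⟩ : ∃ x ∈ S, x ∉ ({a, b} : Finset V) := by
        by_contra! hcon
        have := Finset.card_le_card (show S ⊆ {a, b} from hcon)
        have := Finset.card_le_two (a := a) (b := b)
        omega
      simp only [Finset.mem_insert, Finset.mem_singleton, not_or] at hxab
      refine ⟨w, x, fun h => hw (h ▸ hx), hws, hext x ⟨hx, ?_⟩ hxab.1 hxab.2⟩
      have hS3 : ({x, a, b} : Finset V) = S := by
        apply Finset.eq_of_subset_of_card_le
        · intro z hz; simp at hz; rcases hz with rfl | rfl | rfl <;> assumption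
        · rw [Finset.card_insert_of_notMem (by simp [hxab]), Finset.card_pair hab.ne]; omega
      intro c hc d hd hxc hxd hcd
      rw [← hS3] at hc hd
      simp only [Finset.mem_insert, Finset.mem_singleton] at hc hd
      rcases hc with rfl | rfl | rfl
      · exact (hxc.ne rfl).elim
      · rcases hd with rfl | rfl | rfl
        · exact (hxd.ne rfl).elim
        · exact (hcd rfl).elim
        · exact hab
      · rcases hd with rfl | rfl | rfl
        · exact (hxd.ne rfl).elim
        · exact hab.symm
        · exact (hcd rfl).elim
    · obtain ⟨u, v, huv, hu, hv⟩ := ih h4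
      have hnadj := hS.not_adj h4 hu hv
      by_cases h1 : u = a ∨ u = b
      · refine ⟨w, v, fun h => hw (h ▸ hv.1), hws, hext v hv ?_ ?_⟩
        · rintro rfl
          rcases h1 with rfl | rfl
          · exact huv rfl
          · exact hnadj hab.symm
        · rintro rfl
          rcases h1 with rfl | rfl
          · exact hnadj hab
          · exact huv rfl
      · rw [not_or] at h1
        exact ⟨w, u, fun h => hw (h ▸ hu.1), hws, hext u hu h1.1 h1.2⟩

end TwoTrees

section ChainExists

variable {V : Type} {G : SimpleGraph V}

theorem Chain.snoc {y : ℕ → V} {p : ℕ → ℕ} {N j : ℕ} (h : Chain G y p N) (hN : 1 ≤ N) {v a b : V}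
    (hv : v ∉ seg y N) (ha : y N = a) (hj : j < N) (hb : y j = b) (hab : G.Adj a b)
    (hn : ∀ u ∈ seg y N, G.Adj v u ↔ u = a ∨ u = b) (h0 : 2 ≤ N → j ≠ 0) :
    ∃ y' p', Chain G y' p' (N + 1) ∧ seg y' (N + 1) = insert v (seg y N) ∧ y' 0 = y 0 ∧
      y' (N + 1) = v := by
  have hjp : j = N - 1 ∨ j = p N := by
    rw [← h.adj j N hj le_rfl, ha, hb]; exact hab.symm
  have hy : ∀ i, i ≤ N → Function.update y (N + 1) v i = y i := fun i hi =>
    Function.update_of_ne (by omega) _ _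
  have hyN : Function.update y (N + 1) v (N + 1) = v := Function.update_self ..
  refine ⟨Function.update y (N + 1) v,
    fun k => if k ≤ N then p k else if k = N + 1 then j else k - 2, ?_, ?_, hy 0 (by omega), hyN⟩
  · refine ⟨⟨?_, ?_, ?_, ?_, ?_⟩, ?_, ?_⟩
    · simp [h.p0]
    · simp [hN, h.p1]
    · by_cases h2 : 2 ≤ N
      · simp [h2, h.p2]
      · have : N = 1 := by omega
        subst this
        simp; omega
    · intro k hk
      split_ifs with h1 h2
      · exact h.pos k hk
      · have := h0 (by omega); omega
      · omega
    · intro k hk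
      rcases Nat.lt_trichotomy k N with h1 | h1 | h1
      · rw [if_pos (by omega), if_pos (by omega)]
        exact h.next k hk
      · subst h1
        rw [if_neg (by omega), if_pos rfl, if_pos le_rfl]
        tauto
      · right
        rw [if_neg (by omega), if_neg (by omega)]
        omega
    · intro i k hi hk hik
      rcases Nat.lt_or_ge N i with h1 | h1 <;> rcases Nat.lt_or_ge N k with h2 | h2
      · omega
      · have : i = N + 1 := by omega
        subst this
        rw [hyN, hy k h2] at hik
        exact (hv ⟨k, h2, hik.symm⟩).elim
      · have : k = N + 1 := by omega
        subst this
        rw [hyN, hy i h1] at hik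
        exact (hv ⟨i, h1, hik⟩).elim
      · rw [hy i h1, hy k h2] at hik
        exact h.inj i k h1 h2 hik
    · intro i k hik hk
      rcases Nat.lt_or_ge N k with h2 | h2
      · have : k = N + 1 := by omega
        subst this
        rw [hyN, hy i (by omega), if_neg (by omega), if_pos rfl, SimpleGraph.adj_comm,
          hn _ ⟨i, by omega, rfl⟩, ← ha, ← hb]
        constructor
        · rintro (h1 | h1)
          · left; have := h.inj _ _ (by omega) le_rfl h1; omega
          · right; exact h.inj _ _ (by omega) (by omega) h1
        · rintro (h1 | h1)
          · left; rw [h1]; simp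
          · right; rw [h1]
      · rw [hy i (by omega), hy k h2, if_pos h2]
        exact h.adj i k hik h2
  · ext u
    constructor
    · rintro ⟨i, hi, rfl⟩
      rcases Nat.lt_or_ge N i with h1 | h1
      · have : i = N + 1 := by omega
        subst this
        rw [hyN]; exact .inl rfl
      · rw [hy i h1]; exact .inr ⟨i, h1, rfl⟩
    · rintro (rfl | ⟨i, hi, rfl⟩)
      · exact ⟨N + 1, le_rfl, hyN⟩
      · exact ⟨i, by omega, hy i hi⟩

theorem Chain.edge {s s' : V} (h : G.Adj s s') :
    ∃ y p, Chain G y p 1 ∧ seg y 1 = {s, s'} ∧ y 0 = s ∧ y 1 = s' := by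
  refine ⟨fun i => if i = 0 then s else s', fun k => k - 2, ⟨⟨rfl, rfl, rfl, fun k hk => by omega,
    fun k hk => by omega⟩, ?_, ?_⟩, ?_, rfl, rfl⟩
  · intro i j hi hj
    rcases Nat.le_one_iff_eq_zero_or_eq_one.1 hi with rfl | rfl <;>
      rcases Nat.le_one_iff_eq_zero_or_eq_one.1 hj with rfl | rfl <;> simp [h.ne, h.ne']
  · intro j k hjk hk
    have h1 : k = 1 := by omega
    have h2 : j = 0 := by omega
    subst h1 h2
    simpa using h
  · ext u
    constructor
    · rintro ⟨i, hi, rfl⟩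
      rcases Nat.le_one_iff_eq_zero_or_eq_one.1 hi with rfl | rfl <;> simp
    · rintro (rfl | rfl)
      · exact ⟨0, by omega, rfl⟩
      · exact ⟨1, by omega, rfl⟩

theorem TT.chain (n : ℕ) {S : Finset V} (h : TT G S) (hn : S.card = n) {s s' : V}
    (hs : Simp G S s) (hs' : Simp G S s') (hss : s ≠ s')
    (hall : S.card ≠ 3 → ∀ u, Simp G S u → u = s ∨ u = s') :
    ∃ y p N, 1 ≤ N ∧ Chain G y p N ∧ seg y N = (S : Set V) ∧ y 0 = s ∧ y N = s' := by
  classical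
  induction n using Nat.strong_induction_on generalizing S s s' with
  | _ n ih =>
  rcases Nat.lt_or_ge S.card 3 with h3 | h3
  · have h2 : S = {s, s'} := Finset.eq_pair_of_card (by have := h.two_le; omega) hs.1 hs'.1 hss
    have hadj : G.Adj s s' := by
      cases h with
      | edge a b h =>
        have h1 := hs.1
        have h2 := hs'.1
        simp only [Finset.mem_insert, Finset.mem_singleton] at h1 h2
        rcases h1 with rfl | rfl <;> rcases h2 with rfl | rfl
        · exact (hss rfl).elim
        · exact h
        · exact h.symm
        · exact (hss rfl).elim
      | ext S v a b hS hv ha hb hab hn =>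
        rw [Finset.card_insert_of_notMem hv] at h3
        have := hS.two_le
        omega
    obtain ⟨y, p, h, hseg, h0, h1⟩ := Chain.edge hadj
    exact ⟨y, p, 1, le_rfl, h, by rw [hseg, h2]; simp, h0, h1⟩
  · obtain ⟨hT, a, b, ha, hb, hab, hnb⟩ := h.erase h3 hs'
    have hcard := Finset.card_erase_of_mem hs'.1
    have hsub : ∀ {u}, Simp G S u → u ≠ s' → Simp G (S.erase s') u := fun {u} hu hne =>
      ⟨by simp [hu.1, hne], fun x hx y hy => hu.2 x (Finset.mem_of_mem_erase hx) y
        (Finset.mem_of_mem_erase hy)⟩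
    have hsS := hsub hs hss
    have hva : s' ≠ a := ((hnb a ha).2 (.inl rfl)).ne
    have hvb : s' ≠ b := ((hnb b hb).2 (.inr rfl)).ne
    have hsup : ∀ u, Simp G (S.erase s') u → u ≠ a → u ≠ b → Simp G S u := by
      intro u hu hua hub
      have hnot : ¬ G.Adj s' u := fun hadj => by
        rcases (hnb u (Finset.mem_of_mem_erase hu.1)).1 hadj with h | h
        · exact hua h
        · exact hub h
      refine ⟨Finset.mem_of_mem_erase hu.1, fun x hx y hy hux huy => ?_⟩
      refine hu.2 x ?_ y ?_ hux huy
      · exact Finset.mem_erase.2 ⟨fun h => hnot (h ▸ hux.symm), hx⟩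
      · exact Finset.mem_erase.2 ⟨fun h => hnot (h ▸ huy.symm), hy⟩
    -- the new end of the shorter chain
    obtain ⟨a, b, ha, hb, hab, hnb, hsa, ha', hsb, hall'⟩ : ∃ a b, a ∈ S ∧ b ∈ S ∧ G.Adj a b ∧
        (∀ u ∈ S, G.Adj s' u ↔ u = a ∨ u = b) ∧ s ≠ a ∧ Simp G (S.erase s') a ∧
        (4 ≤ S.card → s ≠ b) ∧
        ((S.erase s').card ≠ 3 → ∀ u, Simp G (S.erase s') u → u = s ∨ u = a) := by
      rcases Nat.lt_or_ge S.card 4 with h4 | h4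
      · have h2 : S.erase s' = {a, b} := Finset.eq_pair_of_card (by omega)
          (by simp [ha, Ne.symm hva]) (by simp [hb, Ne.symm hvb]) hab.ne
        have hsimp : ∀ u ∈ S.erase s', Simp G (S.erase s') u := by
          intro u hu
          refine ⟨hu, ?_⟩
          rw [h2] at hu ⊢
          intro x hx y hy hux huy hxy
          simp only [Finset.mem_insert, Finset.mem_singleton] at hu hx hy
          have := hux.ne
          have := huy.ne
          rcases hu with rfl | rfl <;> rcases hx with rfl | rfl <;> rcases hy with rfl | rfl <;>
            simp_all
        have hmem : ∀ u, u ∈ S.erase s' → u = a ∨ u = b := fun u hu => by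
          rw [h2] at hu; simpa using hu
        have haS : a ∈ S.erase s' := by simp [ha, Ne.symm hva]
        have hbS : b ∈ S.erase s' := by simp [hb, Ne.symm hvb]
        rcases hmem s hsS.1 with rfl | rfl
        · exact ⟨b, s, hb, ha, hab.symm, fun u hu => by rw [hnb u hu, or_comm], hab.ne,
            hsimp b hbS, by omega, fun _ u hu => hmem u hu.1⟩
        · exact ⟨a, s, ha, hb, hab, hnb, hab.ne', hsimp a haS, by omega,
            fun _ u hu => (hmem u hu.1).symm⟩
      · have hnadj := h.not_adj h4 hs hs'
        have hsa : s ≠ a := fun h => hnadj (h ▸ ((hnb a ha).2 (.inl rfl)).symm)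
        have hsb : s ≠ b := fun h => hnadj (h ▸ ((hnb b hb).2 (.inr rfl)).symm)
        have hcl : ∀ u, Simp G (S.erase s') u → u = s ∨ u = a ∨ u = b := by
          intro u hu
          by_contra! hcon
          have h1 := hall (by omega) u (hsup u hu hcon.2.1 hcon.2.2)
          have h2 := Finset.ne_of_mem_erase hu.1
          tauto
        rcases Nat.lt_or_ge S.card 5 with h5 | h5
        · refine ⟨a, b, ha, hb, hab, hnb, hsa, ⟨by simp [ha, Ne.symm hva], ?_⟩, fun _ => hsb,
            fun h => by omega⟩
          have h2 : (S.erase s').erase a = {s, b} := Finset.eq_pair_of_card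
            (by rw [Finset.card_erase_of_mem (by simp [ha, Ne.symm hva])]; omega)
            (by simp [hsa, hss, hs.1]) (by simp [hab.ne', Ne.symm hvb, hb]) hsb
          intro x hx y hy hax hay hxy
          have hx' : x ∈ (S.erase s').erase a := Finset.mem_erase.2 ⟨hax.ne', hx⟩
          have hy' : y ∈ (S.erase s').erase a := Finset.mem_erase.2 ⟨hay.ne', hy⟩
          obtain ⟨-, c, d, hc, hd, hcd, hncd⟩ := hT.erase (by omega) hsS
          have hcab : c = a ∨ c = b := by
            by_cases hca : c = a
            · exact .inl hca
            · have : c ∈ (S.erase s').erase a := Finset.mem_erase.2 ⟨hca, hc⟩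
              rw [h2] at this
              simp only [Finset.mem_insert, Finset.mem_singleton] at this
              rcases this with h | h
              · exact (((hncd c hc).2 (.inl rfl)).ne h.symm).elim
              · exact .inr h
          have hdab : d = a ∨ d = b := by
            by_cases hca : d = a
            · exact .inl hca
            · have : d ∈ (S.erase s').erase a := Finset.mem_erase.2 ⟨hca, hd⟩
              rw [h2] at this
              simp only [Finset.mem_insert, Finset.mem_singleton] at this
              rcases this with h | h
              · exact (((hncd d hd).2 (.inr rfl)).ne h.symm).elim
              · exact .inr h
          have hsbadj : G.Adj s b := by
            apply (hncd b (by simp [hb, Ne.symm hvb])).2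
            have := hcd.ne
            rcases hcab with rfl | rfl <;> rcases hdab with rfl | rfl <;> simp_all
          rw [h2] at hx' hy'
          simp only [Finset.mem_insert, Finset.mem_singleton] at hx' hy'
          rcases hx' with rfl | rfl <;> rcases hy' with rfl | rfl
          · exact (hxy rfl).elim
          · exact hsbadj
          · exact hsbadj.symm
          · exact (hxy rfl).elim
        · have hnab : ¬ (Simp G (S.erase s') a ∧ Simp G (S.erase s') b) := fun h =>
            hT.not_adj (by omega) h.1 h.2 hab
          obtain ⟨u, v, huv, hu, hv⟩ := hT.exists_simp (by omega)
          have hor : Simp G (S.erase s') a ∨ Simp G (S.erase s') b := by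
            rcases hcl u hu with rfl | rfl | rfl
            · rcases hcl v hv with rfl | rfl | rfl
              · exact (huv rfl).elim
              · exact .inl hv
              · exact .inr hv
            · exact .inl hu
            · exact .inr hu
          rcases hor with hA | hB
          · refine ⟨a, b, ha, hb, hab, hnb, hsa, hA, fun _ => hsb, fun _ u hu => ?_⟩
            rcases hcl u hu with rfl | rfl | rfl
            · exact .inl rfl
            · exact .inr rfl
            · exact (hnab ⟨hA, hu⟩).elim
          · refine ⟨b, a, hb, ha, hab.symm, fun u hu => by rw [hnb u hu, or_comm], hsb, hB,
              fun _ => hsa, fun _ u hu => ?_⟩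
            rcases hcl u hu with rfl | rfl | rfl
            · exact .inl rfl
            · exact (hnab ⟨hu, hB⟩).elim
            · exact .inr rfl
    obtain ⟨y, p, N, hN, hC, hseg, h0, hyN⟩ := ih (S.erase s').card (by omega) hT rfl hsS ha' hsa
      hall'
    have hbm : b ∈ seg y N := by
      rw [hseg, Finset.mem_coe]
      exact Finset.mem_erase.2 ⟨((hnb b hb).2 (.inr rfl)).ne', hb⟩
    obtain ⟨j, hj, hyj⟩ := hbm
    have hjN : j ≠ N := fun h => hab.ne (by rw [← hyN, ← hyj, h])
    obtain ⟨y', p', hC', hseg', h0', hy'⟩ := hC.snoc hN (v := s') (a := a) (b := b) (j := j)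
      (by rw [hseg]; simp) hyN (by omega) hyj hab
      (fun u hu => hnb u (by rw [hseg] at hu; exact Finset.mem_of_mem_erase hu))
      (by
        rintro h2 rfl
        rw [h0] at hyj
        refine hsb ?_ hyj
        have hle : (Finset.range (N + 1)).card ≤ (S.erase s').card := by
          refine Finset.card_le_card_of_injOn y ?_ ?_
          · intro i hi
            have : y i ∈ seg y N := ⟨i, by simpa [Nat.lt_succ_iff] using hi, rfl⟩
            rw [hseg] at this
            exact this
          · intro i hi j hj
            simp only [Finset.coe_range, Set.mem_Iio] at hi hj
            exact hC.inj i j (by omega) (by omega)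
        rw [Finset.card_range] at hle
        omega)
    refine ⟨y', p', N + 1, by omega, hC', ?_, h0'.trans h0, hy'⟩
    rw [hseg', hseg]
    ext u
    simp only [Set.mem_insert_iff, Finset.mem_coe, Finset.mem_erase]
    constructor
    · rintro (rfl | h)
      · exact hs'.1
      · exact h.2
    · intro h
      by_cases hu : u = s' <;> tauto

end ChainExists

section Thru

variable {V : Type} {G : SimpleGraph V}

theorem SimpleGraph.Walk.IsPath.detour {a b v : V} (ha : G.Adj v a) (hb : G.Adj v b) {w w' : V}
    {p : G.Walk w w'} (hp : p.IsPath) (he : s(a, b) ∈ p.edges) (hv : v ∉ p.support) :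
    ∃ q : G.Walk w w', q.IsPath ∧ (∀ x ∈ q.support, x = v ∨ x ∈ p.support) ∧
      s(v, a) ∈ q.edges ∧ s(v, b) ∈ q.edges := by
  induction p with
  | nil => simp at he
  | cons h p ih =>
    rename_i u u' w'
    rw [SimpleGraph.Walk.cons_isPath_iff] at hp
    rw [SimpleGraph.Walk.support_cons, List.mem_cons, not_or] at hv
    rw [SimpleGraph.Walk.edges_cons, List.mem_cons] at he
    by_cases h1 : s(a, b) = s(u, u')
    · have key : ∀ (h1 : G.Adj u v) (h2 : G.Adj v u'),
          ∃ q : G.Walk u w', q.IsPath ∧ (∀ x ∈ q.support, x = v ∨ x ∈ (Walk.cons h p).support) ∧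
            s(v, u) ∈ q.edges ∧ s(v, u') ∈ q.edges := by
        intro h1 h2
        refine ⟨.cons h1 (.cons h2 p), ?_, ?_, ?_, ?_⟩
        · simp only [SimpleGraph.Walk.cons_isPath_iff, SimpleGraph.Walk.support_cons,
            List.mem_cons, not_or]
          exact ⟨⟨hp.1, hv.2⟩, h1.ne, hp.2⟩
        · intro x hx
          simp only [SimpleGraph.Walk.support_cons, List.mem_cons] at hx ⊢
          tauto
        · simp [Sym2.eq_swap]
        · simp
      rcases Sym2.eq_iff.1 h1 with ⟨rfl, rfl⟩ | ⟨rfl, rfl⟩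
      · exact key ha.symm hb
      · obtain ⟨q, h1, h2, h3, h4⟩ := key hb.symm ha
        exact ⟨q, h1, h2, h4, h3⟩
    · obtain ⟨q, hq, hqs, h3, h4⟩ := ih hp.1 (he.resolve_left h1) hv.2
      refine ⟨.cons h q, ?_, ?_, ?_, ?_⟩
      · rw [SimpleGraph.Walk.cons_isPath_iff]
        refine ⟨hq, fun hu => ?_⟩
        rcases hqs _ hu with h | h
        · exact hv.1 h.symm
        · exact hp.2 h
      · intro x hx
        simp only [SimpleGraph.Walk.support_cons, List.mem_cons] at hx ⊢
        rcases hx with h | h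
        · tauto
        · rcases hqs _ h with h | h <;> tauto
      · simp [h3]
      · simp [h4]

/-- Any two vertices of a 2-tree are the ends of a path through any given edge. -/
theorem TT.path_through {S : Finset V} (h : TT G S) {x y : V} (hx : x ∈ S) (hy : y ∈ S)
    (hxy : G.Adj x y) {w w' : V} (hw : w ∈ S) (hw' : w' ∈ S) (hne : w ≠ w') :
    ∃ p : G.Walk w w', p.IsPath ∧ (∀ z ∈ p.support, z ∈ S) ∧ s(x, y) ∈ p.edges := by
  classical
  induction h generalizing x y w w' with
  | edge a b h =>
    have key : ∀ a b : V, x ∈ ({a, b} : Finset V) → y ∈ ({a, b} : Finset V) → G.Adj a b →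
        ∃ p : G.Walk a b, p.IsPath ∧ (∀ z ∈ p.support, z ∈ ({a, b} : Finset V)) ∧
          s(x, y) ∈ p.edges := by
      intro a b hx hy h
      refine ⟨.cons h .nil, by simp [h.ne], by simp, ?_⟩
      simp only [Finset.mem_insert, Finset.mem_singleton] at hx hy
      have := hxy.ne
      rcases hx with rfl | rfl <;> rcases hy with rfl | rfl <;> simp_all [Sym2.eq_swap]
    have hw0 := hw
    have hw0' := hw'
    simp only [Finset.mem_insert, Finset.mem_singleton] at hw0 hw0'
    rcases hw0 with rfl | rfl <;> rcases hw0' with rfl | rfl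
    · exact (hne rfl).elim
    · exact key _ _ hx hy h
    · obtain ⟨p, h1, h2, h3⟩ := key _ _ (Finset.pair_comm w' w ▸ hx) (Finset.pair_comm w' w ▸ hy)
        h.symm
      exact ⟨p, h1, by rw [Finset.pair_comm]; exact h2, h3⟩
    · exact (hne rfl).elim
  | ext S v a b hS hv ha hb hab hn ih =>
    have hva : G.Adj v a := (hn a ha).2 (.inl rfl)
    have hvb : G.Adj v b := (hn b hb).2 (.inr rfl)
    -- a path starting at the new vertex
    have from_v : ∀ w' : V, w' ∈ S → ∀ x y : V, x ∈ insert v S → y ∈ insert v S → G.Adj x y →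
        ∃ p : G.Walk v w', p.IsPath ∧ (∀ z ∈ p.support, z ∈ insert v S) ∧ s(x, y) ∈ p.edges := by
      clear hx hy hxy hw hw' hne
      intro w' hw' x y hx hy hxy
      have key : ∀ c, c ∈ S → G.Adj v c → c ≠ w' → ∀ x y, x ∈ S → y ∈ S → G.Adj x y →
          ∃ p : G.Walk v w', p.IsPath ∧ (∀ z ∈ p.support, z ∈ insert v S) ∧ s(x, y) ∈ p.edges ∧
            s(v, c) ∈ p.edges := by
        intro c hc hvc hcw x y hx hy hxy
        obtain ⟨p, h1, h2, h3⟩ := ih hx hy hxy hc hw' hcw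
        refine ⟨.cons hvc p, ?_, ?_, by simp [h3], by simp⟩
        · rw [SimpleGraph.Walk.cons_isPath_iff]
          exact ⟨h1, fun h => hv (h2 _ h)⟩
        · intro z hz
          rw [SimpleGraph.Walk.support_cons, List.mem_cons] at hz
          rcases hz with rfl | hz
          · simp
          · simp [h2 z hz]
      have edge_v : ∀ c, c ∈ S → G.Adj v c →
          ∃ p : G.Walk v w', p.IsPath ∧ (∀ z ∈ p.support, z ∈ insert v S) ∧ s(v, c) ∈ p.edges := by
        intro c hc hvc
        by_cases hcw : c = w'
        · subst hcw
          exact ⟨.cons hvc .nil, by simp [hvc.ne], by simp [hc], by simp⟩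
        · obtain ⟨p, h1, h2, h3, h4⟩ := key c hc hvc hcw a b ha hb hab
          exact ⟨p, h1, h2, h4⟩
      rw [Finset.mem_insert] at hx hy
      rcases hx with rfl | hx <;> rcases hy with rfl | hy
      · exact (hxy.ne rfl).elim
      · exact edge_v y hy hxy
      · rw [Sym2.eq_swap]; exact edge_v x hx hxy.symm
      · by_cases haw : a = w'
        · obtain ⟨p, h1, h2, h3, h4⟩ := key b hb hvb (fun h => hab.ne (haw.trans h.symm)) x y hx hy
            hxy
          exact ⟨p, h1, h2, h3⟩
        · obtain ⟨p, h1, h2, h3, h4⟩ := key a ha hva haw x y hx hy hxy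
          exact ⟨p, h1, h2, h3⟩
    by_cases hwv : w = v
    · subst hwv
      exact from_v w' ((Finset.mem_insert.1 hw').resolve_left (Ne.symm hne)) x y hx hy hxy
    by_cases hwv' : w' = v
    · subst hwv'
      obtain ⟨p, h1, h2, h3⟩ := from_v w ((Finset.mem_insert.1 hw).resolve_left hne) x y hx hy hxy
      exact ⟨p.reverse, h1.reverse, by simpa using h2, by simpa using h3⟩
    have hw := (Finset.mem_insert.1 hw).resolve_left hwv
    have hw' := (Finset.mem_insert.1 hw').resolve_left hwv'
    have edge_v : ∀ c, c ∈ S → G.Adj v c →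
        ∃ p : G.Walk w w', p.IsPath ∧ (∀ z ∈ p.support, z ∈ insert v S) ∧ s(v, c) ∈ p.edges := by
      intro c hc hvc
      obtain ⟨p, h1, h2, h3⟩ := ih ha hb hab hw hw' hne
      obtain ⟨q, h4, h5, h6, h7⟩ := h1.detour hva hvb h3 (fun h => hv (h2 _ h))
      refine ⟨q, h4, fun z hz => ?_, ?_⟩
      · rcases h5 z hz with rfl | h
        · simp
        · simp [h2 z h]
      · rcases (hn c hc).1 hvc with rfl | rfl <;> assumption
    rw [Finset.mem_insert] at hx hy
    rcases hx with rfl | hx <;> rcases hy with rfl | hy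
    · exact (hxy.ne rfl).elim
    · exact edge_v y hy hxy
    · rw [Sym2.eq_swap]; exact edge_v x hx hxy.symm
    · obtain ⟨p, h1, h2, h3⟩ := ih hx hy hxy hw hw' hne
      exact ⟨p, h1, fun z hz => by simp [h2 z hz], h3⟩

end Thru

section Blocks

variable {V : Type} {G : SimpleGraph V}

/-- Remove from `G` all edges inside `B`. -/
def offSet (G : SimpleGraph V) (B : Set V) : SimpleGraph V where
  Adj u v := G.Adj u v ∧ ¬ (u ∈ B ∧ v ∈ B)
  symm := ⟨fun _ _ h => ⟨h.1.symm, fun h' => h.2 h'.symm⟩⟩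
  loopless := ⟨fun _ h => h.1.ne rfl⟩

theorem offSet_le (G : SimpleGraph V) (B : Set V) : offSet G B ≤ G := fun _ _ h => h.1

/-- The part of `G` hanging at the vertex `w` of `B`. -/
def gate (G : SimpleGraph V) (B : Set V) (w : V) : Set V := {v | (offSet G B).Reachable w v}

theorem mem_gate_self (G : SimpleGraph V) (B : Set V) (w : V) : w ∈ gate G B w :=
  SimpleGraph.Reachable.refl _

theorem gate_adj {B : Set V} {w u v : V} (hu : u ∈ gate G B w) (h : G.Adj u v)
    (hB : ¬ (u ∈ B ∧ v ∈ B)) : v ∈ gate G B w :=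
  SimpleGraph.Reachable.trans hu (SimpleGraph.Adj.reachable (G := offSet G B) ⟨h, hB⟩)

theorem exists_gate (hG : G.Connected) {B : Set V} {b : V} (hb : b ∈ B) (v : V) :
    ∃ w ∈ B, v ∈ gate G B w := by
  obtain ⟨p⟩ := hG v b
  induction p with
  | nil => exact ⟨_, hb, mem_gate_self _ _ _⟩
  | cons h p ih =>
    rename_i u u' b
    by_cases hu : u ∈ B
    · exact ⟨u, hu, mem_gate_self _ _ _⟩
    · obtain ⟨w, hw, hw'⟩ := ih hb
      exact ⟨w, hw, gate_adj hw' h.symm fun h => hu h.2⟩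

/-- Every edge leaving `A` does so at `c`. -/
def RootedAt (G : SimpleGraph V) (A : Set V) (c : V) : Prop :=
  c ∈ A ∧ ∀ u ∈ A, u ≠ c → ∀ v, G.Adj u v → v ∈ A

theorem RootedAt.mem_support {A : Set V} {c : V} (h : RootedAt G A c) {x y : V} (hx : x ∈ A)
    (hy : y ∉ A) (p : G.Walk x y) : c ∈ p.support := by
  induction p with
  | nil => exact (hy hx).elim
  | cons h' p ih =>
    rename_i u u' b
    rw [SimpleGraph.Walk.support_cons, List.mem_cons]
    by_cases hu : u = c
    · exact .inl hu.symm
    · exact .inr (ih (h.2 u hx hu _ h') hy)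

theorem dist_eq_of_mem_support (hG : G.Connected) {x y c : V}
    (h : ∀ p : G.Walk x y, c ∈ p.support) : G.dist x y = G.dist x c + G.dist c y := by
  classical
  apply le_antisymm hG.dist_triangle
  obtain ⟨p, hp⟩ := hG.exists_walk_length_eq_dist x y
  rw [← hp, ← SimpleGraph.Walk.take_spec p (h p), SimpleGraph.Walk.length_append]
  exact add_le_add (SimpleGraph.dist_le _) (SimpleGraph.dist_le _)

theorem RootedAt.dist_eq (hG : G.Connected) {A : Set V} {c : V} (h : RootedAt G A c) {x y : V}
    (hx : x ∈ A) (hy : y ∉ A) : G.dist x y = G.dist x c + G.dist c y :=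
  dist_eq_of_mem_support hG fun p => h.mem_support hx hy p

/-- Distinct vertices of `B` are not joined outside `B`. -/
def Separated (G : SimpleGraph V) (B : Set V) : Prop :=
  ∀ w ∈ B, ∀ w' ∈ B, (offSet G B).Reachable w w' → w = w'

theorem separated_of_block {B : Set V} (hB : IsBlockOf G B) {S : Finset V} (hSB : (S : Set V) = B)
    (hS : TT G S) : Separated G B := by
  classical
  by_contra hcon
  simp only [Separated, not_forall] at hcon
  obtain ⟨w₀, hw₀, w₀', hw₀', hr₀, hne₀⟩ := hcon
  let P : ℕ → Prop := fun n => ∃ w ∈ B, ∃ w' ∈ B, w ≠ w' ∧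
    ∃ p : (offSet G B).Walk w w', p.length = n
  have hex : ∃ n, P n := by
    obtain ⟨p⟩ := hr₀
    exact ⟨_, w₀, hw₀, w₀', hw₀', hne₀, p, rfl⟩
  obtain ⟨w, hw, w', hw', hne, p, hp⟩ := Nat.find_spec hex
  have hmin : ∀ m, P m → p.length ≤ m := fun m hm => hp ▸ Nat.find_min' hex hm
  have hpath : p.IsPath := by
    apply SimpleGraph.Walk.isPath_of_length_eq_dist
    apply le_antisymm _ (SimpleGraph.dist_le p)
    obtain ⟨q, hq⟩ := p.reachable.exists_walk_length_eq_dist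
    rw [← hq]
    exact hmin _ ⟨w, hw, w', hw', hne, q, rfl⟩
  have hint : ∀ x ∈ p.support, x ∈ B → x = w ∨ x = w' := by
    intro x hx hxB
    by_contra! h
    have h1 := SimpleGraph.Walk.length_takeUntil_lt_length hx h.2
    have h2 := hmin _ ⟨w, hw, x, hxB, h.1.symm, p.takeUntil x hx, rfl⟩
    omega
  obtain ⟨e₀, he₀, hBe⟩ := hB
  induction e₀ with
  | _ a b =>
  have hab : G.Adj a b := he₀
  have haB : a ∈ B := by rw [hBe]; exact ⟨_, he₀, .inl rfl, by simp⟩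
  have hbB : b ∈ B := by rw [hBe]; exact ⟨_, he₀, .inl rfl, by simp⟩
  rw [← hSB] at haB hbB
  cases p with
  | nil => exact hne rfl
  | cons h q =>
    rename_i x
    rw [SimpleGraph.Walk.cons_isPath_iff] at hpath
    have hxB : x ∉ B := fun hx => h.2 ⟨hw, hx⟩
    obtain ⟨r, hr, hrs, hre⟩ := hS.path_through haB hbB hab (w := w') (w' := w)
      (by rw [← Finset.mem_coe, hSB]; exact hw') (by rw [← Finset.mem_coe, hSB]; exact hw) hne.symm
    have hrB : ∀ z ∈ r.support, z ∈ B := fun z hz => by rw [← hSB]; exact hrs z hz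
    have hcyc : (SimpleGraph.Walk.cons h.1 ((q.mapLe (offSet_le G B)).append r)).IsCycle := by
      rw [SimpleGraph.Walk.cons_isCycle_iff]
      constructor
      · rw [SimpleGraph.Walk.isPath_def, SimpleGraph.Walk.support_append]
        rw [List.nodup_append]
        refine ⟨?_, ?_, ?_⟩
        · rw [← SimpleGraph.Walk.isPath_def]
          exact hpath.1.mapLe _
        · exact ((SimpleGraph.Walk.isPath_def _).1 hr).tail
        · rintro z hz z' hz' rfl
          have hzq : z ∈ q.support := by simpa using hz
          have hz1 := hrB z (List.mem_of_mem_tail hz')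
          rcases hint z (by simp [hzq]) hz1 with rfl | rfl
          · exact hpath.2 hzq
          · have := (SimpleGraph.Walk.isPath_def _).1 hr
            rw [← SimpleGraph.Walk.cons_tail_support, List.nodup_cons] at this
            exact this.1 hz'
      · rw [SimpleGraph.Walk.edges_append, List.mem_append, not_or]
        constructor
        · intro he
          have := SimpleGraph.Walk.fst_mem_support_of_mem_edges _ he
          exact hpath.2 (by simpa using this)
        · intro he
          exact hxB (hrB x (SimpleGraph.Walk.snd_mem_support_of_mem_edges _ he))
    apply hxB
    rw [hBe]
    exact ⟨s(w, x), h.1, .inr ⟨_, _, hcyc, by simp [hre], by simp⟩, by simp⟩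

theorem gate_rooted {B : Set V} (hB : Separated G B) {w : V} (hw : w ∈ B) :
    RootedAt G (gate G B w) w := by
  refine ⟨mem_gate_self _ _ _, fun u hu hne v h => gate_adj hu h fun h' => hne ?_⟩
  exact (hB w hw u h'.1 hu).symm

theorem gate_unique {B : Set V} (hB : Separated G B) {w w' v : V} (hw : w ∈ B) (hw' : w' ∈ B)
    (h : v ∈ gate G B w) (h' : v ∈ gate G B w') : w = w' :=
  hB w hw w' hw' (SimpleGraph.Reachable.trans h (SimpleGraph.Reachable.symm h'))

/-- A function that is 1-Lipschitz along the edges inside `B` is so for the distance of `G`. -/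
theorem lipschitz_of_separated (hG : G.Connected) {B : Set V} (hB : Separated G B) (φ : V → ℕ)
    (hφ : ∀ u v, u ∈ B → v ∈ B → G.Adj u v → φ u ≤ φ v + 1) {x y : V} (hx : x ∈ B) (hy : y ∈ B) :
    φ x ≤ φ y + G.dist x y := by
  choose g hg hg' using fun v => exists_gate hG hx v
  have key : ∀ u v (p : G.Walk u v), φ (g u) ≤ φ (g v) + p.length := by
    intro u v p
    induction p with
    | nil => simp
    | cons h p ih =>
      rename_i u u' v
      rw [SimpleGraph.Walk.length_cons]
      have : φ (g u) ≤ φ (g u') + 1 := by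
        by_cases hb : u ∈ B ∧ u' ∈ B
        · have h1 := hB _ (hg u) u hb.1 (hg' u)
          have h2 := hB _ (hg u') u' hb.2 (hg' u')
          rw [h1, h2]
          exact hφ u u' hb.1 hb.2 h
        · have := gate_unique hB (hg u) (hg u') (gate_adj (hg' u) h hb) (hg' u')
          rw [this]; omega
      omega
  obtain ⟨p, hp⟩ := hG.exists_walk_length_eq_dist x y
  have h1 := hB _ (hg x) x hx (hg' x)
  have h2 := hB _ (hg y) y hy (hg' y)
  have := key x y p
  rw [h1, h2, hp] at this
  exact this

theorem TT.exists_adj {S : Finset V} (h : TT G S) : ∀ x ∈ S, ∃ y ∈ S, G.Adj x y := by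
  classical
  induction h with
  | edge a b h =>
    intro x hx
    simp only [Finset.mem_insert, Finset.mem_singleton] at hx
    rcases hx with rfl | rfl
    · exact ⟨b, by simp, h⟩
    · exact ⟨a, by simp, h.symm⟩
  | ext S v a b hS hv ha hb hab hn ih =>
    intro x hx
    rw [Finset.mem_insert] at hx
    rcases hx with rfl | hx
    · exact ⟨a, by simp [ha], (hn a ha).2 (.inl rfl)⟩
    · obtain ⟨y, hy, h⟩ := ih x hx
      exact ⟨y, by simp [hy], h⟩

theorem block_subset (hG : G.Connected) {S : Finset V} (hS : TT G S) {B' : Set V}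
    (hB' : Separated G B') {u v : V} (hu : u ∈ S) (hv : v ∈ S) (huv : u ≠ v) (hu' : u ∈ B')
    (hv' : v ∈ B') : (S : Set V) ⊆ B' := by
  classical
  intro x hx
  by_contra hxB
  obtain ⟨z, hz, hxz⟩ := hS.exists_adj x hx
  obtain ⟨p, hp, hps, hpe⟩ := hS.path_through hx hz hxz hu hv huv
  have hxp := SimpleGraph.Walk.fst_mem_support_of_mem_edges _ hpe
  obtain ⟨w, hw, hxw⟩ := exists_gate hG hu' x
  have hroot := gate_rooted hB' hw
  have hxw' : x ≠ w := fun h => hxB (h ▸ hw)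
  have h1 : w ∈ (p.takeUntil x hxp).reverse.support := by
    by_cases huw : u = w
    · subst huw; exact SimpleGraph.Walk.end_mem_support _
    · exact hroot.mem_support hxw (fun h => huw (hB' w hw u hu' h).symm) _
  have h2 : w ∈ (p.dropUntil x hxp).support := by
    by_cases hvw : v = w
    · subst hvw; exact SimpleGraph.Walk.end_mem_support _
    · exact hroot.mem_support hxw (fun h => hvw (hB' w hw v hv' h).symm) _
  rw [SimpleGraph.Walk.support_reverse, List.mem_reverse] at h1
  have hnd := (SimpleGraph.Walk.isPath_def _).1 hp
  rw [← SimpleGraph.Walk.take_spec p hxp, SimpleGraph.Walk.support_append, List.nodup_append] at hnd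
  rw [← SimpleGraph.Walk.cons_tail_support, List.mem_cons] at h2
  exact hnd.2.2 w h1 w (h2.resolve_left hxw'.symm) rfl

theorem exists_block {u v : V} (h : G.Adj u v) : ∃ B, IsBlockOf G B ∧ u ∈ B ∧ v ∈ B :=
  ⟨_, ⟨s(u, v), h, rfl⟩, ⟨s(u, v), h, .inl rfl, by simp⟩, ⟨s(u, v), h, .inl rfl, by simp⟩⟩

theorem cutVertex_of_gate (hG : G.Connected) {B : Set V} (hB : Separated G B) {w w' u : V}
    (hw : w ∈ B) (hw' : w' ∈ B) (hne : w' ≠ w) (hu : u ∈ gate G B w) (huw : u ≠ w) :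
    IsCutVertex G w := by
  refine ⟨hG, fun hcon => ?_⟩
  obtain ⟨p⟩ := hcon ⟨u, huw⟩ ⟨w', hne⟩
  have h1 := (gate_rooted hB hw).mem_support hu (y := w') (fun h => hne (hB w hw w' hw' h).symm)
    (p.map (SimpleGraph.Embedding.induce _).toHom)
  have h2 := (SimpleGraph.Walk.support_map (SimpleGraph.Embedding.induce {u | u ≠ w}).toHom p) ▸ h1
  obtain ⟨x, -, hx⟩ := List.mem_map.1 h2
  exact x.2 hx

/-- A vertex that is simplicial in each of its blocks. -/
def Nodal (G : SimpleGraph V) (v : V) : Prop :=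
  ∀ B : Set V, IsBlockOf G B → ∀ h : v ∈ B, IsSimplicial (G.induce B) ⟨v, h⟩

theorem IsSimplicial.nodal {v : V} (h : IsSimplicial G v) : Nodal G v := by
  intro B _ hv a ha b hb hab
  exact h ha hb fun h => hab (Subtype.ext h)

namespace IsSemiTwoTree

variable (hG : IsSemiTwoTree G)
include hG

end IsSemiTwoTree
end Blocks

section BlockData

variable {V : Type} {G T : SimpleGraph V}

theorem SimpleGraph.Walk.mem_edges_iff_getVert {u v : V} (p : G.Walk u v) (e : Sym2 V) :
    e ∈ p.edges ↔ ∃ i < p.length, e = s(p.getVert i, p.getVert (i + 1)) := by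
  induction p with
  | nil => simp
  | cons h p ih =>
    rw [SimpleGraph.Walk.edges_cons, List.mem_cons, ih]
    constructor
    · rintro (rfl | ⟨i, hi, rfl⟩)
      · exact ⟨0, by simp, by simp⟩
      · exact ⟨i + 1, by simpa using hi, by simp⟩
    · rintro ⟨i, hi, rfl⟩
      rcases i with _ | i
      · left; simp
      · right; exact ⟨i, by simpa using hi, by simp⟩

namespace Chain

variable {y : ℕ → V} {p : ℕ → ℕ} {N : ℕ}

theorem lipschitz (h : Chain G y p N) (hG : G.Connected) (hB : Separated G (seg y N)) (ψ : ℕ → ℕ)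
    (hψ : ∀ i j, i ≤ N → j ≤ N → G.Adj (y i) (y j) → ψ i ≤ ψ j + 1) {i j : ℕ} (hi : i ≤ N)
    (hj : j ≤ N) : ψ i ≤ ψ j + G.dist (y i) (y j) := by
  classical
  let φ : V → ℕ := fun v => if h : ∃ i, i ≤ N ∧ y i = v then ψ h.choose else 0
  have hφ : ∀ i ≤ N, φ (y i) = ψ i := by
    intro i hi
    have hex : ∃ j, j ≤ N ∧ y j = y i := ⟨i, hi, rfl⟩
    have : φ (y i) = ψ hex.choose := dif_pos hex
    rw [this, h.inj _ _ hex.choose_spec.1 hi hex.choose_spec.2]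
  have := lipschitz_of_separated hG hB φ (by
    rintro u v ⟨i, hi, rfl⟩ ⟨j, hj, rfl⟩ hadj
    rw [hφ i hi, hφ j hj]
    exact hψ i j hi hj hadj) (mem_seg (y := y) hi) (mem_seg (y := y) hj)
  rwa [hφ i hi, hφ j hj] at this

theorem dist_le_lev (h : Chain G y p N) (hG : G.Connected) {k : ℕ} (hk : k ≤ N) :
    G.dist (y 0) (y k) ≤ lev p k := by
  induction k using Nat.strong_induction_on with
  | _ k ih =>
    rcases Nat.eq_zero_or_pos k with rfl | h0
    · simp
    · have := h.parents.lt' h0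
      have h1 := ih (p k) this (by omega)
      rw [h.parents.lev_eq h0]
      have h2 := hG.dist_triangle (u := y 0) (v := y (p k)) (w := y k)
      have h3 := SimpleGraph.dist_eq_one_iff_adj.2 (h.adj_par h0 hk)
      omega

theorem dist_eq_lev (h : Chain G y p N) (hG : G.Connected) (hB : Separated G (seg y N)) {k : ℕ}
    (hk : k ≤ N) : G.dist (y 0) (y k) = lev p k := by
  apply le_antisymm (h.dist_le_lev hG hk)
  have hlt : ∀ i j, i < j → j ≤ N → G.Adj (y i) (y j) →
      lev p i ≤ lev p j ∧ lev p j ≤ lev p i + 1 := by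
    intro i j hij hj hadj
    refine ⟨h.parents.lev_mono hij.le, ?_⟩
    rcases (h.adj i j hij hj).1 hadj with rfl | rfl
    · have := h.parents.lev_succ (j - 1)
      rwa [Nat.sub_add_cancel (by omega)] at this
    · rw [← h.parents.lev_eq (by omega)]
  have := h.lipschitz hG hB (lev p) (fun i j hi hj hadj => by
    rcases Nat.lt_trichotomy i j with hlt' | rfl | hlt'
    · have := hlt i j hlt' hj hadj; omega
    · omega
    · have := hlt j i hlt' hi hadj.symm; omega) hk (Nat.zero_le N)
  rw [h.parents.lev_zero, SimpleGraph.dist_comm] at this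
  omega

end Chain

/-- The structure of a block `B` with simplicial vertices `s` and `s'` and skeleton `T`. -/
structure BlockEnds (G T : SimpleGraph V) (B : Set V) (s s' : V) : Prop where
  block : IsBlockOf G B
  sep : Separated G B
  ne : s ≠ s'
  chain : ∃ y p N, 1 ≤ N ∧ Chain G y p N ∧ seg y N = B ∧ y 0 = s ∧ y N = s'
  chain' : ∃ y p N, 1 ≤ N ∧ Chain G y p N ∧ seg y N = B ∧ y 0 = s' ∧ y N = s
  nodal : ∀ v ∈ B, Nodal G v ↔ v = s ∨ v = s'
  diam : ∀ a ∈ B, ∀ b ∈ B, G.dist a b ≤ G.dist s s'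
  spine : ∃ w : ℕ → V, w 0 = s ∧ w (G.dist s s') = s' ∧
    (∀ i j, i ≤ G.dist s s' → j ≤ G.dist s s' → w i = w j → i = j) ∧
    (∀ i ≤ G.dist s s', w i ∈ B) ∧
    (∀ i < G.dist s s', T.Adj (w i) (w (i + 1))) ∧
    ∀ u v, u ∈ B → v ∈ B → T.Adj u v → ∃ i < G.dist s s', s(u, v) = s(w i, w (i + 1))

theorem BlockEnds.mem {B : Set V} {s s' : V} (h : BlockEnds G T B s s') : s ∈ B := by
  obtain ⟨y, p, N, hN, hC, rfl, rfl, -⟩ := h.chain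
  exact mem_seg (Nat.zero_le _)

theorem BlockEnds.symm {B : Set V} {s s' : V} (h : BlockEnds G T B s s') :
    BlockEnds G T B s' s := by
  have hd := SimpleGraph.dist_comm (G := G) (u := s) (v := s')
  refine ⟨h.block, h.sep, h.ne.symm, h.chain', h.chain, fun v hv => by rw [h.nodal v hv, or_comm],
    fun a ha b hb => hd ▸ h.diam a ha b hb, ?_⟩
  obtain ⟨w, h0, h1, h2, h3, h4, h5⟩ := h.spine
  rw [← hd]
  refine ⟨fun i => w (G.dist s s' - i), by simpa using h1, by simpa using h0, ?_, ?_, ?_, ?_⟩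
  · intro i j hi hj hij
    have := h2 _ _ (by omega) (by omega) hij
    omega
  · intro i hi
    exact h3 _ (by omega)
  · intro i hi
    have := h4 (G.dist s s' - (i + 1)) (by omega)
    rw [show G.dist s s' - (i + 1) + 1 = G.dist s s' - i by omega] at this
    exact this.symm
  · intro u v hu hv huv
    obtain ⟨i, hi, he⟩ := h5 u v hu hv huv
    refine ⟨G.dist s s' - (i + 1), by omega, ?_⟩
    dsimp only
    rw [he, show G.dist s s' - (G.dist s s' - (i + 1)) = i + 1 by omega,
      show G.dist s s' - (G.dist s s' - (i + 1) + 1) = i by omega, Sym2.eq_swap]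

theorem isSimplicial_induce_iff {B : Set V} {S : Finset V} (hS : (S : Set V) = B) {v : V}
    (hv : v ∈ B) : IsSimplicial (G.induce B) ⟨v, hv⟩ ↔ Simp G S v := by
  subst hS
  constructor
  · intro h
    refine ⟨hv, fun a ha b hb hva hvb hab => ?_⟩
    exact h (x := ⟨a, ha⟩) hva (y := ⟨b, hb⟩) hvb fun h => hab (congrArg Subtype.val h)
  · intro h a ha b hb hab
    exact h.2 a.1 a.2 b.1 b.2 ha hb fun h => hab (Subtype.ext h)

namespace IsSemiTwoTree

variable (hG : IsSemiTwoTree G)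
include hG

theorem exists_tt {B : Set V} (hB : IsBlockOf G B) : ∃ S : Finset V, (S : Set V) = B ∧ TT G S := by
  obtain ⟨S, hS, h⟩ := (hG.2.1 B hB).1.tt G Subtype.val Subtype.val_injective fun a b => Iff.rfl
  exact ⟨S, by rw [hS, Subtype.range_coe], h⟩

theorem separated {B : Set V} (hB : IsBlockOf G B) : Separated G B := by
  obtain ⟨S, hS, h⟩ := hG.exists_tt hB
  exact separated_of_block hB hS h

theorem block_eq {B B' : Set V} (hB : IsBlockOf G B) (hB' : IsBlockOf G B') {u v : V}
    (huv : u ≠ v) (hu : u ∈ B) (hv : v ∈ B) (hu' : u ∈ B') (hv' : v ∈ B') : B = B' := by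
  have key : ∀ {B B' : Set V}, IsBlockOf G B → IsBlockOf G B' → u ∈ B → v ∈ B → u ∈ B' → v ∈ B' →
      B ⊆ B' := by
    intro B B' hB hB' hu hv hu' hv'
    obtain ⟨S, rfl, h⟩ := hG.exists_tt hB
    exact block_subset hG.1 h (hG.separated hB') hu hv huv hu' hv'
  exact (key hB hB' hu hv hu' hv').antisymm (key hB' hB hu' hv' hu hv)

theorem exists_ne {B : Set V} (hB : IsBlockOf G B) {v : V} (hv : v ∈ B) :
    ∃ x ∈ B, G.Adj v x := by
  obtain ⟨S, rfl, h⟩ := hG.exists_tt hB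
  exact h.exists_adj v hv

theorem nodal_of_gate {B : Set V} (hB : IsBlockOf G B) {v x : V} (hv : v ∈ B)
    (hx : x ∈ gate G B v) (hxv : x ≠ v) : Nodal G v := by
  obtain ⟨w, hw, hvw⟩ := hG.exists_ne hB hv
  exact hG.2.2 v (cutVertex_of_gate hG.1 (hG.separated hB) hv hw hvw.ne' hx hxv)

theorem nodal_of_simplicial {B : Set V} (hB : IsBlockOf G B) {v : V} (hv : v ∈ B)
    (hs : IsSimplicial (G.induce B) ⟨v, hv⟩) : Nodal G v := by
  intro B' hB' hv'
  by_cases hBB : B = B'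
  · subst hBB; exact hs
  · obtain ⟨x, hx, hvx⟩ := hG.exists_ne hB' hv'
    refine hG.nodal_of_gate hB hv (gate_adj (mem_gate_self G B v) hvx fun h => hBB ?_) hvx.ne' B'
      hB' hv'
    exact hG.block_eq hB hB' hvx.ne hv h.2 hv' hx

theorem induce_connected {B : Set V} (hB : IsBlockOf G B) {b : V} (hb : b ∈ B) :
    (G.induce B).Connected := by
  obtain ⟨S, rfl, h⟩ := hG.exists_tt hB
  have : Nonempty (S : Set V) := ⟨⟨b, hb⟩⟩
  refine ⟨fun u v => ?_⟩
  by_cases huv : u = v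
  · rw [huv]
  · obtain ⟨x, hx, hux⟩ := h.exists_adj u.1 u.2
    obtain ⟨p, hp, hps, -⟩ := h.path_through u.2 hx hux u.2 v.2 fun h => huv (Subtype.ext h)
    exact ⟨p.induce _ hps⟩

theorem exists_blockEnds (hT : IsSkeleton G T) {B : Set V} (hB : IsBlockOf G B) :
    ∃ s s', BlockEnds G T B s s' := by
  obtain ⟨hTG, E, hE, hTE⟩ := hT
  obtain ⟨s₁, s₂, q, hne, hs₁, hs₂, hq, hqd, hdiam, hEB⟩ := hE B hB
  obtain ⟨S, hS, hTT⟩ := hG.exists_tt hB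
  have hsep := hG.separated hB
  have hconn := hG.induce_connected hB s₁.2
  have hne' : s₁.1 ≠ s₂.1 := fun h => hne (Subtype.ext h)
  have hall : ∀ x, IsSimplicial (G.induce B) x → x = s₁ ∨ x = s₂ := by
    obtain ⟨a, b, hab, h⟩ := Set.ncard_eq_two.1 (hG.2.1 B hB).2
    have h1 : s₁ ∈ ({a, b} : Set B) := by rw [← h]; exact hs₁
    have h2 : s₂ ∈ ({a, b} : Set B) := by rw [← h]; exact hs₂
    intro x hx
    have h3 : x ∈ ({a, b} : Set B) := by rw [← h]; exact hx
    simp only [Set.mem_insert_iff, Set.mem_singleton_iff] at h1 h2 h3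
    rcases h1 with rfl | rfl <;> rcases h2 with rfl | rfl <;> tauto
  have hle : ∀ a b : B, G.dist a.1 b.1 ≤ (G.induce B).dist a b := by
    intro a b
    obtain ⟨r, hr⟩ := hconn.exists_walk_length_eq_dist a b
    rw [← hr, ← SimpleGraph.Walk.length_map (SimpleGraph.Embedding.induce B).toHom r]
    exact SimpleGraph.dist_le _
  have hd : G.dist s₁.1 s₂.1 = q.length := by
    classical
    apply le_antisymm ((hle _ _).trans hqd.ge)
    have := lipschitz_of_separated hG.1 hsep
      (fun v => if h : v ∈ B then (G.induce B).dist s₁ ⟨v, h⟩ else 0) (fun u v hu hv huv => by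
        simp only [hu, hv, dif_pos]
        have h1 := hconn.dist_triangle (u := s₁) (v := ⟨v, hv⟩) (w := ⟨u, hu⟩)
        have h2 : (G.induce B).dist ⟨v, hv⟩ ⟨u, hu⟩ = 1 :=
          SimpleGraph.dist_eq_one_iff_adj.2 huv.symm
        omega) s₂.2 s₁.2
    simp only [Subtype.coe_prop, dif_pos, Subtype.coe_eta, SimpleGraph.dist_self] at this
    rw [hqd, SimpleGraph.dist_comm (G := G)]
    omega
  have hsimp : ∀ v (hv : v ∈ B), Nodal G v ↔ IsSimplicial (G.induce B) ⟨v, hv⟩ := fun v hv =>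
    ⟨fun h => h B hB hv, hG.nodal_of_simplicial hB hv⟩
  have hcard : S.card ≠ 3 → ∀ u, Simp G S u → u = s₁.1 ∨ u = s₂.1 := by
    intro _ u hu
    have huB : u ∈ B := by rw [← hS]; exact hu.1
    rcases hall ⟨u, huB⟩ ((isSimplicial_induce_iff hS huB).2 hu) with h | h
    · left; rw [← h]
    · right; rw [← h]
  have hS₁ := (isSimplicial_induce_iff hS s₁.2).1 hs₁
  have hS₂ := (isSimplicial_induce_iff hS s₂.2).1 hs₂
  refine ⟨s₁.1, s₂.1, hB, hsep, hne', ?_, ?_, ?_, ?_, ?_⟩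
  · obtain ⟨y, p, N, hN, hC, hseg, h0, h1⟩ := hTT.chain _ rfl hS₁ hS₂ hne' hcard
    exact ⟨y, p, N, hN, hC, hseg.trans hS, h0, h1⟩
  · obtain ⟨y, p, N, hN, hC, hseg, h0, h1⟩ := hTT.chain _ rfl hS₂ hS₁ hne'.symm
      fun h u hu => (hcard h u hu).symm
    exact ⟨y, p, N, hN, hC, hseg.trans hS, h0, h1⟩
  · intro v hv
    rw [hsimp v hv]
    constructor
    · intro h
      rcases hall _ h with h | h
      · left; rw [← h]
      · right; rw [← h]
    · rintro (rfl | rfl)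
      · exact hs₁
      · exact hs₂
  · intro a ha b hb
    rw [hd]
    exact (hle ⟨a, ha⟩ ⟨b, hb⟩).trans (hdiam _ _)
  · rw [hd]
    have hinB : ∀ u v, u ∈ B → v ∈ B → (T.Adj u v ↔ ∃ i < q.length,
        s(u, v) = s((q.getVert i).1, (q.getVert (i + 1)).1)) := by
      intro u v hu hv
      rw [← SimpleGraph.mem_edgeSet, hTE]
      simp only [Set.mem_iUnion, Set.mem_ofPred_eq, exists_prop]
      have hmem : s(u, v) ∈ E B ↔ ∃ i < q.length,
          s(u, v) = s((q.getVert i).1, (q.getVert (i + 1)).1) := by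
        rw [hEB]
        simp only [Set.mem_image, Set.mem_ofPred_eq, SimpleGraph.Walk.mem_edges_iff_getVert]
        constructor
        · rintro ⟨e, ⟨i, hi, rfl⟩, he⟩
          exact ⟨i, hi, by rw [← he]; rfl⟩
        · rintro ⟨i, hi, he⟩
          exact ⟨_, ⟨i, hi, rfl⟩, by rw [he]; rfl⟩
      rw [← hmem]
      constructor
      · rintro ⟨B', hB', h⟩
        obtain ⟨t₁, t₂, q', -, -, -, -, -, -, hEB'⟩ := hE B' hB'
        rw [hEB'] at h
        obtain ⟨e, he, hee⟩ := h
        have hB'mem : ∀ z ∈ s(u, v), z ∈ B' := by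
          rw [← hee]
          intro z hz
          obtain ⟨z', -, rfl⟩ := Sym2.mem_map.1 hz
          exact z'.2
        have hadj : G.Adj u v := by
          have he' := SimpleGraph.Walk.edges_subset_edgeSet q' he
          induction e with
          | _ a b =>
            have : G.Adj a.1 b.1 := he'
            rw [← SimpleGraph.mem_edgeSet, ← hee]
            exact this
        have : B' = B := hG.block_eq hB' hB hadj.ne (hB'mem u (by simp)) (hB'mem v (by simp)) hu hv
        subst this
        rw [hEB']
        exact ⟨e, he, hee⟩
      · exact fun h => ⟨B, hB, h⟩
    refine ⟨fun i => (q.getVert i).1, by simp, by simp, ?_, fun i _ => (q.getVert i).2, ?_,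
      fun u v hu hv h => (hinB u v hu hv).1 h⟩
    · intro i j hi hj hij
      exact hq.getVert_injOn (x₁ := i) hi (x₂ := j) hj (Subtype.ext hij)
    · intro i hi
      exact (hinB _ _ (q.getVert i).2 (q.getVert (i + 1)).2).2 ⟨i, hi, rfl⟩

end IsSemiTwoTree
end BlockData

section Node

variable {V : Type} {G T : SimpleGraph V}

theorem TT.exists_avoiding {S : Finset V} (hS : TT G S) {u x c : V} (hu : u ∈ S) (hx : x ∈ S)
    (huc : u ≠ c) (hxc : x ≠ c) : ∃ p : G.Walk u x, c ∉ p.support := by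
  classical
  obtain ⟨z, hz, hxz⟩ := hS.exists_adj x hx
  by_cases hc : c ∈ S
  · obtain ⟨p, hp, -, he⟩ := hS.path_through hx hz hxz hu hc huc
    have hxp := SimpleGraph.Walk.fst_mem_support_of_mem_edges _ he
    exact ⟨p.takeUntil x hxp, SimpleGraph.Walk.endpoint_notMem_support_takeUntil hp hxp hxc.symm⟩
  · by_cases hux : u = x
    · subst hux
      exact ⟨.nil, by simpa using huc.symm⟩
    · obtain ⟨p, -, hps, -⟩ := hS.path_through hx hz hxz hu hx hux
      exact ⟨p, fun h => hc (hps _ h)⟩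

/-- `A` splits at the root `c` into a block `B` from `c` to `c'`, the part `A₁` hanging at `c'` and
the rest `A₂`. -/
structure Node (G T : SimpleGraph V) (A : Set V) (c : V) (B : Set V) (c' : V) (A₁ A₂ : Set V) :
    Prop where
  ends : BlockEnds G T B c c'
  root₁ : RootedAt G A₁ c'
  root₂ : RootedAt G A₂ c
  union : A₁ ∪ B ∪ A₂ = A
  inter₁ : ∀ v ∈ A₁, v ∈ B → v = c'
  inter₂ : ∀ v ∈ A₂, v ∈ B → v = c
  disj : ∀ v ∈ A₁, v ∉ A₂
  edges : ∀ u v, G.Adj u v → u ∈ A → v ∈ A →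
    (u ∈ B ∧ v ∈ B) ∨ (u ∈ A₁ ∧ v ∈ A₁) ∨ (u ∈ A₂ ∧ v ∈ A₂)

namespace IsSemiTwoTree

variable (hG : IsSemiTwoTree G)
include hG

theorem block_subset_rooted {A B : Set V} {c u : V} (hA : RootedAt G A c) (hB : IsBlockOf G B)
    (huA : u ∈ A) (huB : u ∈ B) (huc : u ≠ c) : B ⊆ A := by
  obtain ⟨S, rfl, hS⟩ := hG.exists_tt hB
  intro x hx
  by_contra hxA
  obtain ⟨p, hp⟩ := hS.exists_avoiding huB hx huc fun h => hxA (h ▸ hA.1)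
  exact hp (hA.mem_support huA hxA p)

theorem node {A B : Set V} {c c' : V} (hA : RootedAt G A c) (hB : BlockEnds G T B c c')
    (hBA : B ⊆ A) : Node G T A c B c' (gate G B c') (A ∩ gate G B c) := by
  classical
  have hsep := hB.sep
  have hc := hB.mem
  have hc' := hB.symm.mem
  have hsub : gate G B c' ⊆ A := by
    intro v hv
    by_contra hvA
    obtain ⟨p⟩ := id (show (offSet G B).Reachable c' v from hv)
    have hA' : RootedAt (offSet G B) A c := ⟨hA.1, fun u hu hne v h => hA.2 u hu hne v h.1⟩
    have h1 := hA'.mem_support (hBA hc') hvA p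
    have h2 : (offSet G B).Reachable c' c := ⟨p.takeUntil c h1⟩
    exact hB.ne (hsep c' hc' c hc h2).symm
  refine ⟨hB, gate_rooted hsep hc', ?_, ?_, ?_, ?_, ?_, ?_⟩
  · refine ⟨⟨hA.1, mem_gate_self _ _ _⟩, fun u hu hne v h => ⟨hA.2 u hu.1 hne v h, ?_⟩⟩
    exact (gate_rooted hsep hc).2 u hu.2 hne v h
  · ext v
    constructor
    · rintro ((h | h) | h)
      · exact hsub h
      · exact hBA h
      · exact h.1
    · intro hv
      obtain ⟨w, hw, hvw⟩ := exists_gate hG.1 hc v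
      by_cases hwv : v = w
      · subst hwv; exact .inl (.inr hw)
      · rcases (hB.nodal w hw).1 (hG.nodal_of_gate hB.block hw hvw hwv) with rfl | rfl
        · exact .inr ⟨hv, hvw⟩
        · exact .inl (.inl hvw)
  · intro v hv hvB
    exact (hsep c' hc' v hvB hv).symm
  · intro v hv hvB
    exact (hsep c hc v hvB hv.2).symm
  · intro v hv hv'
    exact hB.ne (gate_unique hsep hc hc' hv'.2 hv)
  · intro u v h hu hv
    by_cases huv : u ∈ B ∧ v ∈ B
    · exact .inl huv
    · obtain ⟨w, hw, huw⟩ := exists_gate hG.1 hc u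
      have hvw := gate_adj huw h huv
      have hne : u ≠ w ∨ v ≠ w := by
        by_contra! hcon
        exact h.ne (hcon.1.trans hcon.2.symm)
      have hnod : Nodal G w := by
        rcases hne with hne | hne
        · exact hG.nodal_of_gate hB.block hw huw hne
        · exact hG.nodal_of_gate hB.block hw hvw hne
      rcases (hB.nodal w hw).1 hnod with rfl | rfl
      · exact .inr (.inr ⟨⟨hu, huw⟩, hv, hvw⟩)
      · exact .inr (.inl ⟨huw, hvw⟩)

theorem exists_node (hT : IsSkeleton G T) {A : Set V} {c : V} (hA : RootedAt G A c)
    (hc : Nodal G c) (hne : A ≠ {c}) : ∃ B c' A₁ A₂, Node G T A c B c' A₁ A₂ := by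
  obtain ⟨x, hx, hxc⟩ : ∃ x ∈ A, x ≠ c := by
    by_contra! h
    exact hne (Set.eq_singleton_iff_unique_mem.2 ⟨hA.1, h⟩)
  obtain ⟨u, hu, huc⟩ : ∃ u ∈ A, G.Adj u c := by
    obtain ⟨p⟩ := hG.1 x c
    induction p with
    | nil => exact (hxc rfl).elim
    | cons h p ih =>
      rename_i a b c
      have hb := hA.2 a hx hxc b h
      by_cases hbc : b = c
      · exact ⟨a, hx, hbc ▸ h⟩
      · exact ih hA hc hne hb hbc
  obtain ⟨B, hB, huB, hcB⟩ := exists_block huc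
  have hBA := hG.block_subset_rooted hA hB hu huB huc.ne
  obtain ⟨s, s', hE⟩ := hG.exists_blockEnds hT hB
  rcases (hE.nodal c hcB).1 hc with rfl | rfl
  · exact ⟨B, s', _, _, hG.node hA hE hBA⟩
  · exact ⟨B, s, _, _, hG.node hA hE.symm hBA⟩

end IsSemiTwoTree

namespace BlockEnds

variable {B : Set V} {s s' : V}

theorem nodal_left (h : BlockEnds G T B s s') : Nodal G s := (h.nodal s h.mem).2 (.inl rfl)

theorem nodal_right (h : BlockEnds G T B s s') : Nodal G s' := h.symm.nodal_left

theorem chain_lev (h : BlockEnds G T B s s') (hG : G.Connected) :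
    ∃ y p N, 1 ≤ N ∧ Chain G y p N ∧ seg y N = B ∧ y 0 = s ∧ y N = s' ∧ lev p N = G.dist s s' ∧
      kap p N = B.ncard - 2 * G.dist s s' ∧ B.ncard = N + 1 := by
  obtain ⟨y, p, N, hN, hC, hseg, rfl, rfl⟩ := h.chain
  have h1 := hC.dist_eq_lev hG (hseg ▸ h.sep) le_rfl
  have hcard : B.ncard = N + 1 := by
    have : seg y N = y '' (Finset.range (N + 1) : Finset ℕ) := by
      ext v
      simp [seg]
    rw [← hseg, this, Set.InjOn.ncard_image, Set.ncard_coe_finset, Finset.card_range]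
    intro i hi j hj hij
    simp only [Finset.coe_range, Set.mem_Iio] at hi hj
    exact hC.inj i j (by omega) (by omega) hij
  refine ⟨y, p, N, hN, hC, hseg, rfl, rfl, h1.symm, ?_, hcard⟩
  have := hC.parents.kap_eq hN
  omega

theorem two_dist_le (h : BlockEnds G T B s s') (hG : G.Connected) : 2 * G.dist s s' ≤ B.ncard := by
  obtain ⟨y, p, N, hN, hC, hseg, h0, h1, hl, hk, hcard⟩ := h.chain_lev hG
  have := hC.parents.two_lev_le N
  omega

theorem up [Fintype V] (h : BlockEnds G T B s s') (hG : G.Connected) :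
    Up G B s' (G.dist s s') (B.ncard - 2 * G.dist s s') := by
  obtain ⟨y, p, N, hN, hC, rfl, h0, rfl, hl, hk, -⟩ := h.chain_lev hG
  rw [← hk, ← hl]
  exact hC.up le_rfl

theorem low [Fintype V] (h : BlockEnds G T B s s') (hG : G.Connected) :
    Low G B s s' (G.dist s s') (B.ncard - 2 * G.dist s s') := by
  obtain ⟨y, p, N, hN, hC, rfl, rfl, rfl, hl, hk, -⟩ := h.chain_lev hG
  rw [← hk, ← hl]
  exact hC.low le_rfl

theorem reach [Fintype V] (h : BlockEnds G T B s s') (hG : G.Connected) :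
    Reach G (sg s (2 ^ G.dist s s')) (sg s' 1) := by
  obtain ⟨y, p, N, hN, hC, rfl, rfl, rfl, hl, hk, -⟩ := h.chain_lev hG
  rw [← hl]
  exact hC.reach_lev le_rfl

theorem ncard_edges (h : BlockEnds G T B s s') :
    {e ∈ T.edgeSet | ∀ x ∈ e, x ∈ B}.ncard = G.dist s s' := by
  obtain ⟨w, h0, h1, h2, h3, h4, h5⟩ := h.spine
  have : {e ∈ T.edgeSet | ∀ x ∈ e, x ∈ B} =
      (fun i => s(w i, w (i + 1))) '' (Finset.range (G.dist s s') : Finset ℕ) := by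
    ext e
    induction e with
    | _ u v =>
    constructor
    · rintro ⟨he, hB⟩
      obtain ⟨i, hi, h⟩ := h5 u v (hB u (by simp)) (hB v (by simp)) he
      exact ⟨i, by simpa using hi, h.symm⟩
    · rintro ⟨i, hi, h⟩
      simp only [Finset.coe_range, Set.mem_Iio] at hi
      rw [← h]
      refine ⟨h4 i hi, fun x hx => ?_⟩
      rcases Sym2.mem_iff.1 hx with rfl | rfl
      · exact h3 _ (by omega)
      · exact h3 _ (by omega)
  rw [this, Set.InjOn.ncard_image, Set.ncard_coe_finset, Finset.card_range]
  intro i hi j hj hij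
  simp only [Finset.coe_range, Set.mem_Iio] at hi hj
  rcases Sym2.eq_iff.1 hij with h | h
  · exact h2 _ _ (by omega) (by omega) h.1
  · have := h2 _ _ (by omega) (by omega) h.1
    have := h2 _ _ (by omega) (by omega) h.2
    omega

/-- The vertex set of the spine, with its pebbling properties. -/
theorem exists_spine [Fintype V] (h : BlockEnds G T B s s') :
    ∃ W : Set V, W ⊆ B ∧ s ∈ W ∧ s' ∈ W ∧ W ⊆ T.support ∧
      (∀ u v, u ∈ B → v ∈ B → T.Adj u v → u ∈ W) ∧
      Up T W s (G.dist s s') 0 ∧ Low T W s s' (G.dist s s') 0 ∧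
      Reach T (sg s' (2 ^ G.dist s s')) (sg s 1) := by
  obtain ⟨w, h0, h1, h2, h3, h4, h5⟩ := h.symm.spine
  rw [SimpleGraph.dist_comm (u := s') (v := s)] at h1 h2 h3 h4 h5
  set d := G.dist s s' with hd
  have hup : ∀ i ≤ d, Up T (seg w i) (w i) i 0 := by
    intro i hi
    induction i with
    | zero => rw [seg_zero]; exact Up.single _ _
    | succ i ih =>
      rw [seg_succ]
      exact (ih (by omega)).edge (h4 i (by omega))
  have hlow : ∀ i ≤ d, Low T (seg w i) (w i) (w 0) i 0 := by
    intro i hi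
    induction i with
    | zero => rw [seg_zero]; exact Low.single _ _
    | succ i ih =>
      have hne : w i ≠ w (i + 1) := (h4 i (by omega)).ne
      have hcut : CutAt T (seg w i) {w i, w (i + 1)} (w i) := by
        have hwi : w (i + 1) ∉ seg w i := by
          rintro ⟨j, hj, hj'⟩
          have := h2 _ _ (by omega) (by omega) hj'
          omega
        refine ⟨mem_seg le_rfl, by simp, ?_, ?_⟩
        · rintro v hv (rfl | rfl)
          · rfl
          · exact (hwi hv).elim
        · have key : ∀ u v, T.Adj u v → u ∈ seg w i → v = w (i + 1) → u = w i := by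
            rintro u v huv ⟨j, hj, rfl⟩ rfl
            obtain ⟨k, hk, he⟩ := h5 _ _ (h3 j (by omega)) (h3 (i + 1) hi) huv
            rcases Sym2.eq_iff.1 he with h | h
            · have := h2 _ _ (by omega) (by omega) h.1
              have := h2 _ _ (by omega) (by omega) h.2
              congr 1; omega
            · have := h2 _ _ (by omega) (by omega) h.1
              have := h2 _ _ (by omega) (by omega) h.2
              omega
          intro u v huv hu hv
          have hor : ∀ z, z ∈ seg w i ∪ {w i, w (i + 1)} → z ∈ seg w i ∨ z = w (i + 1) := by
            rintro z (h | rfl | rfl)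
            · exact .inl h
            · exact .inl (mem_seg le_rfl)
            · exact .inr rfl
          rcases hor u hu with h | rfl <;> rcases hor v hv with h' | rfl
          · exact .inl ⟨h, h'⟩
          · right; rw [key _ _ huv h rfl]; simp
          · right; rw [key _ _ huv.symm h' rfl]; simp
          · exact (huv.ne rfl).elim
      have := Low.series hcut (by simp) (mem_seg (Nat.zero_le i)) (ih (by omega))
        (Low.edge hne)
      rw [seg_succ]
      convert this using 1
      ext v
      simp only [Set.mem_insert_iff, Set.mem_union, Set.mem_singleton_iff]
      have := mem_seg (y := w) (le_refl i)
      constructor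
      · tauto
      · rintro (h | rfl | rfl)
        · exact .inr h
        · exact .inr this
        · exact .inl rfl
  have hpos : 1 ≤ d := by
    rcases Nat.eq_zero_or_pos d with h' | h'
    · rw [h'] at h1; exact (h.ne (h1.symm.trans h0)).elim
    · exact h'
  refine ⟨seg w d, ?_, h1 ▸ mem_seg le_rfl, h0 ▸ mem_seg (Nat.zero_le _), ?_, ?_,
    h1 ▸ hup d le_rfl, ?_, ?_⟩
  · rintro v ⟨i, hi, rfl⟩; exact h3 i hi
  · rintro v ⟨i, hi, rfl⟩
    rcases Nat.lt_or_ge i d with h | h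
    · exact ⟨_, h4 i h⟩
    · refine ⟨w (i - 1), ?_⟩
      have := h4 (i - 1) (by omega)
      rw [Nat.sub_add_cancel (by omega)] at this
      exact this.symm
  · intro u v hu hv huv
    obtain ⟨i, hi, he⟩ := h5 u v hu hv huv
    rcases Sym2.eq_iff.1 he with h | h
    · rw [h.1]; exact mem_seg (by omega)
    · rw [h.1]; exact mem_seg (by omega)
  · have := hlow d le_rfl
    rwa [h0, h1] at this
  · have : ∀ i ≤ d, Reach T (sg (w 0) (2 ^ i)) (sg (w i) 1) := by
      intro i hi
      induction i with
      | zero => exact Reach.refl _ _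
      | succ i ih =>
        have h6 := (ih (by omega)).smul 2
        rw [Nat.mul_comm, ← pow_succ] at h6
        exact h6.trans (Reach.step (h4 i (by omega)) 1)
    have := this d le_rfl
    rwa [h0, h1] at this

end BlockEnds
end Node

section Branch

variable {V : Type} {G T : SimpleGraph V}

namespace Node

variable {A B A₁ A₂ : Set V} {c c' : V}

theorem left_notMem (h : Node G T A c B c' A₁ A₂) : c ∉ A₁ :=
  fun hc => h.ends.ne (h.inter₁ c hc h.ends.mem)

theorem right_notMem (h : Node G T A c B c' A₁ A₂) : c' ∉ A₂ :=
  fun hc => h.ends.ne (h.inter₂ c' hc h.ends.symm.mem).symm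

theorem sub₁ (h : Node G T A c B c' A₁ A₂) : A₁ ⊆ A := fun _ hv => h.union ▸ .inl (.inl hv)

theorem subB (h : Node G T A c B c' A₁ A₂) : B ⊆ A := fun _ hv => h.union ▸ .inl (.inr hv)

theorem sub₂ (h : Node G T A c B c' A₁ A₂) : A₂ ⊆ A := fun _ hv => h.union ▸ .inr hv

theorem cut₁ (h : Node G T A c B c' A₁ A₂) {H : SimpleGraph V} (hH : H ≤ G) {X₁ W : Set V}
    (hX : X₁ ⊆ A₁) (hW : W ⊆ B) (h1 : c' ∈ X₁) (h2 : c' ∈ W) : CutAt H X₁ W c' := by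
  have hA : ∀ v, v ∈ X₁ ∪ W → v ∈ A := by
    rintro v (hv | hv)
    · exact h.sub₁ (hX hv)
    · exact h.subB (hW hv)
  refine ⟨h1, h2, fun v hv hv' => h.inter₁ v (hX hv) (hW hv'), fun u v huv hu hv => ?_⟩
  have kB : ∀ w, w ∈ X₁ ∪ W → w ∈ B → w ∈ W := by
    rintro w (hw | hw) hwB
    · rwa [h.inter₁ w (hX hw) hwB]
    · exact hw
  have k1 : ∀ w, w ∈ X₁ ∪ W → w ∈ A₁ → w ∈ X₁ := by
    rintro w (hw | hw) hwA
    · exact hw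
    · rwa [h.inter₁ w hwA (hW hw)]
  have k2 : ∀ w, w ∈ X₁ ∪ W → w ∈ A₂ → w = c := by
    rintro w (hw | hw) hwA
    · exact (h.disj w (hX hw) hwA).elim
    · exact h.inter₂ w hwA (hW hw)
  rcases h.edges u v (hH huv) (hA u hu) (hA v hv) with ⟨ha, hb⟩ | ⟨ha, hb⟩ | ⟨ha, hb⟩
  · exact .inr ⟨kB u hu ha, kB v hv hb⟩
  · exact .inl ⟨k1 u hu ha, k1 v hv hb⟩
  · exact (huv.ne ((k2 u hu ha).trans (k2 v hv hb).symm)).elim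

theorem cut₂ (h : Node G T A c B c' A₁ A₂) {H : SimpleGraph V} (hH : H ≤ G) {X₁ W X₂ : Set V}
    (hX₁ : X₁ ⊆ A₁) (hW : W ⊆ B) (hX₂ : X₂ ⊆ A₂) (h2 : c ∈ W) (h3 : c ∈ X₂) :
    CutAt H X₂ (X₁ ∪ W) c := by
  have k2 : ∀ w, w ∈ X₁ ∪ W → w ∈ A₂ → w = c := by
    rintro w (hw | hw) hwA
    · exact (h.disj w (hX₁ hw) hwA).elim
    · exact h.inter₂ w hwA (hW hw)
  have hA : ∀ v, v ∈ X₂ ∪ (X₁ ∪ W) → v ∈ A := by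
    rintro v (hv | hv | hv)
    · exact h.sub₂ (hX₂ hv)
    · exact h.sub₁ (hX₁ hv)
    · exact h.subB (hW hv)
  refine ⟨h3, .inr h2, fun v hv hv' => k2 v hv' (hX₂ hv), fun u v huv hu hv => ?_⟩
  have kB : ∀ w, w ∈ X₂ ∪ (X₁ ∪ W) → w ∈ B → w ∈ X₁ ∪ W := by
    rintro w (hw | hw) hwB
    · right; rwa [h.inter₂ w (hX₂ hw) hwB]
    · exact hw
  have k1 : ∀ w, w ∈ X₂ ∪ (X₁ ∪ W) → w ∈ A₁ → w ∈ X₁ ∪ W := by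
    rintro w (hw | hw) hwA
    · exact (h.disj w hwA (hX₂ hw)).elim
    · exact hw
  have k3 : ∀ w, w ∈ X₂ ∪ (X₁ ∪ W) → w ∈ A₂ → w ∈ X₂ := by
    rintro w (hw | hw) hwA
    · exact hw
    · rwa [k2 w hw hwA]
  rcases h.edges u v (hH huv) (hA u hu) (hA v hv) with ⟨ha, hb⟩ | ⟨ha, hb⟩ | ⟨ha, hb⟩
  · exact .inr ⟨kB u hu ha, kB v hv hb⟩
  · exact .inr ⟨k1 u hu ha, k1 v hv hb⟩
  · exact .inl ⟨k3 u hu ha, k3 v hv hb⟩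

theorem dist_left (h : Node G T A c B c' A₁ A₂) (hG : G.Connected) {x : V} (hx : x ∈ A₁) :
    G.dist c x = G.dist c c' + G.dist c' x := by
  have := h.root₁.dist_eq hG hx h.left_notMem
  rw [SimpleGraph.dist_comm (u := c) (v := x), this, SimpleGraph.dist_comm (u := x),
    SimpleGraph.dist_comm (u := c') (v := c), add_comm]

theorem dist_cross (h : Node G T A c B c' A₁ A₂) (hG : G.Connected) {x y : V} (hx : x ∈ A₁)
    (hy : y ∈ A₂) : G.dist x y = G.dist c' x + G.dist c c' + G.dist c y := by
  have h1 := h.root₁.dist_eq hG hx fun h' => h.disj y h' hy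
  have h2 := h.root₂.dist_eq hG hy h.right_notMem
  rw [SimpleGraph.dist_comm (u := x) (v := c')] at h1
  rw [SimpleGraph.dist_comm (u := y) (v := c'), SimpleGraph.dist_comm (u := y)] at h2
  omega

theorem four_point (h : Node G T A c B c' A₁ A₂) (hG : G.Connected) {x y w : V}
    (h₁ : x ∈ A₁ → y ∈ A₁ → w ∈ A₁ → G.dist c' x + G.dist y w ≤
      max (G.dist c' y + G.dist x w) (G.dist c' w + G.dist x y))
    (h₂ : x ∈ A₂ → y ∈ A₂ → w ∈ A₂ → G.dist c x + G.dist y w ≤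
      max (G.dist c y + G.dist x w) (G.dist c w + G.dist x y))
    (hx : x ∈ A₁ ∨ x ∈ A₂) (hy : y ∈ A₁ ∨ y ∈ A₂) (hw : w ∈ A₁ ∨ w ∈ A₂) :
    G.dist c x + G.dist y w ≤ max (G.dist c y + G.dist x w) (G.dist c w + G.dist x y) := by
  have t1 : G.dist y w ≤ G.dist y c + G.dist c w := hG.dist_triangle
  have t2 : G.dist y w ≤ G.dist y c' + G.dist c' w := hG.dist_triangle
  rw [SimpleGraph.dist_comm (u := y) (v := c)] at t1
  rw [SimpleGraph.dist_comm (u := y) (v := c')] at t2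
  have cxy := SimpleGraph.dist_comm (G := G) (u := x) (v := y)
  have cxw := SimpleGraph.dist_comm (G := G) (u := x) (v := w)
  have cyw := SimpleGraph.dist_comm (G := G) (u := y) (v := w)
  rcases hx with hx | hx <;> rcases hy with hy | hy <;> rcases hw with hw | hw
  · have := h₁ hx hy hw
    have := h.dist_left hG hx
    have := h.dist_left hG hy
    have := h.dist_left hG hw
    omega
  · have := h.dist_left hG hx
    have := h.dist_left hG hy
    have := h.dist_cross hG hx hw
    have := h.dist_cross hG hy hw
    omega
  · have := h.dist_left hG hx
    have := h.dist_left hG hw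
    have := h.dist_cross hG hx hy
    have := h.dist_cross hG hw hy
    omega
  · have := h.dist_left hG hx
    have := h.dist_cross hG hx hy
    have := h.dist_cross hG hx hw
    omega
  · have := h.dist_left hG hy
    have := h.dist_left hG hw
    have := h.dist_cross hG hy hx
    have := h.dist_cross hG hw hx
    omega
  · have := h.dist_left hG hy
    have := h.dist_cross hG hy hx
    have := h.dist_cross hG hy hw
    omega
  · have := h.dist_left hG hw
    have := h.dist_cross hG hw hx
    have := h.dist_cross hG hw hy
    omega
  · exact h₂ hx hy hw

theorem mem_of_nodal (h : Node G T A c B c' A₁ A₂) {v : V} (hv : v ∈ A) (hn : Nodal G v) :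
    v ∈ A₁ ∨ v ∈ A₂ := by
  rw [← h.union] at hv
  rcases hv with (hv | hv) | hv
  · exact .inl hv
  · rcases (h.ends.nodal v hv).1 hn with rfl | rfl
    · exact .inr h.root₂.1
    · exact .inl h.root₁.1
  · exact .inr hv

variable [Fintype V]

theorem ncard (h : Node G T A c B c' A₁ A₂) : A.ncard + 2 = A₁.ncard + B.ncard + A₂.ncard := by
  have i1 : A₁ ∩ B = {c'} := by
    ext v
    constructor
    · rintro ⟨h1, h2⟩; exact h.inter₁ v h1 h2
    · rintro rfl; exact ⟨h.root₁.1, h.ends.symm.mem⟩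
  have i2 : (A₁ ∪ B) ∩ A₂ = {c} := by
    ext v
    constructor
    · rintro ⟨h1 | h1, h2⟩
      · exact (h.disj v h1 h2).elim
      · exact h.inter₂ v h2 h1
    · rintro rfl; exact ⟨.inr h.ends.mem, h.root₂.1⟩
  have e1 := Set.ncard_union_add_ncard_inter A₁ B
  have e2 := Set.ncard_union_add_ncard_inter (A₁ ∪ B) A₂
  rw [i1, Set.ncard_singleton] at e1
  rw [i2, Set.ncard_singleton, h.union] at e2
  omega

theorem ncard_edges (h : Node G T A c B c' A₁ A₂) (hT : T ≤ G) :
    {e ∈ T.edgeSet | ∀ x ∈ e, x ∈ A}.ncard = {e ∈ T.edgeSet | ∀ x ∈ e, x ∈ A₁}.ncard +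
      {e ∈ T.edgeSet | ∀ x ∈ e, x ∈ A₂}.ncard + G.dist c c' := by
  rw [← h.ends.ncard_edges, ← Set.ncard_union_eq, ← Set.ncard_union_eq]
  · congr 1
    ext e
    induction e with
    | _ u v =>
    simp only [Set.mem_union, Set.mem_ofPred_eq, SimpleGraph.mem_edgeSet, Sym2.mem_iff,
      forall_eq_or_imp, forall_eq]
    constructor
    · rintro ⟨he, hu, hv⟩
      have := h.edges u v (hT he) hu hv
      tauto
    · rintro ((⟨he, hu, hv⟩ | ⟨he, hu, hv⟩) | ⟨he, hu, hv⟩)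
      · exact ⟨he, h.sub₁ hu, h.sub₁ hv⟩
      · exact ⟨he, h.sub₂ hu, h.sub₂ hv⟩
      · exact ⟨he, h.subB hu, h.subB hv⟩
  · rw [Set.disjoint_left]
    intro e
    induction e with
    | _ u v =>
    simp only [Set.mem_union, Set.mem_ofPred_eq, SimpleGraph.mem_edgeSet, Sym2.mem_iff,
      forall_eq_or_imp, forall_eq]
    rintro (⟨he, hu, hv⟩ | ⟨he, hu, hv⟩) ⟨-, hu', hv'⟩
    · exact he.ne ((h.inter₁ u hu hu').trans (h.inter₁ v hv hv').symm)
    · exact he.ne ((h.inter₂ u hu hu').trans (h.inter₂ v hv hv').symm)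
  · rw [Set.disjoint_left]
    intro e
    induction e with
    | _ u v =>
    rintro ⟨-, h1⟩ ⟨-, h2⟩
    exact h.disj u (h1 u (by simp)) (h2 u (by simp))

theorem ncard_blocks (h : Node G T A c B c' A₁ A₂) (hG : IsSemiTwoTree G) (hT : IsSkeleton G T) :
    {X | IsBlockOf G X ∧ X ⊆ A}.ncard = {X | IsBlockOf G X ∧ X ⊆ A₁}.ncard +
      {X | IsBlockOf G X ∧ X ⊆ A₂}.ncard + 1 := by
  rw [← Set.ncard_singleton B, ← Set.ncard_union_eq, ← Set.ncard_union_eq]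
  · congr 1
    ext X
    simp only [Set.mem_union, Set.mem_ofPred_eq, Set.mem_singleton_iff]
    constructor
    · rintro ⟨hX, hXA⟩
      by_cases h1 : ∃ u ∈ X, u ∈ A₁ ∧ u ≠ c'
      · obtain ⟨u, hu, hu1, huc⟩ := h1
        exact .inl (.inl ⟨hX, hG.block_subset_rooted h.root₁ hX hu1 hu huc⟩)
      by_cases h2 : ∃ u ∈ X, u ∈ A₂ ∧ u ≠ c
      · obtain ⟨u, hu, hu1, huc⟩ := h2
        exact .inl (.inr ⟨hX, hG.block_subset_rooted h.root₂ hX hu1 hu huc⟩)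
      push Not at h1 h2
      have hXB : X ⊆ B := by
        intro v hv
        have := hXA hv
        rw [← h.union] at this
        rcases this with (hv' | hv') | hv'
        · rw [h1 v hv hv']; exact h.ends.symm.mem
        · exact hv'
        · rw [h2 v hv hv']; exact h.ends.mem
      obtain ⟨s, s', hs⟩ := hG.exists_blockEnds hT hX
      exact .inr (hG.block_eq hX h.ends.block hs.ne hs.mem hs.symm.mem (hXB hs.mem)
        (hXB hs.symm.mem))
    · rintro ((⟨hX, hXA⟩ | ⟨hX, hXA⟩) | rfl)
      · exact ⟨hX, hXA.trans h.sub₁⟩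
      · exact ⟨hX, hXA.trans h.sub₂⟩
      · exact ⟨h.ends.block, h.subB⟩
  · rw [Set.disjoint_singleton_right]
    rintro (⟨-, hB⟩ | ⟨-, hB⟩)
    · exact h.left_notMem (hB h.ends.mem)
    · exact h.right_notMem (hB h.ends.symm.mem)
  · rw [Set.disjoint_left]
    rintro X ⟨hX, h1⟩ ⟨-, h2⟩
    obtain ⟨s, s', hs⟩ := hG.exists_blockEnds hT hX
    exact h.disj s (h1 hs.mem) (h2 hs.mem)

end Node

/-- Pebbling and counting data of a part `A` of `G` rooted at `c`: `A'` is the part of the skeleton,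
`t * 2 ^ e + κ` the pebbling function of the latter and `F` the surplus of `G`. -/
structure Branch [Fintype V] (G T : SimpleGraph V) (A : Set V) (c : V) (e κ F : ℕ) (A' : Set V) :
    Prop where
  upG : Up G A c e (κ + F)
  upT : Up T A' c e κ
  lowT : ∃ z ∈ A', Low T A' c z e κ
  lowG : ∀ z ∈ A, Nodal G z → G.dist c z = e → Low G A c z e (κ + F) ∧ Low G A z c e (κ + F)
  le : ∀ x ∈ A, G.dist c x ≤ e
  tip : ∃ z ∈ A, Nodal G z ∧ G.dist c z = e
  four : ∀ x ∈ A, ∀ y ∈ A, ∀ w ∈ A, Nodal G x → Nodal G y → Nodal G w →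
    G.dist c x + G.dist y w ≤ max (G.dist c y + G.dist x w) (G.dist c w + G.dist x y)
  count : F + 2 * {e ∈ T.edgeSet | ∀ x ∈ e, x ∈ A}.ncard + 1 =
    A.ncard + {X | IsBlockOf G X ∧ X ⊆ A}.ncard
  sub : A' ⊆ A
  mem : c ∈ A'
  adj : ∀ u v, u ∈ A → v ∈ A → T.Adj u v → u ∈ A'
  supp : A' ⊆ insert c T.support

theorem Branch.single [Fintype V] (hG : IsSemiTwoTree G) (hT : IsSkeleton G T) {c : V}
    (hc : Nodal G c) : Branch G T {c} c 0 0 0 {c} where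
  upG := Up.single _ _
  upT := Up.single _ _
  lowT := ⟨c, rfl, Low.single _ _⟩
  lowG := by
    rintro z rfl - -
    exact ⟨Low.single _ _, Low.single _ _⟩
  le := by rintro x rfl; simp
  tip := ⟨c, rfl, hc, by simp⟩
  four := by rintro x rfl y rfl w rfl - - -; simp
  count := by
    have h1 : {e ∈ T.edgeSet | ∀ x ∈ e, x ∈ ({c} : Set V)} = ∅ := by
      rw [Set.eq_empty_iff_forall_notMem]
      intro e
      induction e with
      | _ u v =>
      rintro ⟨he, h⟩
      exact (SimpleGraph.Adj.ne he) ((h u (by simp)).trans (h v (by simp)).symm)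
    have h2 : {X | IsBlockOf G X ∧ X ⊆ {c}} = ∅ := by
      rw [Set.eq_empty_iff_forall_notMem]
      rintro X ⟨hX, h⟩
      obtain ⟨s, s', hs⟩ := hG.exists_blockEnds hT hX
      exact hs.ne ((h hs.mem).trans (h hs.symm.mem).symm)
    rw [h1, h2]
    simp
  sub := subset_rfl
  mem := rfl
  adj := by rintro u v hu - -; exact hu
  supp := by rintro v rfl; exact .inl rfl

end Branch

section Grow

variable {V : Type} [Fintype V] {G T : SimpleGraph V} {A B A₁ A₂ : Set V} {c c' : V}

theorem Node.branch (h : Node G T A c B c' A₁ A₂) (hG : IsSemiTwoTree G) (hT : IsSkeleton G T)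
    {e₁ κ₁ F₁ e₂ κ₂ F₂ : ℕ} {A₁' A₂' : Set V} (h₁ : Branch G T A₁ c' e₁ κ₁ F₁ A₁')
    (h₂ : Branch G T A₂ c e₂ κ₂ F₂ A₂') : ∃ e κ F A', Branch G T A c e κ F A' := by
  obtain ⟨W, hWB, hcW, hcW', hWT, hWadj, hWup, hWlow, hWreach⟩ := h.ends.exists_spine
  have hd := h.ends.two_dist_le hG.1
  set d := G.dist c c' with hdd
  have hp := Nat.two_pow_pos (min (e₁ + d) e₂)
  have hcd : G.dist c' c = d := SimpleGraph.dist_comm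
  have low' : Low G B c' c d (B.ncard - 2 * d) := hcd ▸ h.ends.symm.low hG.1
  have up' : Up G B c d (B.ncard - 2 * d) := hcd ▸ h.ends.symm.up hG.1
  have reach' : Reach G (sg c' (2 ^ d)) (sg c 1) := hcd ▸ h.ends.symm.reach hG.1
  obtain ⟨z₁, hz₁, hz₁n, hz₁d⟩ := h₁.tip
  obtain ⟨z₂, hz₂, hz₂n, hz₂d⟩ := h₂.tip
  have cut₁ := h.cut₁ le_rfl subset_rfl subset_rfl h.root₁.1 h.ends.symm.mem
  have cut₂ := h.cut₂ le_rfl subset_rfl subset_rfl subset_rfl h.ends.mem h.root₂.1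
  have low₁ : ∀ z ∈ A₁, Nodal G z → G.dist c' z = e₁ →
      Low G (A₁ ∪ B) c z (e₁ + d) (κ₁ + F₁ + (B.ncard - 2 * d)) ∧
      Low G (A₁ ∪ B) z c (e₁ + d) (κ₁ + F₁ + (B.ncard - 2 * d)) := by
    intro z hz hn hzd
    obtain ⟨l1, l2⟩ := h₁.lowG z hz hn hzd
    refine ⟨Low.series cut₁ h.ends.mem hz l1 (h.ends.low hG.1), ?_⟩
    have := Low.series cut₁.symm hz h.ends.mem low' l2
    rwa [Set.union_comm, add_comm d, add_comm (B.ncard - 2 * d)] at this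
  have dist₁ : ∀ x ∈ A₁, G.dist c x = d + G.dist c' x := fun x hx => h.dist_left hG.1 hx
  refine ⟨max (e₁ + d) e₂, κ₁ + κ₂ + 2 ^ min (e₁ + d) e₂ - 1, F₁ + F₂ + (B.ncard - 2 * d),
    A₁' ∪ W ∪ A₂', ?_, ?_, ?_, ?_, ?_, ?_, ?_, ?_, ?_, .inl (.inr hcW), ?_, ?_⟩
  · rw [← h.union]
    have := (h₁.upG.extend up' h.ends.symm.mem reach').wedge h₂.upG
    exact this.mono_num (by omega)
  · simpa using (h₁.upT.extend hWup hcW' hWreach).wedge h₂.upT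
  · obtain ⟨w₁, hw₁, l₁⟩ := h₁.lowT
    obtain ⟨w₂, hw₂, l₂⟩ := h₂.lowT
    have tcut₁ := h.cut₁ hT.1 h₁.sub hWB h₁.mem hcW'
    have tcut₂ := h.cut₂ hT.1 h₁.sub hWB h₂.sub hcW h₂.mem
    have l := Low.series tcut₁ hcW hw₁ l₁ hWlow
    rw [add_zero] at l
    rcases le_total e₂ (e₁ + d) with he | he
    · rw [max_eq_left he, min_eq_right he]
      refine ⟨w₁, .inl (.inl hw₁), ?_⟩
      have := Low.hang tcut₂ (.inr hcW) (.inl hw₁) hw₂ l l₂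
      rwa [Set.union_comm] at this
    · rw [max_eq_right he, min_eq_left he]
      refine ⟨w₂, .inr hw₂, ?_⟩
      have := Low.hang tcut₂.symm h₂.mem hw₂ (.inl hw₁) l₂ l
      rwa [add_comm κ₂] at this
  · intro z hz hn hzd
    have hKF : ∀ p, 0 < p → κ₁ + F₁ + (B.ncard - 2 * d) + (κ₂ + F₂) + p - 1 =
      κ₁ + κ₂ + p - 1 + (F₁ + F₂ + (B.ncard - 2 * d)) := by intro p hp; omega
    have hKF' : ∀ p, 0 < p → κ₂ + F₂ + (κ₁ + F₁ + (B.ncard - 2 * d)) + p - 1 =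
      κ₁ + κ₂ + p - 1 + (F₁ + F₂ + (B.ncard - 2 * d)) := by intro p hp; omega
    rw [← hKF _ hp]
    rcases h.mem_of_nodal hz hn with hz | hz
    · have h1 := h₁.le z hz
      have h2 := dist₁ z hz
      have he : e₂ ≤ e₁ + d := by omega
      obtain ⟨l1, l2⟩ := low₁ z hz hn (by omega)
      obtain ⟨k1, k2⟩ := h₂.lowG z₂ hz₂ hz₂n hz₂d
      rw [max_eq_left he, min_eq_right he, ← h.union, Set.union_comm _ A₂]
      exact ⟨Low.hang cut₂ (.inr h.ends.mem) (.inl hz) hz₂ l1 k1,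
        Low.hang cut₂ (.inl hz) (.inr h.ends.mem) hz₂ l2 k1⟩
    · have h1 := h₂.le z hz
      have he : e₁ + d ≤ e₂ := by omega
      obtain ⟨l1, l2⟩ := low₁ z₁ hz₁ hz₁n hz₁d
      obtain ⟨k1, k2⟩ := h₂.lowG z hz hn (by omega)
      rw [hKF _ hp, ← hKF' _ hp, max_eq_right he, min_eq_left he, ← h.union]
      exact ⟨Low.hang cut₂.symm h.root₂.1 hz (.inl hz₁) k1 l1,
        Low.hang cut₂.symm hz h.root₂.1 (.inl hz₁) k2 l1⟩
  · intro x hx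
    rw [← h.union] at hx
    rcases hx with (hx | hx) | hx
    · have := h₁.le x hx
      have := dist₁ x hx
      omega
    · have := h.ends.diam c h.ends.mem x hx
      omega
    · have := h₂.le x hx
      omega
  · rcases le_total e₂ (e₁ + d) with he | he
    · refine ⟨z₁, h.sub₁ hz₁, hz₁n, ?_⟩
      have := dist₁ z₁ hz₁
      omega
    · refine ⟨z₂, h.sub₂ hz₂, hz₂n, ?_⟩
      omega
  · intro x hx y hy w hw nx ny nw
    exact h.four_point hG.1 (fun h1 h2 h3 => h₁.four x h1 y h2 w h3 nx ny nw)
      (fun h1 h2 h3 => h₂.four x h1 y h2 w h3 nx ny nw) (h.mem_of_nodal hx nx)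
      (h.mem_of_nodal hy ny) (h.mem_of_nodal hw nw)
  · have k1 := h₁.count
    have k2 := h₂.count
    have k3 := h.ncard
    have k4 := h.ncard_edges hT.1
    have k5 := h.ncard_blocks hG hT
    omega
  · rintro v ((hv | hv) | hv)
    · exact h.sub₁ (h₁.sub hv)
    · exact h.subB (hWB hv)
    · exact h.sub₂ (h₂.sub hv)
  · intro u v hu hv huv
    rcases h.edges u v (hT.1 huv) hu hv with ⟨ha, hb⟩ | ⟨ha, hb⟩ | ⟨ha, hb⟩
    · exact .inl (.inr (hWadj u v ha hb huv))
    · exact .inl (.inl (h₁.adj u v ha hb huv))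
    · exact .inr (h₂.adj u v ha hb huv)
  · rintro v ((hv | hv) | hv)
    · rcases h₁.supp hv with rfl | hv
      · exact .inr (hWT hcW')
      · exact .inr hv
    · exact .inr (hWT hv)
    · exact h₂.supp hv

theorem IsSemiTwoTree.exists_branch (hG : IsSemiTwoTree G) (hT : IsSkeleton G T)
    (hA : RootedAt G A c) (hc : Nodal G c) : ∃ e κ F A', Branch G T A c e κ F A' := by
  induction hn : A.ncard using Nat.strong_induction_on generalizing A c with
  | _ n ih =>
  subst hn
  by_cases hne : A = {c}
  · subst hne
    exact ⟨_, _, _, _, Branch.single hG hT hc⟩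
  · obtain ⟨B, c', A₁, A₂, h⟩ := hG.exists_node hT hA hc hne
    have s1 : A₁.ncard < A.ncard := Set.ncard_lt_ncard
      (Set.ssubset_iff_of_subset h.sub₁ |>.2 ⟨c, hA.1, h.left_notMem⟩)
    have s2 : A₂.ncard < A.ncard := Set.ncard_lt_ncard
      (Set.ssubset_iff_of_subset h.sub₂ |>.2 ⟨c', h.sub₁ h.root₁.1, h.right_notMem⟩)
    obtain ⟨_, _, _, _, h₁⟩ := ih _ s1 h.root₁ h.ends.nodal_right rfl
    obtain ⟨_, _, _, _, h₂⟩ := ih _ s2 h.root₂ hc rfl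
    exact h.branch hG hT h₁ h₂

end Grow

section Rooted

variable {V : Type}

/-- The pebbling number for configurations supported on `A`. -/
noncomputable def piOn [Fintype V] (H : SimpleGraph V) (A : Set V) (r : V) (t : ℕ) : ℕ :=
  sInf {s | ∀ C : V → ℕ, (∀ v, v ∉ A → C v = 0) → s ≤ ∑ v, C v → TSolvable H C r t}

variable [Fintype V] {H G T : SimpleGraph V} {A : Set V} {r z : V} {e K t : ℕ}

theorem piOn_univ : piOn H Set.univ r t = piT H r t := by
  simp [piOn, piT, finsum_eq_sum_of_fintype]

theorem Up.mem (h : Up H A r e K) (t : ℕ) : t * 2 ^ e + K ∈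
    {s | ∀ C : V → ℕ, (∀ v, v ∉ A → C v = 0) → s ≤ ∑ v, C v → TSolvable H C r t} :=
  fun C hC hs => (Reach.tSolvable_iff).2 (h t C hC hs)

theorem Up.piOn_le (h : Up H A r e K) (t : ℕ) : piOn H A r t ≤ t * 2 ^ e + K :=
  Nat.sInf_le (h.mem t)

theorem Low.le_piOn (h : Low H A r z e K) (hz : z ∈ A) (hH : onSet H A = H) {e' K' : ℕ}
    (h' : Up H A r e' K') (ht : 1 ≤ t) : t * 2 ^ e + K ≤ piOn H A r t := by
  refine le_csInf ⟨_, h'.mem t⟩ fun s hs => ?_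
  by_contra! hlt
  obtain ⟨X, hX, hXs, hXc⟩ := h
  rw [hH] at hXc
  have hp : 0 < t * 2 ^ e := by positivity
  obtain ⟨C', hC', htC⟩ := hs (sg z (t * 2 ^ e - 1) + X) (fun v hv => by
      have hvz : v ≠ z := fun h => hv (h ▸ hz)
      simp [sg_ne hvz, hX v hv]) (by
      simp only [Pi.add_apply, Finset.sum_add_distrib, sum_sg, hXs]
      omega)
  have h1 := hXc _ C' hC'
  have h2 : (t * 2 ^ e - 1) / 2 ^ e < t := by
    rw [Nat.div_lt_iff_lt_mul (Nat.two_pow_pos e)]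
    omega
  omega

theorem tSolvable_induce_support (C : V → ℕ) (hC : ∀ v, v ∉ T.support → C v = 0)
    (hr : r ∈ T.support) : TSolvable (T.induce T.support) (fun v => C v) ⟨r, hr⟩ t ↔
    TSolvable T C r t := by
  classical
  constructor
  · rintro ⟨C', hC', ht⟩
    let ext (D : T.support → ℕ) : V → ℕ := fun v => if h : v ∈ T.support then D ⟨v, h⟩ else 0
    have hext : ∀ D (v : T.support), ext D v = D v := fun D v => dif_pos v.2
    have hext' : ∀ D v, v ∉ T.support → ext D v = 0 := fun D v h => dif_neg h
    have key : ∀ D, Relation.ReflTransGen (PebStep (T.induce T.support)) (fun v => C v) D →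
        Relation.ReflTransGen (PebStep T) C (ext D) := by
      intro D hD
      induction hD with
      | refl =>
        have : ext (fun v => C v) = C := by
          funext v
          by_cases hv : v ∈ T.support
          · exact hext (fun v => C v) ⟨v, hv⟩
          · exact (hext' (fun v => C v) v hv).trans (hC v hv).symm
        rw [this]
      | tail _ hs ih =>
        obtain ⟨u, v, huv, h1, h2, h3, h4⟩ := hs
        refine ih.tail ⟨u, v, huv, by rwa [hext], by rw [hext, hext, h2], by rw [hext, hext, h3],
          fun w hwu hwv => ?_⟩
        by_cases hw : w ∈ T.support
        · have := h4 ⟨w, hw⟩ (fun h => hwu (congrArg Subtype.val h))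
            (fun h => hwv (congrArg Subtype.val h))
          have e1 := fun D => hext D ⟨w, hw⟩
          simp only at e1
          rw [e1, e1, this]
        · rw [hext' _ w hw, hext' _ w hw]
    exact ⟨_, key _ hC', by rwa [hext C' ⟨r, hr⟩]⟩
  · rintro ⟨C', hC', ht⟩
    refine ⟨fun v => C' v, ?_, ht⟩
    clear ht
    induction hC' with
    | refl => exact .refl
    | tail _ hs ih =>
      obtain ⟨u, v, huv, h1, h2, h3, h4⟩ := hs
      exact ih.tail ⟨⟨u, v, huv⟩, ⟨v, u, huv.symm⟩, huv, h1, h2, h3, fun w hwu hwv =>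
        h4 w (fun h => hwu (Subtype.ext h)) (fun h => hwv (Subtype.ext h))⟩

theorem piT_induce_support (hr : r ∈ T.support) :
    piT (T.induce T.support) ⟨r, hr⟩ t = piOn T T.support r t := by
  classical
  have hsum : ∀ C : V → ℕ, (∀ v, v ∉ T.support → C v = 0) →
      ∑ᶠ v : T.support, C v = ∑ v, C v := by
    intro C hC
    rw [finsum_eq_sum_of_fintype, ← finsum_eq_sum_of_fintype, finsum_set_coe_eq_finsum_mem,
      ← finsum_eq_sum_of_fintype]
    refine finsum_congr fun v => ?_
    by_cases hv : v ∈ T.support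
    · simp [hv]
    · simp [hv, hC v hv]
  unfold piT piOn
  congr 1
  ext s
  constructor
  · intro h C hC hs
    exact (tSolvable_induce_support C hC hr).1 (h _ (by rwa [hsum C hC]))
  · intro h C hs
    let C₁ : V → ℕ := fun v => if h : v ∈ T.support then C ⟨v, h⟩ else 0
    have h1 : (fun v : T.support => C₁ v) = C := by
      funext v
      exact dif_pos v.2
    have h2 : ∀ v, v ∉ T.support → C₁ v = 0 := fun v h => dif_neg h
    have := (tSolvable_induce_support C₁ h2 hr).2 (h C₁ h2 (by rwa [← hsum C₁ h2, h1]))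
    rwa [h1] at this

omit [Fintype V] in
theorem rootedAt_univ (G : SimpleGraph V) (c : V) : RootedAt G Set.univ c :=
  ⟨trivial, fun _ _ _ _ _ => trivial⟩

variable {κ F : ℕ} {A' : Set V}

theorem Branch.piT_le (h : Branch G T Set.univ r e κ F A') (t : ℕ) :
    piT G r t ≤ t * 2 ^ e + (κ + F) := piOn_univ (H := G) ▸ h.upG.piOn_le t

theorem Low.le_piT (h : Low G Set.univ r z e K) {e' K' : ℕ} (h' : Up G Set.univ r e' K')
    (ht : 1 ≤ t) : t * 2 ^ e + K ≤ piT G r t :=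
  piOn_univ (H := G) ▸ h.le_piOn trivial (onSet_univ G) h' ht

namespace IsSemiTwoTree

variable (hG : IsSemiTwoTree G) (hT : IsSkeleton G T)
include hG hT

theorem piT_le_of_farthest {r' : V} (hr : Nodal G r) (hr' : Nodal G r')
    (hfar : ∀ x, G.dist r x ≤ G.dist r r') (ht : 1 ≤ t) : piT G r t ≤ piT G r' t := by
  obtain ⟨e, κ, F, A', h⟩ := hG.exists_branch hT (rootedAt_univ G r) hr
  obtain ⟨e', κ', F', A'', h'⟩ := hG.exists_branch hT (rootedAt_univ G r') hr'
  obtain ⟨z, -, -, hz⟩ := h.tip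
  have h1 := h.le r' trivial
  have h2 := hfar z
  exact (h.piT_le t).trans ((h.lowG r' trivial hr' (by omega)).2.le_piT h'.upG ht)

theorem piT_nodal_le {r' w : V} (hr : Nodal G r) (hr' : Nodal G r') (hw : Nodal G w)
    (hmax : ∀ x y, G.dist x y ≤ G.dist r' w) (ht : 1 ≤ t) : piT G r t ≤ piT G r' t := by
  obtain ⟨e, κ, F, A', h⟩ := hG.exists_branch hT (rootedAt_univ G r) hr
  obtain ⟨z, -, hzn, hz⟩ := h.tip
  have h4 := h.four z trivial r' trivial w trivial hzn hr' hw
  have h1 := h.le r' trivial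
  have h2 := h.le w trivial
  have h3 := hmax z w
  have h5 := hmax z r'
  rcases le_max_iff.1 h4 with h4 | h4
  · refine hG.piT_le_of_farthest hT hr hr' (fun x => ?_) ht
    have := h.le x trivial
    omega
  · refine (hG.piT_le_of_farthest hT hr hzn (fun x => ?_) ht).trans
      (hG.piT_le_of_farthest hT hzn hr' (fun x => ?_) ht)
    · have := h.le x trivial
      omega
    · have := hmax z x
      omega

end IsSemiTwoTree

theorem Node.piT_interior_le {B A₁ A₂ : Set V} {c c' : V} (h : Node G T Set.univ c B c' A₁ A₂)
    (hG : IsSemiTwoTree G) (hT : IsSkeleton G T) {e₁ κ₁ F₁ e₂ κ₂ F₂ : ℕ} {A₁' A₂' : Set V}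
    (h₁ : Branch G T A₁ c' e₁ κ₁ F₁ A₁') (h₂ : Branch G T A₂ c e₂ κ₂ F₂ A₂') (hr : r ∈ B)
    (hrc : r ≠ c) (hrc' : r ≠ c') (hord : e₁ + G.dist r c' ≤ e₂ + G.dist c r) (ht : 1 ≤ t) :
    ∃ z, Nodal G z ∧ piT G r t ≤ piT G z t := by
  obtain ⟨z₁, hz₁, hz₁n, hz₁d⟩ := h₁.tip
  obtain ⟨z₂, hz₂, hz₂n, hz₂d⟩ := h₂.tip
  obtain ⟨_, _, _, _, hz⟩ := hG.exists_branch hT (rootedAt_univ G z₁) hz₁n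
  refine ⟨z₁, hz₁n, ?_⟩
  have low' := h.ends.symm.low hG.1
  have cut₁ := h.cut₁ le_rfl subset_rfl subset_rfl h.root₁.1 h.ends.symm.mem
  have cut₂ := h.cut₂ le_rfl subset_rfl subset_rfl subset_rfl h.ends.mem h.root₂.1
  have l := Low.series cut₁.symm hz₁ h.ends.mem low' (h₁.lowG z₁ hz₁ hz₁n hz₁d).2
  rw [Set.union_comm] at l
  have l' := Low.series cut₂ (.inl hz₁) hz₂ (h₂.lowG z₂ hz₂ hz₂n hz₂d).1 l
  rw [Set.union_comm, h.union] at l'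
  have hunion := h.union
  have hsep := h.ends.sep
  obtain ⟨y, p, N, hN, hC, rfl, rfl, rfl, hl, hk, hcard⟩ := h.ends.chain_lev hG.1
  obtain ⟨k, hkN, rfl⟩ := hr
  have hk1 : k ≠ 0 := by rintro rfl; exact hrc rfl
  have hk2 : k ≠ N := by rintro rfl; exact hrc' rfl
  have hu := hC.up_interior (by omega) (by omega) h₂.upG h₁.upG (k := k) (D := G.dist (y k) (y N))
    (fun ψ h0 hψ => by
      have := hC.lipschitz hG.1 hsep ψ hψ hkN le_rfl
      omega) (by rwa [← hC.dist_eq_lev hG.1 hsep hkN])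
  have hset : A₂ ∪ seg y N ∪ A₁ = Set.univ := by
    rw [← hunion, Set.union_assoc, Set.union_comm, Set.union_comm A₁]
  rw [hset] at hu
  have hle := l'.le_piT hz.upG ht
  have hle' := hu.piOn_le t
  rw [SimpleGraph.dist_comm (u := y N) (v := y 0), ← hl, hcard] at hle
  rw [piOn_univ] at hle'
  have he : e₂ + lev p N + e₁ = e₂ + (lev p N + e₁) := add_assoc _ _ _
  rw [he] at hle'
  omega

theorem IsSemiTwoTree.exists_nodal_piT_le (hG : IsSemiTwoTree G) (hT : IsSkeleton G T)
    [Nontrivial V] (r : V) (ht : 1 ≤ t) : ∃ z, Nodal G z ∧ piT G r t ≤ piT G z t := by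
  by_cases hr : Nodal G r
  · exact ⟨r, hr, le_rfl⟩
  obtain ⟨x, hx⟩ := hG.1.preconnected.exists_adj_of_nontrivial r
  obtain ⟨B, hB, hrB, -⟩ := exists_block hx
  obtain ⟨s, s', h⟩ := hG.exists_blockEnds hT hB
  have hs := h.nodal_left
  have hs' := h.nodal_right
  have hrs : r ≠ s := by rintro rfl; exact hr hs
  have hrs' : r ≠ s' := by rintro rfl; exact hr hs'
  have n := hG.node (rootedAt_univ G s) h (Set.subset_univ B)
  have n' := hG.node (rootedAt_univ G s') h.symm (Set.subset_univ B)
  rw [Set.univ_inter] at n n'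
  obtain ⟨e, _, _, _, b⟩ := hG.exists_branch hT n.root₂ hs
  obtain ⟨e', _, _, _, b'⟩ := hG.exists_branch hT n'.root₂ hs'
  have c1 := SimpleGraph.dist_comm (G := G) (u := r) (v := s)
  have c2 := SimpleGraph.dist_comm (G := G) (u := r) (v := s')
  rcases le_total (e' + G.dist r s') (e + G.dist s r) with hord | hord
  · exact n.piT_interior_le hG hT b' b hrB hrs hrs' hord ht
  · exact n'.piT_interior_le hG hT b b' hrB hrs' hrs (by omega) ht

end Rooted

/-- for a semi-2-tree `G`, the `t`-pebbling number is attained at any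
simplicial vertex `r*` of maximum eccentricity, and equals
`π_t(T,r*) + (n−1) + b − 2e(T)` for the skeleton `T`, where `n` is the number of
vertices and `b` the number of blocks of `G`. -/
theorem semiTwoTree_global_pebbling {V : Type} [Fintype V] (G T : SimpleGraph V)
    (hG : IsSemiTwoTree G) (hT : IsSkeleton G T) (rstar : V)
    (hstar : IsSimplicial G rstar) (hecc : eccG G rstar = diamG G)
    (hrT : rstar ∈ T.support)
    (n b t : ℕ) (hn : Fintype.card V = n)
    (hb : {B : Set V | IsBlockOf G B}.ncard = b) (ht : 1 ≤ t) :
    piGt G t = piT G rstar t ∧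
    piGt G t =
      piT (T.induce T.support) ⟨rstar, hrT⟩ t + (n - 1) + b - 2 * T.edgeSet.ncard := by
  have hstar' : Nodal G rstar := IsSimplicial.nodal hstar
  obtain ⟨e, κ, F, A', h⟩ := hG.exists_branch hT (rootedAt_univ G rstar) hstar'
  have : Nonempty V := ⟨rstar⟩
  have : Nontrivial V := by
    obtain ⟨x, hx⟩ := hrT
    exact ⟨rstar, x, hx.ne⟩
  obtain ⟨w, -, hwn, hw⟩ := h.tip
  have hmax : ∀ x y, G.dist x y ≤ G.dist rstar w := by
    intro x y
    have h1 : G.dist x y ≤ eccG G x := le_ciSup (Set.finite_range (G.dist x)).bddAbove y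
    have h2 : eccG G x ≤ diamG G := le_ciSup (Set.finite_range (eccG G)).bddAbove x
    have h3 : eccG G rstar ≤ e := ciSup_le fun v => h.le v trivial
    omega
  have hG' : piGt G t = piT G rstar t := by
    apply le_antisymm
    · refine ciSup_le fun r => ?_
      obtain ⟨z, hz, hle⟩ := hG.exists_nodal_piT_le hT r ht
      exact hle.trans (hG.piT_nodal_le hT hz hstar' hwn hmax ht)
    · exact le_ciSup (f := fun r => piT G r t) (Set.finite_range _).bddAbove rstar
  refine ⟨hG', ?_⟩
  have hval : piT G rstar t = t * 2 ^ e + (κ + F) :=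
    le_antisymm (h.piT_le t) ((h.lowG w trivial hwn hw).1.le_piT h.upG ht)
  have hA' : A' = T.support := by
    ext v
    constructor
    · intro hv
      rcases h.supp hv with rfl | hv
      · exact hrT
      · exact hv
    · rintro ⟨u, hu⟩
      exact h.adj v u trivial trivial hu
  subst hA'
  obtain ⟨z, hz, hlow⟩ := h.lowT
  have hvalT : piT (T.induce T.support) ⟨rstar, hrT⟩ t = t * 2 ^ e + κ := by
    rw [piT_induce_support]
    refine le_antisymm (h.upT.piOn_le t) (hlow.le_piOn hz ?_ h.upT ht)
    ext u v
    exact ⟨fun h => h.1, fun h => ⟨h, ⟨v, h⟩, ⟨u, h.symm⟩⟩⟩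
  have hcount := h.count
  simp only [Set.mem_univ, implies_true, and_true, Set.subset_univ, Set.ncard_univ,
    Nat.card_eq_fintype_card, hn, hb, Set.ofPred_mem_eq] at hcount
  have hpos : 0 < Fintype.card V := Fintype.card_pos
  rw [hG', hval, hvalT]
  omega
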